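/- Let φ ∈ C^∞(ℝ^n_y × ℝ^n_ξ) be real-valued with |det ∂_y∂_ξ φ(y,ξ)| ≥ C₀ > 0 for all (y,ξ), and with every entry h of ∂_y∂_ξ φ satisfying |∂_y^α h| ≤ C_α and |∂_ξ^β h| ≤ C_β for all |α|, |β| ≤ 2n+1. Let a ∈ C^∞(ℝ^n_x × ℝ^n_ξ) satisfy ∂_x^α ∂_ξ^β a ∈ L^∞(ℝ^n_x × ℝ^n_ξ) for all multi-indices α with |α| ≤ ⌊n/2⌋+1 and all β ∈ {0,1}^n, and assume a(x,ξ) = 0 whenever ξ lies outside some compact set K. Then the operator Tu(x) = ∫∫ e^{i(x·ξ + φ(y,ξ))} a(x,ξ) u(y) dy dξ, defined for Schwartz u, satisfies ‖Tu‖_{L²(ℝ^n)} ≤ C ‖u‖_{L²(ℝ^n)}, where C depends only on n, C₀, the phase constants, and the listed L^∞ norms of derivatives of a, and is independent of K. -/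

import Mathlib

open MeasureTheory Complex SchwartzMap
open scoped BigOperators ENNReal Real RealInnerProductSpace

noncomputable section

/-- The derivative of `g` along the direction `v`. -/
def dLine {W F : Type*} [NormedAddCommGroup W] [NormedSpace ℝ W]
    [NormedAddCommGroup F] [NormedSpace ℝ F] (v : W) (g : W → F) : W → F :=
  fun z => fderiv ℝ g z v

/-- The iterated partial derivative `∂^α` along the coordinate directions `dirs`,
with multiplicities given by the multi-index `α`. -/
def mderiv {n : ℕ} {W F : Type*} [NormedAddCommGroup W] [NormedSpace ℝ W]
    [NormedAddCommGroup F] [NormedSpace ℝ F]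
    (dirs : Fin n → W) (α : Fin n → ℕ) (g : W → F) : W → F :=
  ((List.ofFn fun i => (dLine (dirs i) (F := F))^[α i]).foldr (· ∘ ·) id) g

/-- The length `|α|` of a multi-index. -/
def mdeg {n : ℕ} (α : Fin n → ℕ) : ℕ := ∑ i, α i

/-- The first-factor coordinate directions in `ℝ^n × ℝ^n`. -/
def dX {n : ℕ} (i : Fin n) : EuclideanSpace ℝ (Fin n) × EuclideanSpace ℝ (Fin n) :=
  (EuclideanSpace.single i 1, 0)

/-- The second-factor coordinate directions in `ℝ^n × ℝ^n`. -/
def dY {n : ℕ} (j : Fin n) : EuclideanSpace ℝ (Fin n) × EuclideanSpace ℝ (Fin n) :=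
  (0, EuclideanSpace.single j 1)

/-- The entry `∂²φ/∂u_i∂v_j` of the mixed Hessian of a function of two `ℝ^n` variables. -/
def mixedHessXY {n : ℕ}
    (φ : EuclideanSpace ℝ (Fin n) × EuclideanSpace ℝ (Fin n) → ℝ) (i j : Fin n) :
    EuclideanSpace ℝ (Fin n) × EuclideanSpace ℝ (Fin n) → ℝ :=
  dLine (dX i) (dLine (dY j) φ)

/-! ### One dimensional derivative bounds -/

lemma iter_mul_bound (k : ℕ) (f g : ℝ → ℂ) (x : ℝ) (hf : ContDiffAt ℝ k f x)
    (hg : ContDiffAt ℝ k g x) (M1 M2 : ℝ)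
    (h1 : ∀ i ≤ k, ‖iteratedDeriv i f x‖ ≤ M1) (h2 : ∀ i ≤ k, ‖iteratedDeriv i g x‖ ≤ M2) :
    ∀ i ≤ k, ‖iteratedDeriv i (fun t => f t * g t) x‖ ≤ 2 ^ k * (M1 * M2) := by
  intro i hi
  have hM1 : 0 ≤ M1 := (norm_nonneg _).trans (h1 0 (Nat.zero_le _))
  have hM2 : 0 ≤ M2 := (norm_nonneg _).trans (h2 0 (Nat.zero_le _))
  have hik : ((i : ℕ) : WithTop ℕ∞) ≤ ((k : ℕ) : WithTop ℕ∞) := by exact_mod_cast hi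
  have e := iteratedDeriv_mul (hf.of_le hik) (hg.of_le hik)
  have e' : iteratedDeriv i (fun t => f t * g t) x = iteratedDeriv i (f * g) x := rfl
  rw [e', e]
  calc _ ≤ ∑ j ∈ Finset.range (i + 1),
        ‖(i.choose j : ℂ) * iteratedDeriv j f x * iteratedDeriv (i - j) g x‖ := norm_sum_le _ _
    _ ≤ ∑ j ∈ Finset.range (i + 1), (i.choose j : ℝ) * (M1 * M2) := by
        apply Finset.sum_le_sum
        intro j hj
        have hj' : j ≤ i := Nat.lt_succ_iff.mp (Finset.mem_range.mp hj)
        rw [norm_mul, norm_mul, mul_assoc, Complex.norm_natCast]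
        gcongr
        · exact h1 j (hj'.trans hi)
        · exact h2 _ ((Nat.sub_le _ _).trans hi)
    _ = 2 ^ i * (M1 * M2) := by
        rw [← Finset.sum_mul]
        congr 1
        exact_mod_cast Nat.sum_range_choose i
    _ ≤ 2 ^ k * (M1 * M2) := by
        gcongr
        norm_num

lemma iter_inv_bound (k : ℕ) (c B : ℝ) (hc : 0 < c) : ∃ C : ℝ, 0 ≤ C ∧ ∀ (g : ℝ → ℂ) (x : ℝ),
    ContDiff ℝ (⊤ : ℕ∞) g → c ≤ ‖g x‖ → (∀ i ≤ k, ‖iteratedDeriv i g x‖ ≤ B) →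
    ∀ i ≤ k, ‖iteratedDeriv i (fun t => (g t)⁻¹) x‖ ≤ C := by
  induction k with
  | zero =>
    refine ⟨c⁻¹, by positivity, fun g x hg hgx _ i hi => ?_⟩
    obtain rfl : i = 0 := by omega
    rw [iteratedDeriv_zero, norm_inv]
    gcongr
  | succ k ih =>
    obtain ⟨C, hC0, hC⟩ := ih
    refine ⟨max C (2 ^ k * (2 ^ k * (C * C) * B)), hC0.trans (le_max_left _ _), fun g x hg hgx hB i hi => ?_⟩
    have hgx0 : g x ≠ 0 := norm_pos_iff.mp (hc.trans_le hgx)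
    have hi0 := hC g x hg hgx (fun i hi => hB i (by omega))
    have hm : ContDiffAt ℝ k (fun t => (g t)⁻¹) x :=
      (hg.of_le (by exact_mod_cast le_top)).contDiffAt.inv hgx0
    rcases Nat.lt_or_ge k i with h | h
    · obtain rfl : i = k + 1 := by omega
      refine le_trans ?_ (le_max_right _ _)
      rw [iteratedDeriv_succ']
      have hd : deriv (fun t => (g t)⁻¹) =ᶠ[nhds x]
          fun t => -1 * (((g t)⁻¹ * (g t)⁻¹) * deriv g t) := by
        have : ∀ᶠ t in nhds x, g t ≠ 0 := hg.continuous.continuousAt.eventually_ne hgx0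
        filter_upwards [this] with t ht
        have h1 : HasDerivAt g (deriv g t) t :=
          ((hg.differentiable (by simp)) t).hasDerivAt
        rw [(h1.fun_inv ht).deriv]
        field_simp
      rw [hd.iteratedDeriv_eq]
      have hgd : ContDiff ℝ (⊤ : ℕ∞) (deriv g) := (contDiff_infty_iff_deriv.mp hg).2
      have hgd' : ContDiffAt ℝ k (deriv g) x := (hgd.of_le (by exact_mod_cast le_top)).contDiffAt
      have h3 := iter_mul_bound k _ _ x (hm.mul hm) hgd' (2 ^ k * (C * C)) B
        (iter_mul_bound k _ _ x hm hm C C hi0 hi0)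
        (fun i hi => by rw [← iteratedDeriv_succ']; exact hB (i + 1) (by omega)) k le_rfl
      rw [iteratedDeriv_const_mul_field, norm_mul, norm_neg, norm_one, one_mul]
      exact h3
    · exact (hi0 i h).trans (le_max_left _ _)

lemma iter_exp_bound (k : ℕ) (B : ℝ) : ∃ C : ℝ, ∀ (g : ℝ → ℂ) (x : ℝ),
    ContDiff ℝ (⊤ : ℕ∞) g → ‖Complex.exp (g x)‖ ≤ 1 →
    (∀ i, 1 ≤ i → i ≤ k → ‖iteratedDeriv i g x‖ ≤ B) →
    ∀ i ≤ k, ‖iteratedDeriv i (fun t => Complex.exp (g t)) x‖ ≤ C := by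
  induction k with
  | zero =>
    refine ⟨1, fun g x hg hgx _ i hi => ?_⟩
    obtain rfl : i = 0 := by omega
    rwa [iteratedDeriv_zero]
  | succ k ih =>
    obtain ⟨C, hC⟩ := ih
    refine ⟨max C (2 ^ k * (C * B)), fun g x hg hgx hB i hi => ?_⟩
    have hi0 := hC g x hg hgx (fun i hi hi' => hB i hi (by omega))
    rcases Nat.lt_or_ge k i with h | h
    · obtain rfl : i = k + 1 := by omega
      refine le_trans ?_ (le_max_right _ _)
      rw [iteratedDeriv_succ']
      have hd : deriv (fun t => Complex.exp (g t)) = fun t => Complex.exp (g t) * deriv g t := by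
        funext t
        have h1 : HasDerivAt g (deriv g t) t :=
          ((hg.differentiable (by simp)) t).hasDerivAt
        exact h1.cexp.deriv
      rw [hd]
      have hgd : ContDiff ℝ (⊤ : ℕ∞) (deriv g) := (contDiff_infty_iff_deriv.mp hg).2
      exact iter_mul_bound k _ _ x ((hg.cexp.of_le (by exact_mod_cast le_top)).contDiffAt)
        ((hgd.of_le (by exact_mod_cast le_top)).contDiffAt) C B hi0
        (fun i hi => by rw [← iteratedDeriv_succ']; exact hB (i + 1) (by omega) (by omega)) k le_rfl
    · exact (hi0 i h).trans (le_max_left _ _)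

lemma iter_ofReal (f : ℝ → ℝ) (hf : ContDiff ℝ (⊤ : ℕ∞) f) (k : ℕ) :
    iteratedDeriv k (fun t => (f t : ℂ)) = fun t => ((iteratedDeriv k f t : ℝ) : ℂ) := by
  induction k generalizing f with
  | zero => simp
  | succ k ih =>
    rw [iteratedDeriv_succ', iteratedDeriv_succ', ← ih _ (contDiff_infty_iff_deriv.mp hf).2]
    congr 1
    funext t
    exact ((hf.differentiable (by simp)) t).hasDerivAt.ofReal_comp.deriv

/-! ### Derivatives along a line -/

/-- `k`-th derivative at `z` along the direction `v`. -/
def ld {W F : Type*} [NormedAddCommGroup W] [NormedSpace ℝ W]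
    [NormedAddCommGroup F] [NormedSpace ℝ F] (v : W) (k : ℕ) (f : W → F) (z : W) : F :=
  iteratedDeriv k (fun t : ℝ => f (z + t • v)) 0

section ldsec
variable {W F : Type*} [NormedAddCommGroup W] [NormedSpace ℝ W]
    [NormedAddCommGroup F] [NormedSpace ℝ F]

lemma line_contDiff (v z : W) : ContDiff ℝ (⊤ : ℕ∞) (fun t : ℝ => z + t • v) := by fun_prop

lemma dLine_smooth (v : W) (f : W → F) (hf : ContDiff ℝ (⊤ : ℕ∞) f) :
    ContDiff ℝ (⊤ : ℕ∞) (dLine v f) := by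
  unfold dLine
  exact (hf.fderiv_right (m := ((⊤ : ℕ∞) : WithTop ℕ∞)) (by simp)).clm_apply contDiff_const

lemma dLine_iter_smooth (v : W) (f : W → F) (hf : ContDiff ℝ (⊤ : ℕ∞) f) (k : ℕ) :
    ContDiff ℝ (⊤ : ℕ∞) ((dLine v)^[k] f) := by
  induction k with
  | zero => exact hf
  | succ k ih => rw [Function.iterate_succ_apply']; exact dLine_smooth v _ ih

lemma deriv_line (v z : W) (f : W → F) (t : ℝ) (hf : DifferentiableAt ℝ f (z + t • v)) :
    HasDerivAt (fun t : ℝ => f (z + t • v)) (dLine v f (z + t • v)) t := by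
  have h1 : HasDerivAt (fun t : ℝ => z + t • v) v t := by
    simpa using ((hasDerivAt_id t).smul_const v).const_add z
  exact hf.hasFDerivAt.comp_hasDerivAt t h1

lemma ld_zero (v : W) (f : W → F) (z : W) : ld v 0 f z = f z := by simp [ld]

lemma ld_succ (v : W) (k : ℕ) (f : W → F) (z : W) (hf : ContDiff ℝ (⊤ : ℕ∞) f) :
    ld v (k + 1) f z = ld v k (dLine v f) z := by
  unfold ld
  rw [iteratedDeriv_succ']
  congr 1
  funext t
  exact (deriv_line v z f t (hf.differentiable (by simp) _)).deriv

lemma ld_eq_dLine_iter (v : W) (k : ℕ) (f : W → F) (z : W) (hf : ContDiff ℝ (⊤ : ℕ∞) f) :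
    ld v k f z = (dLine v)^[k] f z := by
  induction k generalizing f with
  | zero => simp [ld_zero]
  | succ k ih =>
    rw [ld_succ v k f z hf, ih _ (dLine_smooth v f hf), Function.iterate_succ_apply]

lemma ld_mul_bound (v : W) (k : ℕ) (f g : W → ℂ) (z : W) (hf : ContDiffAt ℝ k f z)
    (hg : ContDiffAt ℝ k g z) (M1 M2 : ℝ)
    (h1 : ∀ i ≤ k, ‖ld v i f z‖ ≤ M1) (h2 : ∀ i ≤ k, ‖ld v i g z‖ ≤ M2) :
    ∀ i ≤ k, ‖ld v i (fun y => f y * g y) z‖ ≤ 2 ^ k * (M1 * M2) := by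
  have hl : ContDiffAt ℝ k (fun t : ℝ => z + t • v) 0 :=
    ((line_contDiff v z).of_le (by exact_mod_cast le_top)).contDiffAt
  have hz : z + (0 : ℝ) • v = z := by simp
  exact iter_mul_bound k (fun t => f (z + t • v)) (fun t => g (z + t • v)) 0
    (ContDiffAt.comp (0 : ℝ) (by rw [hz]; exact hf) hl)
    (ContDiffAt.comp (0 : ℝ) (by rw [hz]; exact hg) hl) M1 M2 h1 h2

lemma ld_congr (v : W) (k : ℕ) (f g : W → F) (z : W) (h : f =ᶠ[nhds z] g) :
    ld v k f z = ld v k g z := by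
  unfold ld
  apply Filter.EventuallyEq.iteratedDeriv_eq
  have hl : Filter.Tendsto (fun t : ℝ => z + t • v) (nhds 0) (nhds z) := by
    have := (line_contDiff v z).continuous.tendsto 0
    simpa using this
  exact hl.eventually h

lemma ld_zero_fun (v : W) (k : ℕ) (f : W → F) (z : W) (h : f =ᶠ[nhds z] fun _ => 0) :
    ld v k f z = 0 := by
  rw [ld_congr v k f _ z h]
  unfold ld
  simp

lemma ld_ofReal (v : W) (k : ℕ) (f : W → ℝ) (z : W) (hf : ContDiff ℝ (⊤ : ℕ∞) f) :
    ld v k (fun y => (f y : ℂ)) z = ((ld v k f z : ℝ) : ℂ) := by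
  unfold ld
  rw [iter_ofReal (fun t => f (z + t • v)) (hf.comp (line_contDiff v z))]

end ldsec

/-! ### Non-stationary phase -/

lemma nsp (N : ℕ) (c B : ℝ) (hc : 0 < c) : ∃ C : ℝ, 0 ≤ C ∧ ∀ (n : ℕ) (v : EuclideanSpace ℝ (Fin n))
    (Φ : EuclideanSpace ℝ (Fin n) → ℝ) (b : EuclideanSpace ℝ (Fin n) → ℂ) (lam : ℝ), 0 < lam →
    ContDiff ℝ (⊤ : ℕ∞) Φ → ContDiff ℝ (⊤ : ℕ∞) b → HasCompactSupport b →
    (∀ z ∈ tsupport b, c * lam ≤ |dLine v Φ z|) →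
    (∀ z ∈ tsupport b, ∀ k, 1 ≤ k → k ≤ N + 1 → |ld v k Φ z| ≤ B * lam) →
    (∀ z, ∀ k ≤ N, ‖ld v k b z‖ ≤ B) →
    ‖∫ z, Complex.exp (Complex.I * (Φ z : ℂ)) * b z‖ ≤ C * lam⁻¹ ^ N * volume.real (tsupport b) := by
  induction N generalizing B with
  | zero =>
    refine ⟨|B|, abs_nonneg _, fun n v Φ b lam hlam hΦ hb hbs h1 h2 h3 => ?_⟩
    rw [pow_zero, mul_one]
    have : ∫ z, Complex.exp (Complex.I * (Φ z : ℂ)) * b z =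
        ∫ z in tsupport b, Complex.exp (Complex.I * (Φ z : ℂ)) * b z := by
      symm
      apply setIntegral_eq_integral_of_forall_compl_eq_zero
      intro z hz
      rw [image_eq_zero_of_notMem_tsupport hz, mul_zero]
    rw [this]
    apply norm_setIntegral_le_of_norm_le_const hbs.measure_lt_top
    intro z _
    rw [norm_mul, mul_comm Complex.I, Complex.norm_exp_ofReal_mul_I, one_mul]
    have := h3 z 0 le_rfl
    rw [ld_zero] at this
    exact this.trans (le_abs_self _)
  | succ N ih =>
    obtain ⟨C1, hC10, hC1⟩ := iter_inv_bound (N + 1) c B hc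
    obtain ⟨C, hC0, hC⟩ := ih (max B (2 ^ (N + 1) * (B * C1)))
    refine ⟨C, hC0, fun n v Φ b lam hlam hΦ hb hbs h1 h2 h3 => ?_⟩
    set g : EuclideanSpace ℝ (Fin n) → ℂ := fun z => ((dLine v Φ z / lam : ℝ) : ℂ) with hg
    have hΦ' := dLine_smooth v Φ hΦ
    have hgs : ContDiff ℝ (⊤ : ℕ∞) g := by
      have : ContDiff ℝ (⊤ : ℕ∞) (fun z => dLine v Φ z / lam) := hΦ'.div_const lam
      exact Complex.ofRealCLM.contDiff.comp this
    have hgne : ∀ z ∈ tsupport b, c ≤ ‖g z‖ := by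
      intro z hz
      rw [hg]
      simp only [Complex.norm_real, Real.norm_eq_abs, abs_div, abs_of_pos hlam]
      rw [le_div_iff₀ hlam]
      exact h1 z hz
    set m : EuclideanSpace ℝ (Fin n) → ℂ := fun z => (g z)⁻¹ with hm
    have hms : ∀ z ∈ tsupport b, ContDiffAt ℝ (⊤ : ℕ∞) m z := fun z hz =>
      hgs.contDiffAt.inv (norm_pos_iff.mp (hc.trans_le (hgne z hz)))
    set f : EuclideanSpace ℝ (Fin n) → ℂ := fun z => b z * m z with hf
    have hfz : ∀ z, z ∉ tsupport b → f =ᶠ[nhds z] fun _ => 0 := by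
      intro z hz
      have := notMem_tsupport_iff_eventuallyEq.mp hz
      filter_upwards [this] with y hy
      simp [hf, hy]
    have hfs : ContDiff ℝ (⊤ : ℕ∞) f := by
      rw [contDiff_iff_contDiffAt]
      intro z
      by_cases hz : z ∈ tsupport b
      · exact hb.contDiffAt.mul (hms z hz)
      · exact contDiffAt_const.congr_of_eventuallyEq (hfz z hz)
    have hfsupp : tsupport f ⊆ tsupport b := by
      intro z hz
      by_contra hzb
      exact (notMem_tsupport_iff_eventuallyEq.mpr (hfz z hzb)) hz
    have hfc : HasCompactSupport f := hbs.mono' (subset_tsupport f |>.trans hfsupp)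
    set b' := dLine v f with hb'
    have hb's : ContDiff ℝ (⊤ : ℕ∞) b' := dLine_smooth v f hfs
    have hb'supp : tsupport b' ⊆ tsupport b := by
      refine (closure_minimal ?_ (isClosed_tsupport f)).trans hfsupp
      intro z hz
      by_contra hzf
      apply hz
      have h0 := notMem_tsupport_iff_eventuallyEq.mp hzf
      have : fderiv ℝ f z = fderiv ℝ (fun _ => (0 : ℂ)) z := Filter.EventuallyEq.fderiv_eq h0
      simp [hb', dLine, this]
    have hb'c : HasCompactSupport b' := hbs.mono' (subset_tsupport b' |>.trans hb'supp)
    have key := hC n v Φ b' lam hlam hΦ hb's hb'c (fun z hz => h1 z (hb'supp hz))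
      (fun z hz k hk hk' => (h2 z (hb'supp hz) k hk (by omega)).trans
        (by gcongr; exact le_max_left _ _))
      (by
        intro z k hk
        refine le_trans ?_ (le_max_right _ _)
        rw [hb', ← ld_succ v k f z hfs]
        have hB0 : 0 ≤ B := (norm_nonneg _).trans (h3 z 0 (Nat.zero_le _))
        by_cases hz : z ∈ tsupport b
        · refine ld_mul_bound v (N + 1) b m z ((hb.of_le (by exact_mod_cast le_top)).contDiffAt)
            ((hms z hz).of_le (by exact_mod_cast le_top)) B C1 (h3 z) ?_ (k + 1) (by omega)
          have e := hC1 (fun t => g (z + t • v)) 0 (hgs.comp (line_contDiff v z))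
            (by simpa using hgne z hz) ?_
          · exact e
          · intro i hi
            have e2 : iteratedDeriv i (fun t : ℝ => g (z + t • v)) 0 = ld v i g z := rfl
            have e3 : ld v i g z = ((ld v i (fun z => dLine v Φ z / lam) z : ℝ) : ℂ) :=
              ld_ofReal v i (fun z => dLine v Φ z / lam) z (hΦ'.div_const lam)
            have e4 : ld v i (fun z => dLine v Φ z / lam) z = lam⁻¹ * ld v (i + 1) Φ z := by
              rw [ld_succ v i Φ z hΦ]
              unfold ld
              rw [← iteratedDeriv_const_mul_field]
              congr 1
              funext t
              exact div_eq_inv_mul _ _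
            rw [e2, e3, e4, Complex.norm_real, Real.norm_eq_abs, abs_mul, abs_inv, abs_of_pos hlam,
              inv_mul_le_iff₀ hlam, mul_comm]
            exact h2 z hz (i + 1) (by omega) (by omega)
        · rw [ld_zero_fun v (k + 1) f z (hfz z hz), norm_zero]
          positivity)
    set e : EuclideanSpace ℝ (Fin n) → ℂ := fun z => Complex.exp (Complex.I * (Φ z : ℂ)) with he
    have hes : ContDiff ℝ (⊤ : ℕ∞) e :=
      (contDiff_const.mul (Complex.ofRealCLM.contDiff.comp hΦ)).cexp
    have hde : ∀ z, fderiv ℝ e z v = Complex.I * ((dLine v Φ z : ℝ) : ℂ) * e z := by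
      intro z
      have h1 : HasDerivAt (fun t : ℝ => Φ (z + t • v)) (dLine v Φ z) 0 := by
        simpa using deriv_line v z Φ 0 (hΦ.differentiable (by simp) _)
      have h2 : HasDerivAt (fun t : ℝ => e (z + t • v)) (dLine v e z) 0 := by
        simpa using deriv_line v z e 0 (hes.differentiable (by simp) _)
      have h3 := (h1.ofReal_comp.const_mul Complex.I).cexp
      have h4 := h2.unique h3
      change dLine v e z = _
      rw [h4]
      simp [he]
      ring
    have hcf : Continuous f := hfs.continuous
    have hibp := integral_mul_fderiv_eq_neg_fderiv_mul_of_integrable (μ := volume) (f := e) (g := f)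
      (v := v)
      (((hes.continuous_fderiv (by simp)).clm_apply continuous_const |>.mul hcf).integrable_of_hasCompactSupport
        hfc.mul_left)
      ((hes.continuous.mul hb's.continuous).integrable_of_hasCompactSupport hb'c.mul_left)
      ((hes.continuous.mul hcf).integrable_of_hasCompactSupport hfc.mul_left)
      (fun x _ => hes.differentiable (by simp) _) (fun x _ => hfs.differentiable (by simp) _)
    have h5 : ∀ z, fderiv ℝ e z v * f z = (Complex.I * lam) * (e z * b z) := by
      intro z
      rw [hde]
      by_cases hz : z ∈ tsupport b
      · have hgz : g z ≠ 0 := norm_pos_iff.mp (hc.trans_le (hgne z hz))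
        have : ((dLine v Φ z : ℝ) : ℂ) = lam * g z := by
          have hl : (lam : ℂ) ≠ 0 := by exact_mod_cast hlam.ne'
          rw [hg]; push_cast; field_simp
        rw [this, hf, hm]
        field_simp
      · have : b z = 0 := image_eq_zero_of_notMem_tsupport hz
        simp [hf, this]
    simp_rw [h5] at hibp
    rw [integral_const_mul] at hibp
    have h6 : ‖∫ z, e z * b' z‖ = lam * ‖∫ z, e z * b z‖ := by
      have : ∫ z, e z * b' z = -(Complex.I * lam * ∫ z, e z * b z) := hibp
      rw [this, norm_neg, norm_mul, norm_mul, Complex.norm_I, one_mul, Complex.norm_real,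
        Real.norm_eq_abs, abs_of_pos hlam]
    have h7 : ‖∫ z, e z * b z‖ = lam⁻¹ * ‖∫ z, e z * b' z‖ := by
      rw [h6]; field_simp
    rw [h7]
    calc _ ≤ lam⁻¹ * (C * lam⁻¹ ^ N * volume.real (tsupport b')) := by gcongr
      _ ≤ lam⁻¹ * (C * lam⁻¹ ^ N * volume.real (tsupport b)) := by
          gcongr
          exact hbs.measure_lt_top.ne
      _ = _ := by ring

/-! ### Cauchy-Schwarz and duality -/

abbrev EE (n : ℕ) := EuclideanSpace ℝ (Fin n)

/-- squared `L²` norm. -/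
def n2 {n : ℕ} (f : EE n → ℂ) : ℝ≥0∞ := ∫⁻ x, ‖f x‖ₑ ^ 2

lemma cs_lint {α : Type*} [MeasurableSpace α] (μ : Measure α) (f g : α → ℝ≥0∞)
    (hf : AEMeasurable f μ) (hg : AEMeasurable g μ) :
    (∫⁻ x, f x * g x ∂μ) ^ 2 ≤ (∫⁻ x, f x ^ 2 ∂μ) * (∫⁻ x, g x ^ 2 ∂μ) := by
  have h := ENNReal.lintegral_mul_le_Lp_mul_Lq μ Real.HolderConjugate.two_two hf hg
  have h2 : ∀ x : ℝ≥0∞, (x ^ (1 / (2:ℝ))) ^ 2 = x := by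
    intro x
    rw [← ENNReal.rpow_natCast, ← ENNReal.rpow_mul]; norm_num
  calc _ ≤ _ := pow_le_pow_left₀ (zero_le) h 2
    _ = _ := by
      rw [mul_pow, h2, h2]
      simp

lemma duality {n : ℕ} (f : EE n → ℂ) (hf : Measurable f) (B : ℝ) (hB : ∀ x, ‖f x‖ ≤ B)
    (M : ℝ≥0∞)
    (H : ∀ g : EE n → ℂ, Measurable g → Integrable g → (∃ R : ℝ, ∀ x, R ≤ ‖x‖ → g x = 0) →
      n2 g ≠ ⊤ → ‖∫ x, f x * g x‖ₑ ^ 2 ≤ M * n2 g) : n2 f ≤ M := by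
  have key : ∀ k : ℕ, ∫⁻ x in Metric.ball (0 : EE n) k, ‖f x‖ₑ ^ 2 ≤ M := by
    intro k
    set S := Metric.ball (0 : EE n) k with hS
    have hSm : MeasurableSet S := measurableSet_ball
    set g : EE n → ℂ := S.indicator (fun x => (starRingEnd ℂ) (f x)) with hg
    have hgm : Measurable g := (Complex.continuous_conj.measurable.comp hf).indicator hSm
    have hvS : volume S < ⊤ := measure_ball_lt_top
    have hgi : Integrable g := by
      rw [integrable_indicator_iff hSm]
      refine Measure.integrableOn_of_bounded (M := B) hvS.ne
        (Complex.continuous_conj.measurable.comp hf).aestronglyMeasurable ?_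
      filter_upwards with x
      simpa using hB x
    have e1 : n2 g = ∫⁻ x in S, ‖f x‖ₑ ^ 2 := by
      unfold n2
      rw [← lintegral_indicator hSm]
      congr 1; funext x
      by_cases hx : x ∈ S <;> simp [hg, hx]
    have hfin : ∫⁻ x in S, ‖f x‖ₑ ^ 2 ≠ ⊤ := by
      refine ne_of_lt (lt_of_le_of_lt (lintegral_mono (g := fun _ => (ENNReal.ofReal B) ^ 2) ?_) ?_)
      · intro x
        refine pow_le_pow_left₀ zero_le ?_ 2
        rw [← ofReal_norm]
        exact ENNReal.ofReal_le_ofReal (hB x)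
      · rw [setLIntegral_const]
        exact ENNReal.mul_lt_top (by finiteness) hvS
    have e2 : ‖∫ x, f x * g x‖ₑ = ∫⁻ x in S, ‖f x‖ₑ ^ 2 := by
      have a1 : ∀ x, f x * g x = ((S.indicator (fun x => ‖f x‖ ^ 2) x : ℝ) : ℂ) := by
        intro x
        by_cases hx : x ∈ S
        · simp [hg, hx, Complex.mul_conj, Complex.normSq_eq_norm_sq]
        · simp [hg, hx]
      simp_rw [a1]
      rw [integral_complex_ofReal, integral_indicator hSm]
      rw [integral_eq_lintegral_of_nonneg_ae (by filter_upwards with x; positivity)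
        (hf.norm.pow_const 2).aestronglyMeasurable]
      have a2 : ∀ x, ENNReal.ofReal (‖f x‖ ^ 2) = ‖f x‖ₑ ^ 2 := by
        intro x; rw [ENNReal.ofReal_pow (norm_nonneg _), ofReal_norm]
      simp_rw [a2]
      rw [← ofReal_norm]
      simp only [Complex.norm_real, Real.norm_eq_abs, ENNReal.abs_toReal]
      rw [ENNReal.ofReal_toReal hfin]
    have h := H g hgm hgi ⟨k, fun x hx => by simp [hg, hS, hx]⟩ (by rw [e1]; exact hfin)
    rw [e1, e2, sq] at h
    by_cases h0 : ∫⁻ x in S, ‖f x‖ₑ ^ 2 = 0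
    · rw [h0]; exact zero_le
    · exact (ENNReal.mul_le_mul_iff_left h0 hfin).mp h
  have hU : (⋃ k : ℕ, Metric.ball (0 : EE n) k) = Set.univ := Metric.iUnion_ball_nat 0
  unfold n2
  rw [← setLIntegral_univ, ← hU, setLIntegral_iUnion_of_directed]
  · exact iSup_le key
  · exact (monotone_nat_of_le_succ fun k => Metric.ball_subset_ball (by simp)).directed_le

/-! ### Quantitative global inverse function theorem -/

section hadamard
variable {E : Type*} [NormedAddCommGroup E] [NormedSpace ℝ E]

lemma taylor_lip (G : E → E) (G' : E → E →L[ℝ] E) (L : ℝ) (hL : 0 < L)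
    (hG : ∀ x, HasFDerivAt G (G' x) x) (hLip : ∀ x y, ‖G' x - G' y‖ ≤ L * ‖x - y‖) (x y : E) :
    ‖G y - G x - G' x (y - x)‖ ≤ L * ‖y - x‖ * ‖y - x‖ := by
  refine Convex.norm_image_sub_le_of_norm_hasFDerivWithin_le' (s := Metric.closedBall x ‖y - x‖)
    (f' := G') (fun z _ => (hG z).hasFDerivWithinAt) (fun z hz => ?_) (convex_closedBall _ _)
    (by simp) (by simp [dist_eq_norm])
  refine (hLip z x).trans ?_
  gcongr
  simpa [dist_eq_norm] using hz

variable [CompleteSpace E]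

set_option maxHeartbeats 1000000 in
lemma newton_exists (G : E → E) (G' J : E → E →L[ℝ] E) (L M : ℝ) (hL : 0 < L) (hM : 0 < M)
    (hG : ∀ x, HasFDerivAt G (G' x) x) (hLip : ∀ x y, ‖G' x - G' y‖ ≤ L * ‖x - y‖)
    (hJ1 : ∀ x v, G' x (J x v) = v) (hJ2 : ∀ x v, J x (G' x v) = v) (hJM : ∀ x, ‖J x‖ ≤ M)
    (x y : E) : ‖x - y‖ ≤ 2 * M * ‖G x - G y‖ := by
  set t := G y with ht
  -- continuity
  have hJLip : ∀ a b, ‖J a - J b‖ ≤ (M * L * M) * ‖a - b‖ := by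
    intro a b
    have : J a - J b = (J a).comp ((G' b - G' a).comp (J b)) := by
      ext v; simp [hJ1, hJ2]
    rw [this]
    calc _ ≤ ‖J a‖ * (‖G' b - G' a‖ * ‖J b‖) :=
          (ContinuousLinearMap.opNorm_comp_le _ _).trans (by
            gcongr; exact ContinuousLinearMap.opNorm_comp_le _ _)
      _ ≤ M * ((L * ‖b - a‖) * M) := by 
          have q1 := hJM a
          have q2 := hJM b
          have q3 := hLip b a
          gcongr
      _ = _ := by rw [norm_sub_rev b a]; ring
  have hJc : Continuous J := by
    refine (LipschitzWith.of_dist_le_mul (K := Real.toNNReal (M * L * M)) fun a b => ?_).continuous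
    rw [Real.coe_toNNReal _ (by positivity), dist_eq_norm, dist_eq_norm]
    exact hJLip a b
  have hGc : Continuous G := continuous_iff_continuousAt.2 fun z => (hG z).continuousAt
  set e : E → ℝ := fun q => ‖G q - t‖ with he
  have hec : Continuous e := by fun_prop
  have he0 : ∀ q, 0 ≤ e q := fun q => norm_nonneg _
  set δ : E → ℝ := fun q => (1 + 2 * L * M ^ 2 * e q)⁻¹ with hδ
  have hpos : ∀ q, 0 < 1 + 2 * L * M ^ 2 * e q := fun q => by have := he0 q; positivity
  have hδ0 : ∀ q, 0 < δ q := fun q => inv_pos.2 (hpos q)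
  have hδ1 : ∀ q, δ q ≤ 1 := fun q => inv_le_one_of_one_le₀ (by have := he0 q; nlinarith [mul_nonneg (mul_nonneg hL.le (sq_nonneg M)) this])
  have hδ2 : ∀ q, δ q * (L * M ^ 2 * e q) ≤ 1 / 2 := fun q => by
    have h1 : δ q * (1 + 2 * L * M ^ 2 * e q) = 1 := inv_mul_cancel₀ (hpos q).ne'
    nlinarith [hδ0 q]
  have hδc : Continuous δ := by
    refine Continuous.inv₀ (by fun_prop) fun q => (hpos q).ne'
  set N : E → E := fun q => q - δ q • J q (G q - t) with hN
  have hNc : Continuous N := by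
    have : Continuous fun q => J q (G q - t) := hJc.clm_apply (by fun_prop)
    fun_prop
  have step : ∀ q, ‖N q - q‖ ≤ δ q * (M * e q) := by
    intro q
    have : N q - q = -(δ q • J q (G q - t)) := by simp [hN]
    rw [this, norm_neg, norm_smul, Real.norm_of_nonneg (hδ0 q).le]
    gcongr
    · exact ((J q).le_opNorm _).trans (by gcongr; exact hJM q)
  have dec : ∀ q, e (N q) ≤ (1 - δ q / 2) * e q := by
    intro q
    have h1 := taylor_lip G G' L hL hG hLip q (N q)
    have h2 : G' q (N q - q) = -(δ q • (G q - t)) := by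
      have : N q - q = -(δ q • J q (G q - t)) := by simp [hN]
      rw [this, map_neg, map_smul, hJ1]
    rw [h2] at h1
    have h3 : G (N q) - t = (1 - δ q) • (G q - t) + (G (N q) - G q - -(δ q • (G q - t))) := by
      rw [sub_smul, one_smul]; abel
    have h4 : e (N q) ≤ (1 - δ q) * e q + L * ‖N q - q‖ * ‖N q - q‖ := by
      show ‖G (N q) - t‖ ≤ _
      rw [h3]
      refine (norm_add_le _ _).trans (add_le_add ?_ h1)
      rw [norm_smul, Real.norm_of_nonneg (by linarith [hδ1 q])]
    have h5 : L * ‖N q - q‖ * ‖N q - q‖ ≤ L * (δ q * (M * e q)) * (δ q * (M * e q)) := by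
      gcongr <;> exact step q
    have h6 : L * (δ q * (M * e q)) * (δ q * (M * e q)) = (δ q * (L * M ^ 2 * e q)) * (δ q * e q) := by
      ring
    have h7 := mul_le_mul_of_nonneg_right (hδ2 q) (mul_nonneg (hδ0 q).le (he0 q))
    rw [h6] at h5
    nlinarith
  have step2 : ∀ q, ‖N q - q‖ ≤ 2 * M * (e q - e (N q)) := by
    intro q
    have h1 := step q
    have h2 := dec q
    have : δ q * (M * e q) = 2 * M * (δ q / 2 * e q) := by ring
    rw [this] at h1
    refine h1.trans ?_
    gcongr
    linarith
  have dec1 : ∀ q, e (N q) ≤ e q := by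
    intro q
    have := (norm_nonneg _).trans (step2 q)
    nlinarith
  have mono : ∀ q k, e (N^[k] q) ≤ e q := by
    intro q k
    induction k with
    | zero => simp
    | succ k ih => rw [Function.iterate_succ_apply']; exact (dec1 _).trans ih
  have geo : ∀ q k, e (N^[k] q) ≤ (1 - δ q / 2) ^ k * e q := by
    intro q k
    induction k with
    | zero => simp
    | succ k ih =>
      rw [Function.iterate_succ_apply', pow_succ']
      have h1 : δ q ≤ δ (N^[k] q) := by
        simp only [hδ]
        gcongr
        exact mono q k
      have h2 : 0 ≤ 1 - δ q / 2 := by linarith [hδ1 q, hδ0 q]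
      calc _ ≤ (1 - δ (N^[k] q) / 2) * e (N^[k] q) := dec _
        _ ≤ (1 - δ q / 2) * ((1 - δ q / 2) ^ k * e q) := by
          gcongr
        _ = _ := by ring
  have e_lim : ∀ q, Filter.Tendsto (fun k => e (N^[k] q)) Filter.atTop (nhds 0) := by
    intro q
    have h : Filter.Tendsto (fun k : ℕ => (1 - δ q / 2) ^ k * e q) Filter.atTop (nhds (0 * e q)) :=
      (tendsto_pow_atTop_nhds_zero_of_lt_one (by linarith [hδ1 q, hδ0 q])
        (by linarith [hδ0 q])).mul_const _
    rw [zero_mul] at h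
    exact squeeze_zero (fun k => he0 _) (geo q) h
  have cau : ∀ q, CauchySeq (fun k => N^[k] q) := by
    intro q
    refine cauchySeq_of_le_geometric (1 - δ q / 2) (M * e q) (by linarith [hδ0 q]) fun k => ?_
    rw [Function.iterate_succ_apply', dist_comm, dist_eq_norm]
    refine (step _).trans ?_
    calc _ ≤ 1 * (M * ((1 - δ q / 2) ^ k * e q)) := by
          gcongr
          · exact hδ1 _
          · exact geo q k
      _ = _ := by ring
  choose P hP using fun q => cauchySeq_tendsto_of_complete (cau q)
  have disp : ∀ q k, ‖N^[k] q - q‖ ≤ 2 * M * (e q - e (N^[k] q)) := by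
    intro q k
    induction k with
    | zero => simp
    | succ k ih =>
      rw [Function.iterate_succ_apply']
      have := norm_add_le (N (N^[k] q) - N^[k] q) (N^[k] q - q)
      rw [sub_add_sub_cancel] at this
      have h2 := step2 (N^[k] q)
      linarith
  have dispP : ∀ q, ‖P q - q‖ ≤ 2 * M * e q := by
    intro q
    refine le_of_tendsto ((hP q).sub_const q).norm (Filter.Eventually.of_forall fun k => ?_)
    refine (disp q k).trans ?_
    gcongr
    linarith [he0 (N^[k] q)]
  have zeroP : ∀ q, G (P q) = t := by
    intro q
    have h1 := (hec.tendsto (P q)).comp (hP q)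
    have h2 := tendsto_nhds_unique h1 (e_lim q)
    exact sub_eq_zero.1 (norm_eq_zero.1 h2)
  have Pshift : ∀ q k, P (N^[k] q) = P q := by
    intro q k
    refine tendsto_nhds_unique (hP _) ?_
    have := (Filter.tendsto_add_atTop_iff_nat k).2 (hP q)
    simpa [Function.iterate_add_apply] using this
  have Pfix : ∀ z, G z = t → P z = z := by
    intro z hz
    have h1 : e z = 0 := by simp [he, hz]
    have := dispP z
    rw [h1, mul_zero] at this
    exact sub_eq_zero.1 (norm_le_zero_iff.1 this)
  have sep : ∀ z z', G z = t → G z' = t → ‖z' - z‖ < (M * L)⁻¹ → z = z' := by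
    intro z z' hz hz' h
    have h1 := taylor_lip G G' L hL hG hLip z z'
    rw [hz, hz', sub_self, zero_sub, norm_neg] at h1
    have h2 : ‖z' - z‖ ≤ M * ‖G' z (z' - z)‖ := by
      conv_lhs => rw [← hJ2 z (z' - z)]
      exact ((J z).le_opNorm _).trans (by gcongr; exact hJM z)
    by_contra hne
    have h3 : 0 < ‖z' - z‖ := norm_pos_iff.2 (sub_ne_zero.2 (Ne.symm hne))
    have h4 : M * L * ‖z' - z‖ < 1 := by
      calc _ < M * L * (M * L)⁻¹ := by gcongr
        _ = 1 := mul_inv_cancel₀ (by positivity)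
    have h5 := mul_le_mul_of_nonneg_left h1 hM.le
    nlinarith
  have loc : IsLocallyConstant P := by
    rw [IsLocallyConstant.iff_eventually_eq]
    intro q
    set r := (M * L)⁻¹ with hr
    have hr0 : 0 < r := by positivity
    have ev1 : ∀ᶠ k in Filter.atTop, 2 * M * e (N^[k] q) < r / 4 := by
      have h := (e_lim q).const_mul (2 * M)
      rw [mul_zero] at h
      exact h.eventually (gt_mem_nhds (by positivity))
    have ev2 : ∀ᶠ k in Filter.atTop, ‖N^[k] q - P q‖ < r / 4 := by
      have h := ((hP q).sub_const (P q)).norm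
      rw [sub_self, norm_zero] at h
      exact h.eventually (gt_mem_nhds (by positivity))
    obtain ⟨k, hk1, hk2⟩ := (ev1.and ev2).exists
    have hNk : Continuous (N^[k]) := hNc.iterate k
    have c1 : ∀ᶠ q' in nhds q, 2 * M * e (N^[k] q') < r / 4 :=
      ((continuous_const.mul (hec.comp hNk)).tendsto q).eventually (gt_mem_nhds hk1)
    have c2 : ∀ᶠ q' in nhds q, ‖N^[k] q' - P q‖ < r / 4 :=
      (((hNk.sub continuous_const).norm).tendsto q).eventually (gt_mem_nhds hk2)
    filter_upwards [c1, c2] with q' h1 h2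
    refine sep _ _ (zeroP _) (zeroP _) ?_
    have h3 := dispP (N^[k] q')
    rw [Pshift] at h3
    have := norm_add_le (P q' - N^[k] q') (N^[k] q' - P q)
    rw [sub_add_sub_cancel] at this
    rw [norm_sub_rev]
    linarith
  have hc : P x = P y := loc.apply_eq_of_isPreconnected isPreconnected_univ trivial trivial
  rw [Pfix y ht.symm] at hc
  have := dispP x
  rw [hc, norm_sub_rev] at this
  exact this

end hadamard

/-! ### Hypotheses on the phase -/

section comm
variable {W F : Type*} [NormedAddCommGroup W] [NormedSpace ℝ W]
    [NormedAddCommGroup F] [NormedSpace ℝ F]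

lemma dLine_comm (v w : W) (f : W → F) (hf : ContDiff ℝ (⊤ : ℕ∞) f) :
    dLine v (dLine w f) = dLine w (dLine v f) := by
  have hd : Differentiable ℝ (fderiv ℝ f) :=
    (hf.fderiv_right (m := ((⊤ : ℕ∞) : WithTop ℕ∞)) (by simp)).differentiable (by simp)
  have key : ∀ (a b : W) z, dLine a (dLine b f) z = fderiv ℝ (fderiv ℝ f) z a b := by
    intro a b z
    unfold dLine
    rw [fderiv_clm_apply (hd z) (differentiableAt_const _)]
    simp
  funext z
  rw [key, key]
  have : IsSymmSndFDerivAt ℝ f z :=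
    (hf.contDiffAt).isSymmSndFDerivAt (by
      rw [minSmoothness_of_isRCLikeNormedField]
      exact WithTop.coe_le_coe.2 (le_top : (2 : ℕ∞) ≤ ⊤))
  exact this v w

lemma dLine_comm_iter (v w : W) (f : W → F) (hf : ContDiff ℝ (⊤ : ℕ∞) f) (k : ℕ) :
    dLine v ((dLine w)^[k] f) = (dLine w)^[k] (dLine v f) := by
  induction k with
  | zero => rfl
  | succ k ih =>
    rw [Function.iterate_succ_apply', dLine_comm _ _ _ (dLine_iter_smooth w f hf k), ih,
      Function.iterate_succ_apply']

lemma mderiv_succ {n : ℕ} (dirs : Fin (n + 1) → W) (α : Fin (n + 1) → ℕ) (g : W → F) :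
    mderiv dirs α g = (dLine (dirs 0))^[α 0]
      (mderiv (fun i => dirs i.succ) (fun i => α i.succ) g) := by
  simp [mderiv, List.ofFn_succ]

lemma mderiv_zero {n : ℕ} (dirs : Fin n → W) (g : W → F) :
    mderiv dirs (fun _ => 0) g = g := by
  induction n with
  | zero => simp [mderiv]
  | succ n ih => rw [mderiv_succ, ih]; rfl

lemma mderiv_single {n : ℕ} (dirs : Fin n → W) (m : Fin n) (k : ℕ) (g : W → F) :
    mderiv dirs (Pi.single m k) g = (dLine (dirs m))^[k] g := by
  induction n with
  | zero => exact m.elim0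
  | succ n ih =>
    rw [mderiv_succ]
    refine Fin.cases ?_ (fun m' => ?_) m
    · have : (fun i : Fin n => (Pi.single (0 : Fin (n+1)) k : Fin (n+1) → ℕ) i.succ) = fun _ => 0 := by
        funext i; simp
      rw [this, mderiv_zero]; simp
    · have : (fun i : Fin n => (Pi.single (m'.succ : Fin (n+1)) k : Fin (n+1) → ℕ) i.succ)
          = Pi.single m' k := by
        funext i
        by_cases h : i = m'
        · subst h; simp
        · rw [Pi.single_eq_of_ne h, Pi.single_eq_of_ne (by simpa using h)]
      rw [this, ih]; simp [Pi.single_eq_of_ne (Fin.succ_ne_zero m').symm]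

end comm

lemma mdeg_single {n : ℕ} (m : Fin n) (k : ℕ) : mdeg (Pi.single m k) = k := by
  simp [mdeg, Finset.sum_pi_single']

lemma dLine_swapX {n : ℕ} {F : Type*} [NormedAddCommGroup F] [NormedSpace ℝ F] (i : Fin n)
    (g : EE n × EE n → F) : dLine (dX i) (g ∘ Prod.swap) = dLine (dY i) g ∘ Prod.swap := by
  funext z
  unfold dLine
  have := (ContinuousLinearEquiv.prodComm ℝ (EE n) (EE n)).comp_right_fderiv (f := g) (x := z)
  have e : (g ∘ Prod.swap) = g ∘ (ContinuousLinearEquiv.prodComm ℝ (EE n) (EE n)) := rfl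
  rw [e, this]
  rfl

lemma dLine_swapY {n : ℕ} {F : Type*} [NormedAddCommGroup F] [NormedSpace ℝ F] (i : Fin n)
    (g : EE n × EE n → F) : dLine (dY i) (g ∘ Prod.swap) = dLine (dX i) g ∘ Prod.swap := by
  funext z
  unfold dLine
  have := (ContinuousLinearEquiv.prodComm ℝ (EE n) (EE n)).comp_right_fderiv (f := g) (x := z)
  have e : (g ∘ Prod.swap) = g ∘ (ContinuousLinearEquiv.prodComm ℝ (EE n) (EE n)) := rfl
  rw [e, this]
  rfl

lemma iter_swapX {n : ℕ} {F : Type*} [NormedAddCommGroup F] [NormedSpace ℝ F] (i : Fin n) (k : ℕ)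
    (g : EE n × EE n → F) : (dLine (dX i))^[k] (g ∘ Prod.swap) = (dLine (dY i))^[k] g ∘ Prod.swap := by
  induction k with
  | zero => rfl
  | succ k ih => rw [Function.iterate_succ_apply', ih, dLine_swapX, Function.iterate_succ_apply']

lemma iter_swapY {n : ℕ} {F : Type*} [NormedAddCommGroup F] [NormedSpace ℝ F] (i : Fin n) (k : ℕ)
    (g : EE n × EE n → F) : (dLine (dY i))^[k] (g ∘ Prod.swap) = (dLine (dX i))^[k] g ∘ Prod.swap := by
  induction k with
  | zero => rfl
  | succ k ih => rw [Function.iterate_succ_apply', ih, dLine_swapY, Function.iterate_succ_apply']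

/-- raw hypotheses on the phase. -/
def HypPh (n : ℕ) (C₀ D : ℝ) (φ : EE n × EE n → ℝ) : Prop :=
  ContDiff ℝ (⊤ : ℕ∞) φ ∧ (∀ z, C₀ ≤ |Matrix.det (Matrix.of fun i j => mixedHessXY φ i j z)|) ∧
  ∀ i j m : Fin n, ∀ k ≤ 2 * n + 1, ∀ z,
    |(dLine (dX m))^[k] (mixedHessXY φ i j) z| ≤ D ∧ |(dLine (dY m))^[k] (mixedHessXY φ i j) z| ≤ D

lemma mixed_swap {n : ℕ} (φ : EE n × EE n → ℝ) (hφ : ContDiff ℝ (⊤ : ℕ∞) φ) (i j : Fin n) :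
    mixedHessXY (φ ∘ Prod.swap) i j = mixedHessXY φ j i ∘ Prod.swap := by
  unfold mixedHessXY
  rw [dLine_swapY, dLine_swapX, dLine_comm _ _ _ hφ]

lemma HypPh.swap {n : ℕ} {C₀ D : ℝ} {φ : EE n × EE n → ℝ} (h : HypPh n C₀ D φ) :
    HypPh n C₀ D (φ ∘ Prod.swap) := by
  obtain ⟨h1, h2, h3⟩ := h
  refine ⟨h1.comp (ContinuousLinearEquiv.prodComm ℝ (EE n) (EE n)).contDiff, fun z => ?_,
    fun i j m k hk z => ?_⟩
  · have := h2 z.swap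
    rw [← Matrix.det_transpose] at this
    convert this using 4
    ext i j
    simp [mixed_swap φ h1]
  · rw [mixed_swap φ h1, iter_swapX, iter_swapY]
    exact (h3 j i m k hk z.swap).symm

/-- the estimates on the phase used in the proof. -/
def PhH (n : ℕ) (c B : ℝ) (f : EE n × EE n → ℝ) : Prop :=
  ContDiff ℝ (⊤ : ℕ∞) f ∧
  (∀ y ξ ξ', ξ ≠ ξ' → ∃ j, c * ‖ξ - ξ'‖ ≤ |dLine (dX j) f (y, ξ) - dLine (dX j) f (y, ξ')|) ∧
  (∀ j y y' ξ ξ', |(dLine (dX j) f (y, ξ) - dLine (dX j) f (y, ξ')) -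
      (dLine (dX j) f (y', ξ) - dLine (dX j) f (y', ξ'))| ≤ B * ‖ξ - ξ'‖ * ‖y - y'‖) ∧
  (∀ j k, 1 ≤ k → k ≤ 2 * n + 2 → ∀ y ξ ξ',
    |(dLine (dX j))^[k] f (y, ξ) - (dLine (dX j))^[k] f (y, ξ')| ≤ B * ‖ξ - ξ'‖)

lemma euclid_sum {n : ℕ} (v : EE n) : v = ∑ i, v i • (EuclideanSpace.single i (1 : ℝ) : EE n) := by
  ext j
  simp [Pi.single_apply]

lemma euclid_norm_le {n : ℕ} (v : EE n) (D : ℝ) (h : ∀ i, |v i| ≤ D) : ‖v‖ ≤ n * D := by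
  conv_lhs => rw [euclid_sum v]
  refine (norm_sum_le _ _).trans ?_
  calc _ ≤ ∑ i : Fin n, D := by
        refine Finset.sum_le_sum fun i _ => ?_
        rw [norm_smul]; simpa using h i
    _ = _ := by simp

lemma coord_le {n : ℕ} (v : EE n) (i : Fin n) : |v i| ≤ ‖v‖ := PiLp.norm_apply_le v i

lemma lip_of_partials {n : ℕ} (F : EE n → ℝ) (hF : Differentiable ℝ F) (D : ℝ) (hD : 0 ≤ D)
    (h : ∀ x i, |fderiv ℝ F x (EuclideanSpace.single i 1)| ≤ D) (x y : EE n) :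
    |F x - F y| ≤ n * D * ‖x - y‖ := by
  have hb : ∀ x, ‖fderiv ℝ F x‖ ≤ n * D := by
    intro x
    refine ContinuousLinearMap.opNorm_le_bound _ (by positivity) fun v => ?_
    conv_lhs => rw [euclid_sum v, map_sum]
    refine (norm_sum_le _ _).trans ?_
    calc _ ≤ ∑ i : Fin n, ‖v‖ * D := by
          refine Finset.sum_le_sum fun i _ => ?_
          rw [map_smul, norm_smul]
          exact mul_le_mul (coord_le v i) (h x i) (norm_nonneg _) (norm_nonneg _)
      _ = _ := by simp; ring
  exact Convex.norm_image_sub_le_of_norm_fderiv_le (fun z _ => hF z) (fun z _ => hb z)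
    convex_univ trivial trivial

lemma slice_X {n : ℕ} (f : EE n × EE n → ℝ) (hf : Differentiable ℝ f) (y ξ : EE n) (i : Fin n) :
    fderiv ℝ (fun y => f (y, ξ)) y (EuclideanSpace.single i 1) = dLine (dX i) f (y, ξ) := by
  have h1 : HasFDerivAt (fun y : EE n => (y, ξ)) (ContinuousLinearMap.inl ℝ (EE n) (EE n)) y :=
    hasFDerivAt_prodMk_left y ξ
  have h2 := ((hf (y, ξ)).hasFDerivAt.comp y h1).fderiv
  simp only [Function.comp_def] at h2
  rw [h2]
  rfl

lemma slice_Y {n : ℕ} (f : EE n × EE n → ℝ) (hf : Differentiable ℝ f) (y ξ : EE n) (i : Fin n) :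
    fderiv ℝ (fun ξ => f (y, ξ)) ξ (EuclideanSpace.single i 1) = dLine (dY i) f (y, ξ) := by
  have h1 : HasFDerivAt (fun ξ : EE n => (y, ξ)) (ContinuousLinearMap.inr ℝ (EE n) (EE n)) ξ :=
    hasFDerivAt_prodMk_right y ξ
  have h2 := ((hf (y, ξ)).hasFDerivAt.comp ξ h1).fderiv
  simp only [Function.comp_def] at h2
  rw [h2]
  rfl

lemma slice_Y_diff {n : ℕ} (f : EE n × EE n → ℝ) (hf : Differentiable ℝ f) (y : EE n) :
    Differentiable ℝ (fun ξ => f (y, ξ)) :=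
  hf.comp (by fun_prop)

lemma slice_X_diff {n : ℕ} (f : EE n × EE n → ℝ) (hf : Differentiable ℝ f) (ξ : EE n) :
    Differentiable ℝ (fun y => f (y, ξ)) :=
  hf.comp (by fun_prop)

/-- operator norm bound by entries. -/
lemma clm_bound {n : ℕ} (A : Matrix (Fin n) (Fin n) ℝ) (D : ℝ) (hD : 0 ≤ D)
    (h : ∀ i j, |A i j| ≤ D) : ‖Matrix.toEuclideanCLM (𝕜 := ℝ) A‖ ≤ n * (n * D) := by
  refine ContinuousLinearMap.opNorm_le_bound _ (by positivity) fun v => ?_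
  have := euclid_norm_le (Matrix.toEuclideanCLM (𝕜 := ℝ) A v) (n * D * ‖v‖) fun i => ?_
  · linarith
  · have e : (Matrix.toEuclideanCLM (𝕜 := ℝ) A v) i = ∑ j, A i j * v j := by
      rw [Matrix.ofLp_toEuclideanCLM]; rfl
    rw [e]
    refine (Finset.abs_sum_le_sum_abs _ _).trans ?_
    calc _ ≤ ∑ j : Fin n, D * ‖v‖ := by
          refine Finset.sum_le_sum fun j _ => ?_
          rw [abs_mul]
          exact mul_le_mul (h i j) (coord_le v j) (abs_nonneg _) hD
      _ = _ := by simp; ring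

lemma inv_entry_bound {n : ℕ} (A : Matrix (Fin n) (Fin n) ℝ) (C₀ D : ℝ) (hC : 0 < C₀) (hD : 1 ≤ D)
    (h : ∀ i j, |A i j| ≤ D) (hdet : C₀ ≤ |A.det|) (i j : Fin n) :
    |A⁻¹ i j| ≤ C₀⁻¹ * (n.factorial * D ^ n) := by
  rw [Matrix.inv_def]
  simp only [Matrix.smul_apply, smul_eq_mul, Ring.inverse_eq_inv', abs_mul, abs_inv]
  have h2 : |A.adjugate i j| ≤ n.factorial * D ^ n := by
    rw [Matrix.adjugate_apply]
    have := Matrix.det_le (A := A.updateRow j (Pi.single i 1)) (abv := AbsoluteValue.abs) (x := D) ?_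
    · simpa using this
    · intro a b
      rw [Matrix.updateRow_apply]
      split_ifs
      · by_cases hb : b = i
        · subst hb; simpa using hD
        · simp [Pi.single_eq_of_ne hb]; linarith
      · exact h a b
  gcongr

lemma HypPh.toPhH (n : ℕ) (C₀ D : ℝ) (hC : 0 < C₀) : ∃ c B : ℝ, 0 < c ∧ 1 ≤ B ∧ ∀ φ, HypPh n C₀ D φ →
    PhH n c B φ := by
  obtain ⟨D', hD', hDD⟩ : ∃ D' : ℝ, 1 ≤ D' ∧ D ≤ D' := ⟨max 1 D, le_max_left _ _, le_max_right _ _⟩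
  set M : ℝ := n * (n * (C₀⁻¹ * (n.factorial * D' ^ n))) + 1 with hM
  set L : ℝ := n * (n * (n * D')) + 1 with hL
  have hM0 : 0 < M := by positivity
  have hL0 : 0 < L := by positivity
  refine ⟨(2 * M * (n + 1))⁻¹, n * (n * D') + n * D' + 1, by positivity, ?_, ?_⟩
  · have : 0 ≤ n * (n * D') + n * D' := by positivity
    linarith
  rintro φ ⟨h1, h2, h3⟩
  have h3a : ∀ i j m : Fin n, ∀ k ≤ 2 * n + 1, ∀ z, |(dLine (dX m))^[k] (mixedHessXY φ i j) z| ≤ D' :=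
    fun i j m k hk z => ((h3 i j m k hk z).1).trans hDD
  have h3b : ∀ i j m : Fin n, ∀ k ≤ 2 * n + 1, ∀ z, |(dLine (dY m))^[k] (mixedHessXY φ i j) z| ≤ D' :=
    fun i j m k hk z => ((h3 i j m k hk z).2).trans hDD
  have hmix : ∀ i j, dLine (dY j) (dLine (dX i) φ) = mixedHessXY φ i j := fun i j =>
    dLine_comm _ _ _ h1
  have hdiff : ∀ g : EE n × EE n → ℝ, ContDiff ℝ (⊤ : ℕ∞) g → Differentiable ℝ g :=
    fun g hg => hg.differentiable (by simp)
  have hms : ∀ i j, ContDiff ℝ (⊤ : ℕ∞) (mixedHessXY φ i j) := fun i j =>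
    dLine_smooth _ _ (dLine_smooth _ _ h1)
  have hdX : ∀ i, ContDiff ℝ (⊤ : ℕ∞) (dLine (dX i) φ) := fun i => dLine_smooth _ _ h1
  have hU2 : ∀ i j k, k ≤ 2 * n + 1 → ∀ y ξ ξ',
      |(dLine (dX j))^[k] (dLine (dX i) φ) (y, ξ) - (dLine (dX j))^[k] (dLine (dX i) φ) (y, ξ')|
        ≤ n * D' * ‖ξ - ξ'‖ := by
    intro i j k hk y ξ ξ'
    have hs := dLine_iter_smooth (dX j) _ (hdX i) k
    refine lip_of_partials (fun ξ => (dLine (dX j))^[k] (dLine (dX i) φ) (y, ξ))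
      (slice_Y_diff _ (hdiff _ hs) y) D' (by linarith) (fun x m => ?_) ξ ξ'
    rw [slice_Y _ (hdiff _ hs), dLine_comm_iter _ _ _ (hdX i), hmix]
    exact h3a _ _ _ _ hk _
  refine ⟨h1, ?_, ?_, ?_⟩
  · intro y
    set G : EE n → EE n := fun ξ => WithLp.toLp 2 fun j => dLine (dX j) φ (y, ξ) with hG
    set H : EE n → Matrix (Fin n) (Fin n) ℝ := fun ξ => Matrix.of fun i j => mixedHessXY φ i j (y, ξ)
      with hH
    have hHe : ∀ ξ i j, |H ξ i j| ≤ D' := by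
      intro ξ i j
      exact h3a i j i 0 (by omega) (y, ξ)
    have hHdet : ∀ ξ, C₀ ≤ |(H ξ).det| := fun ξ => h2 (y, ξ)
    have hHu : ∀ ξ, IsUnit (H ξ).det := fun ξ => by
      rw [isUnit_iff_ne_zero]
      intro h0
      have := hHdet ξ
      rw [h0, abs_zero] at this
      linarith
    have newton := newton_exists G (fun ξ => Matrix.toEuclideanCLM (𝕜 := ℝ) (H ξ))
      (fun ξ => Matrix.toEuclideanCLM (𝕜 := ℝ) (H ξ)⁻¹) L M hL0 hM0 ?_ ?_ ?_ ?_ ?_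
    · intro ξ ξ' hne
      by_contra hcon
      push Not at hcon
      have a1 := newton ξ ξ'
      have a2 := euclid_norm_le (G ξ - G ξ') ((2 * M * (n + 1))⁻¹ * ‖ξ - ξ'‖) fun j => (hcon j).le
      have a3 : 0 < ‖ξ - ξ'‖ := norm_pos_iff.2 (sub_ne_zero.2 hne)
      have a4 : 2 * M * ‖G ξ - G ξ'‖ ≤ 2 * M * (n * ((2 * M * (n + 1))⁻¹ * ‖ξ - ξ'‖)) := by gcongr
      have a5 : 2 * M * (n * ((2 * M * (n + 1))⁻¹ * ‖ξ - ξ'‖)) = n / (n + 1) * ‖ξ - ξ'‖ := by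
        field_simp
      have a6 : (n : ℝ) / (n + 1) < 1 := by rw [div_lt_one (by positivity)]; linarith
      rw [a5] at a4
      nlinarith
    · intro ξ
      rw [← hasFDerivWithinAt_univ, hasFDerivWithinAt_euclidean]
      intro j
      rw [hasFDerivWithinAt_univ]
      have hs := slice_Y_diff _ (hdiff _ (hdX j)) y ξ
      refine hs.hasFDerivAt.congr_fderiv ?_
      symm
      refine ContinuousLinearMap.ext fun v => ?_
      conv_rhs => rw [euclid_sum v, map_sum]
      show (Matrix.toEuclideanCLM (𝕜 := ℝ) (H ξ) v) j = _
      rw [Matrix.ofLp_toEuclideanCLM]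
      show ∑ i, H ξ j i * v i = _
      refine Finset.sum_congr rfl fun i _ => ?_
      rw [map_smul, slice_Y _ (hdiff _ (hdX j)), hmix]
      simp [hH, mul_comm]
    · intro ξ ξ'
      rw [← map_sub]
      have := clm_bound (H ξ - H ξ') (n * D' * ‖ξ - ξ'‖) (by positivity) fun i j => ?_
      · refine this.trans ?_
        rw [hL]
        nlinarith [norm_nonneg (ξ - ξ')]
      · refine lip_of_partials (fun ξ => mixedHessXY φ i j (y, ξ))
          (slice_Y_diff _ (hdiff _ (hms i j)) y) D' (by linarith) (fun x m => ?_) ξ ξ'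
        rw [slice_Y _ (hdiff _ (hms i j))]
        exact h3b i j m 1 (by omega) _
    · intro ξ v
      rw [← ContinuousLinearMap.mul_apply, ← map_mul, Matrix.mul_nonsing_inv _ (hHu ξ)]
      simp
    · intro ξ v
      rw [← ContinuousLinearMap.mul_apply, ← map_mul, Matrix.nonsing_inv_mul _ (hHu ξ)]
      simp
    · intro ξ
      refine (clm_bound _ _ (by positivity) (inv_entry_bound (H ξ) C₀ D' hC hD' (hHe ξ) (hHdet ξ))).trans ?_
      rw [hM]; linarith
  · intro j y y' ξ ξ'
    have hsl : Differentiable ℝ fun y => dLine (dX j) φ (y, ξ) - dLine (dX j) φ (y, ξ') :=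
      (slice_X_diff _ (hdiff _ (hdX j)) ξ).sub (slice_X_diff _ (hdiff _ (hdX j)) ξ')
    have := lip_of_partials (fun y => dLine (dX j) φ (y, ξ) - dLine (dX j) φ (y, ξ')) hsl
      (n * D' * ‖ξ - ξ'‖) (by positivity) (fun x m => ?_) y y'
    · refine this.trans ?_
      have : 0 ≤ (n * D' + 1) * (‖ξ - ξ'‖ * ‖y - y'‖) := by positivity
      nlinarith
    · rw [fderiv_fun_sub (slice_X_diff _ (hdiff _ (hdX j)) ξ x) (slice_X_diff _ (hdiff _ (hdX j)) ξ' x)]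
      rw [ContinuousLinearMap.sub_apply, slice_X _ (hdiff _ (hdX j)), slice_X _ (hdiff _ (hdX j))]
      exact hU2 j m 1 (by omega) x ξ ξ'
  · intro j k hk1 hk2 y ξ ξ'
    obtain ⟨k, rfl⟩ : ∃ k', k = k' + 1 := ⟨k - 1, by omega⟩
    rw [Function.iterate_succ_apply]
    refine (hU2 j j k (by omega) y ξ ξ').trans ?_
    have : 0 ≤ (n * (n * D') + 1) * ‖ξ - ξ'‖ := by positivity
    nlinarith

/-! ### Localised estimate -/

/-- the unimodular exponential. -/
def eI (r : ℝ) : ℂ := Complex.exp (Complex.I * (r : ℂ))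

lemma norm_eI (r : ℝ) : ‖eI r‖ = 1 := by
  unfold eI; rw [mul_comm]; exact Complex.norm_exp_ofReal_mul_I r

lemma enorm_eI (r : ℝ) : ‖eI r‖ₑ = 1 := by
  rw [← ofReal_norm, norm_eI]; simp

lemma eI_contDiff : ContDiff ℝ (⊤ : ℕ∞) eI := by
  unfold eI
  exact Complex.contDiff_exp.comp (contDiff_const.mul Complex.ofRealCLM.contDiff)

@[fun_prop]
lemma eI_continuous : Continuous eI := eI_contDiff.continuous

@[fun_prop]
lemma eI_measurable : Measurable eI := eI_continuous.measurable

lemma eI_add (r s : ℝ) : eI (r + s) = eI r * eI s := by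
  unfold eI; rw [← Complex.exp_add]; congr 1; push_cast; ring

lemma eI_neg (r : ℝ) : eI (-r) = (starRingEnd ℂ) (eI r) := by
  unfold eI; rw [← Complex.exp_conj]; simp

lemma eI_sub (r s : ℝ) : eI (r - s) = eI r * (starRingEnd ℂ) (eI s) := by
  rw [sub_eq_add_neg, eI_add, eI_neg]

lemma ld_trans {W F : Type*} [NormedAddCommGroup W] [NormedSpace ℝ W]
    [NormedAddCommGroup F] [NormedSpace ℝ F] (v : W) (k : ℕ) (b : W → F) (p z : W) :
    ld v k (fun y => b (y - p)) z = ld v k b (z - p) := by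
  unfold ld
  congr 1
  funext t
  show b (z + t • v - p) = _
  rw [add_sub_right_comm]

lemma ld_sub {W : Type*} [NormedAddCommGroup W] [NormedSpace ℝ W] (v : W) (k : ℕ)
    (f g : W → ℝ) (z : W) (hf : ContDiff ℝ (⊤ : ℕ∞) f) (hg : ContDiff ℝ (⊤ : ℕ∞) g) :
    ld v k (fun y => f y - g y) z = ld v k f z - ld v k g z := by
  unfold ld
  have h1 : ContDiffAt ℝ k (fun t : ℝ => f (z + t • v)) 0 :=
    ((hf.comp (line_contDiff v z)).of_le (by exact_mod_cast le_top)).contDiffAt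
  have h2 : ContDiffAt ℝ k (fun t : ℝ => g (z + t • v)) 0 :=
    ((hg.comp (line_contDiff v z)).of_le (by exact_mod_cast le_top)).contDiffAt
  exact iteratedDeriv_fun_sub h1 h2

lemma ld_sliceX {n : ℕ} (j : Fin n) (k : ℕ) (f : EE n × EE n → ℝ) (y q : EE n) :
    ld (EuclideanSpace.single j (1 : ℝ)) k (fun y => f (y, q)) y = ld (dX j) k f (y, q) := by
  unfold ld
  congr 1
  funext t
  simp [dX]

lemma bump_bounds {n : ℕ} (b : EE n → ℂ) (hb : ContDiff ℝ (⊤ : ℕ∞) b) (hc : HasCompactSupport b)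
    (N : ℕ) : ∃ B : ℝ, ∀ (j : Fin n) (k : ℕ), k ≤ N → ∀ z,
      ‖ld (EuclideanSpace.single j (1 : ℝ)) k b z‖ ≤ B := by
  have h1 : ∀ (j : Fin n) (k : ℕ), ∃ B : ℝ, ∀ z, ‖ld (EuclideanSpace.single j (1 : ℝ)) k b z‖ ≤ B := by
    intro j k
    have hs := dLine_iter_smooth (EuclideanSpace.single j (1 : ℝ)) b hb k
    have hcs : HasCompactSupport ((dLine (EuclideanSpace.single j (1 : ℝ)))^[k] b) := by
      clear hs
      induction k with
      | zero => exact hc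
      | succ k ih =>
        rw [Function.iterate_succ_apply']
        exact ih.fderiv_apply (𝕜 := ℝ) _
    obtain ⟨B, hB⟩ := hs.continuous.bounded_above_of_compact_support hcs
    exact ⟨B, fun z => by rw [ld_eq_dLine_iter _ _ _ _ hb]; exact hB z⟩
  choose B hB using h1
  refine ⟨∑ j, ∑ k ∈ Finset.range (N + 1), |B j k|, fun j k hk z => (hB j k z).trans ?_⟩
  calc B j k ≤ |B j k| := le_abs_self _
    _ ≤ ∑ k ∈ Finset.range (N + 1), |B j k| :=
      Finset.single_le_sum (f := fun k => |B j k|) (fun _ _ => abs_nonneg _)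
        (Finset.mem_range.2 (by omega))
    _ ≤ _ := Finset.single_le_sum (f := fun j => ∑ k ∈ Finset.range (N + 1), |B j k|)
        (fun _ _ => Finset.sum_nonneg fun _ _ => abs_nonneg _) (Finset.mem_univ j)

lemma tsupport_trans {n : ℕ} (b : EE n → ℂ) (p z : EE n) (hz : z ∈ tsupport fun y => b (y - p)) :
    z - p ∈ tsupport b := by
  have := tsupport_comp_subset_preimage b (f := fun y => y - p) (by fun_prop)
  exact this hz

lemma kernel_bound (n : ℕ) (c B ε : ℝ) (hc : 0 < c) (hB : 1 ≤ B) (hε : B * ε ≤ c / 2)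
    (b : EE n → ℂ) (hb : ContDiff ℝ (⊤ : ℕ∞) b) (hbc : HasCompactSupport b)
    (hbs : tsupport b ⊆ Metric.closedBall 0 ε) :
    ∃ C : ℝ, 0 ≤ C ∧ ∀ f, PhH n c B f → ∀ p q q' : EE n,
      ‖∫ y, eI (f (y, q) - f (y, q')) * b (y - p)‖ ≤ C * ((1 + ‖q - q'‖)⁻¹) ^ (n + 1) := by
  obtain ⟨B1, hB1⟩ := bump_bounds b hb hbc (n + 1)
  set B2 := max B B1 with hB2
  obtain ⟨C, hC0, hC⟩ := nsp (n + 1) (c / 2) B2 (by positivity)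
  set V := volume.real (Metric.closedBall (0 : EE n) ε) with hV
  have hbi : Integrable b := hb.continuous.integrable_of_hasCompactSupport hbc
  set A := ∫ y, ‖b y‖ with hA
  have hA0 : 0 ≤ A := by positivity
  refine ⟨2 ^ (n + 1) * (A + C * V), by positivity, fun f hf p q q' => ?_⟩
  obtain ⟨f1, f2, f3, f4⟩ := hf
  set lam := ‖q - q'‖ with hlam
  have hl0 : 0 ≤ lam := norm_nonneg _
  rcases le_or_gt lam 1 with h | h
  · have a1 : ‖∫ y, eI (f (y, q) - f (y, q')) * b (y - p)‖ ≤ A := by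
      refine (norm_integral_le_integral_norm _).trans ?_
      simp_rw [norm_mul, norm_eI, one_mul]
      rw [integral_sub_right_eq_self (fun y => ‖b y‖) p]
    have a2 : 1 ≤ 2 ^ (n + 1) * ((1 + lam)⁻¹) ^ (n + 1) := by
      rw [← mul_pow]
      apply one_le_pow₀
      rw [← div_eq_mul_inv, one_le_div (by positivity)]
      linarith
    have a3 : 0 ≤ C * V := by positivity
    calc _ ≤ A := a1
      _ ≤ (A + C * V) * (2 ^ (n + 1) * ((1 + lam)⁻¹) ^ (n + 1)) := by nlinarith
      _ = _ := by ring
  · have hne : q ≠ q' := by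
      rintro rfl
      simp [hlam] at h
      linarith
    obtain ⟨j, hj⟩ := f2 p q q' hne
    set v : EE n := EuclideanSpace.single j (1 : ℝ) with hv
    set Φ : EE n → ℝ := fun y => f (y, q) - f (y, q') with hΦ
    have s1 : ContDiff ℝ (⊤ : ℕ∞) fun y => f (y, q) := f1.comp (by fun_prop)
    have s2 : ContDiff ℝ (⊤ : ℕ∞) fun y => f (y, q') := f1.comp (by fun_prop)
    have hΦs : ContDiff ℝ (⊤ : ℕ∞) Φ := s1.sub s2
    have hld : ∀ k z, ld v k Φ z = (dLine (dX j))^[k] f (z, q) - (dLine (dX j))^[k] f (z, q') := by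
      intro k z
      rw [hΦ, ld_sub _ _ _ _ _ s1 s2, ld_sliceX, ld_sliceX, ld_eq_dLine_iter _ _ _ _ f1,
        ld_eq_dLine_iter _ _ _ _ f1]
    have hld1 : ∀ z, dLine v Φ z = dLine (dX j) f (z, q) - dLine (dX j) f (z, q') := by
      intro z
      have := hld 1 z
      rw [ld_eq_dLine_iter _ _ _ _ hΦs] at this
      exact this
    have hts : ∀ z ∈ tsupport (fun y => b (y - p)), ‖z - p‖ ≤ ε := by
      intro z hz
      simpa using hbs (tsupport_trans b p z hz)
    have hbpc : HasCompactSupport fun y => b (y - p) :=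
      hbc.comp_homeomorph (Homeomorph.subRight p)
    have := hC n v Φ (fun y => b (y - p)) lam (by linarith) hΦs (hb.comp (by fun_prop)) hbpc
      ?_ ?_ ?_
    · have hvol : volume.real (tsupport fun y => b (y - p)) ≤ V := by
        have e : V = volume.real (Metric.closedBall p ε) := by
          rw [hV, Measure.real, Measure.real, Measure.addHaar_closedBall_center volume p]
        rw [e]
        refine measureReal_mono (fun z hz => ?_) measure_closedBall_lt_top.ne
        rw [mem_closedBall_iff_norm]
        exact hts z hz
      have a2 : lam⁻¹ ^ (n + 1) ≤ 2 ^ (n + 1) * ((1 + lam)⁻¹) ^ (n + 1) := by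
        rw [← mul_pow]
        refine pow_le_pow_left₀ (by positivity) ?_ _
        rw [← div_eq_mul_inv, inv_eq_one_div, div_le_div_iff₀ (by positivity) (by positivity)]
        linarith
      refine this.trans ?_
      calc C * lam⁻¹ ^ (n + 1) * volume.real (tsupport fun y => b (y - p))
          ≤ C * (2 ^ (n + 1) * ((1 + lam)⁻¹) ^ (n + 1)) * V := by gcongr
        _ ≤ (A + C * V) * (2 ^ (n + 1) * ((1 + lam)⁻¹) ^ (n + 1)) := by
            have : 0 ≤ A * (2 ^ (n + 1) * ((1 + lam)⁻¹) ^ (n + 1)) := by positivity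
            linarith
        _ = _ := by ring
    · intro z hz
      rw [hld1]
      have h3 := f3 j z p q q'
      have h4 : B * ‖q - q'‖ * ‖z - p‖ ≤ c / 2 * lam := by
        calc _ ≤ B * ‖q - q'‖ * ε := by gcongr; exact hts z hz
          _ = (B * ε) * lam := by rw [hlam]; ring
          _ ≤ _ := by gcongr
      have h5 := abs_sub_abs_le_abs_sub (dLine (dX j) f (p, q) - dLine (dX j) f (p, q'))
        (dLine (dX j) f (z, q) - dLine (dX j) f (z, q'))
      rw [abs_sub_comm] at h3
      linarith
    · intro z hz k hk1 hk2
      rw [hld]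
      refine (f4 j k hk1 (by omega) z q q').trans ?_
      gcongr
      exact le_max_left _ _
    · intro z k hk
      rw [ld_trans]
      exact (hB1 j k hk _).trans (le_max_right _ _)

/-! ### Lemma B -/

lemma meas_int {n : ℕ} (F : EE n × EE n → ℂ) (hF : Measurable F) :
    Measurable fun x => ∫ y, F (x, y) :=
  hF.stronglyMeasurable.integral_prod_right'.measurable

lemma sq_mul_le (a b : ℝ≥0∞) : a * b ≤ a ^ 2 + b ^ 2 := by
  rcases le_total a b with h | h
  · calc a * b ≤ b * b := by gcongr
      _ = b ^ 2 := (sq b).symm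
      _ ≤ _ := le_add_self
  · calc a * b ≤ a * a := by gcongr
      _ = a ^ 2 := (sq a).symm
      _ ≤ _ := le_self_add

/-- the weight. -/
def wt (n : ℕ) (x : EE n) : ℝ≥0∞ := ENNReal.ofReal (((1 + ‖x‖)⁻¹) ^ (n + 1))

lemma wt_meas (n : ℕ) : Measurable (wt n) := by
  unfold wt
  fun_prop

lemma wt_int (n : ℕ) : ∫⁻ x, wt n x ≠ ⊤ := by
  have h := integrable_one_add_norm (E := EE n) (μ := volume) (r := (n : ℝ) + 1) (by simp)
  have h2 := h.lintegral_lt_top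
  refine ne_of_lt (lt_of_eq_of_lt ?_ h2)
  congr 1
  funext x
  unfold wt
  congr 1
  rw [Real.rpow_neg (by positivity), inv_pow]
  congr 1
  exact_mod_cast (Real.rpow_natCast (1 + ‖x‖) (n + 1)).symm

lemma schur (n : ℕ) (g : EE n → ℝ≥0∞) (hg : Measurable g) :
    ∫⁻ z : EE n × EE n, g z.1 * g z.2 * wt n (z.1 - z.2) ≤
      2 * (∫⁻ x, wt n x) * ∫⁻ x, g x ^ 2 := by
  have hw := wt_meas n
  have m1 : Measurable fun z : EE n × EE n => g z.1 ^ 2 * wt n (z.1 - z.2) := by fun_prop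
  have m2 : Measurable fun z : EE n × EE n => g z.2 ^ 2 * wt n (z.1 - z.2) := by fun_prop
  have e1 : ∫⁻ z : EE n × EE n, g z.1 ^ 2 * wt n (z.1 - z.2) =
      (∫⁻ x, wt n x) * ∫⁻ x, g x ^ 2 := by
    rw [Measure.volume_eq_prod, lintegral_prod _ m1.aemeasurable]
    simp only
    have : ∀ x : EE n, ∫⁻ y, g x ^ 2 * wt n (x - y) = (∫⁻ x, wt n x) * g x ^ 2 := by
      intro x
      rw [lintegral_const_mul _ (by fun_prop), lintegral_sub_left_eq_self, mul_comm]
    simp_rw [this]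
    rw [lintegral_const_mul _ (by fun_prop)]
  have e2 : ∫⁻ z : EE n × EE n, g z.2 ^ 2 * wt n (z.1 - z.2) =
      (∫⁻ x, wt n x) * ∫⁻ x, g x ^ 2 := by
    rw [Measure.volume_eq_prod, lintegral_prod_symm _ m2.aemeasurable]
    simp only
    have : ∀ x : EE n, ∫⁻ y, g x ^ 2 * wt n (y - x) = (∫⁻ x, wt n x) * g x ^ 2 := by
      intro x
      rw [lintegral_const_mul _ (by fun_prop), lintegral_sub_right_eq_self, mul_comm]
    simp_rw [this]
    rw [lintegral_const_mul _ (by fun_prop)]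
  calc _ ≤ ∫⁻ z : EE n × EE n, (g z.1 ^ 2 * wt n (z.1 - z.2) + g z.2 ^ 2 * wt n (z.1 - z.2)) := by
        refine lintegral_mono fun z => ?_
        rw [← add_mul]
        gcongr
        exact sq_mul_le _ _
    _ = _ := by
        rw [lintegral_add_left m1, e1, e2]; ring

lemma sq_norm_eq (z : ℂ) : ((‖z‖ ^ 2 : ℝ) : ℂ) = z * (starRingEnd ℂ) z := by
  rw [Complex.mul_conj, Complex.normSq_eq_norm_sq]

/-- The `T T^*` estimate. -/
lemma lemB_dual (n : ℕ) (c B ε : ℝ) (hc : 0 < c) (hB : 1 ≤ B) (hε : B * ε ≤ c / 2)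
    (θ : EE n → ℝ) (hθ : ContDiff ℝ (⊤ : ℕ∞) θ) (hθc : HasCompactSupport θ)
    (hθs : tsupport θ ⊆ Metric.closedBall 0 ε) :
    ∃ C : ℝ≥0∞, C ≠ ⊤ ∧ ∀ f, PhH n c B f → ∀ (p : EE n) (g : EE n → ℂ), Measurable g → Integrable g →
      ∫⁻ y, ‖(θ (y - p) : ℂ) * ∫ q, eI (f (y, q)) * g q‖ₑ ^ 2 ≤ C * n2 g := by
  set b : EE n → ℂ := fun y => ((θ y * θ y : ℝ) : ℂ) with hb
  have hbs : ContDiff ℝ (⊤ : ℕ∞) b := Complex.ofRealCLM.contDiff.comp (hθ.mul hθ)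
  have hsub : tsupport b ⊆ tsupport θ := by
    refine closure_mono fun x hx => ?_
    simp [hb] at hx
    exact hx
  have hbc : HasCompactSupport b := hθc.of_isClosed_subset (isClosed_tsupport _) hsub
  have hbi : Integrable b := hbs.continuous.integrable_of_hasCompactSupport hbc
  obtain ⟨C, hC0, hC⟩ := kernel_bound n c B ε hc hB hε b hbs hbc (hsub.trans hθs)
  refine ⟨ENNReal.ofReal C * (2 * ∫⁻ x, wt n x), ?_, fun f hf p g hgm hgi => ?_⟩
  · have := wt_int n
    finiteness
  have hfc : Continuous f := hf.1.continuous
  have hθcont : Continuous θ := hθ.continuous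
  set A : EE n → ℂ := fun y => ∫ q, eI (f (y, q)) * g q with hA
  have hAm : Measurable A := by
    have : Measurable fun z : EE n × EE n => eI (f (z.1, z.2)) * g z.2 := by fun_prop
    exact meas_int _ this
  -- triple integrand
  set F : EE n → EE n × EE n → ℂ := fun y z =>
    b (y - p) * (eI (f (y, z.1)) * g z.1 * (starRingEnd ℂ) (eI (f (y, z.2)) * g z.2)) with hF
  have hcm : Measurable (starRingEnd ℂ) := Complex.continuous_conj.measurable
  have hFm : Measurable (Function.uncurry F) := by
    have hbm : Measurable b := hbs.continuous.measurable
    simp only [hF, Function.uncurry_def]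
    fun_prop
  have hFi : Integrable (Function.uncurry F) (volume.prod volume) := by
    have i1 : Integrable (fun z : EE n × (EE n × EE n) => b (z.1 - p) * (g z.2.1 * g z.2.2))
        (volume.prod volume) :=
      (hbi.comp_sub_right p).mul_prod (hgi.mul_prod hgi)
    refine i1.mono hFm.aestronglyMeasurable ?_
    filter_upwards with z
    simp [hF, Function.uncurry_def, norm_eI]
  have e1 : ∀ y, ∫ z, F y z = ((‖(θ (y - p) : ℂ) * A y‖ ^ 2 : ℝ) : ℂ) := by
    intro y
    simp only [hF]
    rw [integral_const_mul]
    rw [Measure.volume_eq_prod,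
      integral_prod_mul (fun q => eI (f (y, q)) * g q) (fun q => (starRingEnd ℂ) (eI (f (y, q)) * g q)),
      integral_conj, norm_mul, mul_pow, Complex.ofReal_mul, sq_norm_eq (A y)]
    simp [hb]
    rw [sq]
  have e2 : ∀ z : EE n × EE n, ∫ y, F y z = g z.1 * (starRingEnd ℂ) (g z.2) *
      ∫ y, eI (f (y, z.1) - f (y, z.2)) * b (y - p) := by
    intro z
    rw [← integral_const_mul]
    congr 1
    funext y
    simp only [hF, eI_sub, map_mul]
    ring
  have e3 : ENNReal.ofReal ‖∫ y, ∫ z, F y z‖ = ∫⁻ y, ‖(θ (y - p) : ℂ) * A y‖ₑ ^ 2 := by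
    simp_rw [e1]
    have hIntg : Integrable fun y => (‖(θ (y - p) : ℂ) * A y‖ ^ 2 : ℝ) := by
      have := hFi.integral_prod_left
      simp only [Function.uncurry_def] at this
      simp_rw [e1] at this
      exact (Complex.reCLM.integrable_comp this)
    rw [integral_complex_ofReal, Complex.norm_real, Real.norm_of_nonneg (integral_nonneg fun _ => by positivity),
      ofReal_integral_eq_lintegral_ofReal hIntg (by filter_upwards with y; positivity)]
    congr 1; funext y
    rw [ENNReal.ofReal_pow (norm_nonneg _), ofReal_norm]
  rw [← e3, integral_integral_swap hFi, ofReal_norm]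
  calc _ ≤ ∫⁻ z : EE n × EE n, ‖∫ y, F y z‖ₑ := enorm_integral_le_lintegral_enorm _
    _ ≤ ∫⁻ z : EE n × EE n, ENNReal.ofReal C * (‖g z.1‖ₑ * ‖g z.2‖ₑ * wt n (z.1 - z.2)) := by
        refine lintegral_mono fun z => ?_
        simp only [e2]
        rw [enorm_mul, enorm_mul]
        have h1 := hC f hf p z.1 z.2
        have h2 : ‖∫ y, eI (f (y, z.1) - f (y, z.2)) * b (y - p)‖ₑ ≤
            ENNReal.ofReal C * wt n (z.1 - z.2) := by
          rw [← ofReal_norm, wt, ← ENNReal.ofReal_mul hC0]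
          exact ENNReal.ofReal_le_ofReal h1
        have h3 : ‖(starRingEnd ℂ) (g z.2)‖ₑ = ‖g z.2‖ₑ := by
          rw [← ofReal_norm, ← ofReal_norm, RCLike.norm_conj]
        rw [h3]
        calc _ ≤ ‖g z.1‖ₑ * ‖g z.2‖ₑ * (ENNReal.ofReal C * wt n (z.1 - z.2)) := by gcongr
          _ = _ := by ring
    _ = ENNReal.ofReal C * ∫⁻ z : EE n × EE n, (‖g z.1‖ₑ * ‖g z.2‖ₑ * wt n (z.1 - z.2)) := by
        rw [lintegral_const_mul']
        exact ENNReal.ofReal_ne_top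
    _ ≤ ENNReal.ofReal C * (2 * (∫⁻ x, wt n x) * ∫⁻ x, ‖g x‖ₑ ^ 2) := by
        gcongr
        exact schur n (fun x => ‖g x‖ₑ) hgm.enorm
    _ = _ := by rw [n2]; ring

lemma norm_int_le_L1 {n : ℕ} (F u : EE n → ℂ) (M : ℝ) (h : ∀ y, ‖F y‖ ≤ M * ‖u y‖) (hu : Integrable u) :
    ‖∫ y, F y‖ ≤ M * ∫ y, ‖u y‖ := by
  rw [← integral_const_mul]
  exact norm_integral_le_of_norm_le (hu.norm.const_mul M) (by filter_upwards with y using h y)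

/-- Lemma B. -/
lemma lemB (n : ℕ) (c B ε : ℝ) (hc : 0 < c) (hB : 1 ≤ B) (hε : B * ε ≤ c / 2)
    (θ : EE n → ℝ) (hθ : ContDiff ℝ (⊤ : ℕ∞) θ) (hθc : HasCompactSupport θ)
    (hθs : tsupport θ ⊆ Metric.closedBall 0 ε) :
    ∃ C : ℝ≥0∞, C ≠ ⊤ ∧ ∀ f, PhH n c B f → ∀ (p : EE n) (u : EE n → ℂ), Measurable u → Integrable u →
      ∫⁻ q, ‖∫ y, eI (f (y, q)) * ((θ (y - p) : ℂ) * u y)‖ₑ ^ 2 ≤ C * n2 u := by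
  obtain ⟨C, hC, H⟩ := lemB_dual n c B ε hc hB hε θ hθ hθc hθs
  refine ⟨C, hC, fun f hf p u hum hui => ?_⟩
  have hfc : Continuous f := hf.1.continuous
  have hθcont : Continuous θ := hθ.continuous
  obtain ⟨M, hM⟩ := hθcont.bounded_above_of_compact_support hθc
  refine duality _ (meas_int (fun z => eI (f (z.2, z.1)) * ((θ (z.2 - p) : ℂ) * u z.2))
    (by fun_prop)) (M * ∫ y, ‖u y‖) (fun q => ?_) _ (fun g hgm hgi _ _ => ?_)
  · refine norm_int_le_L1 _ _ _ (fun y => ?_) hui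
    rw [norm_mul, norm_eI, one_mul, norm_mul, Complex.norm_real]
    gcongr
    exact hM _
  · set G : EE n → EE n → ℂ := fun q y => eI (f (y, q)) * ((θ (y - p) : ℂ) * u y) * g q with hG
    have hGi : Integrable (Function.uncurry G) (volume.prod volume) := by
      have i1 : Integrable (fun z : EE n × EE n => (M : ℂ) * (g z.1 * u z.2))
        (volume.prod volume) := (hgi.mul_prod hui).const_mul _
      refine i1.mono ?_ ?_
      · have : Measurable (Function.uncurry G) := by
          simp only [hG, Function.uncurry_def]; fun_prop
        exact this.aestronglyMeasurable
      · filter_upwards with z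
        simp only [hG, Function.uncurry_def, norm_mul, norm_eI, Complex.norm_real]
        have h1 := (hM (z.2 - p)).trans (le_abs_self M)
        rw [one_mul, Real.norm_eq_abs M]
        calc _ ≤ |M| * ‖u z.2‖ * ‖g z.1‖ := by gcongr
          _ = _ := by ring
    have e1 : ∫ q, (∫ y, eI (f (y, q)) * ((θ (y - p) : ℂ) * u y)) * g q =
        ∫ y, u y * ((θ (y - p) : ℂ) * ∫ q, eI (f (y, q)) * g q) := by
      calc _ = ∫ q, ∫ y, G q y := by
            congr 1; funext q; rw [← integral_mul_const]
        _ = ∫ y, ∫ q, G q y := integral_integral_swap hGi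
        _ = _ := by
            congr 1; funext y
            rw [← integral_const_mul, ← integral_const_mul]
            congr 1; funext q
            simp only [hG]; ring
    rw [e1]
    have hAm : Measurable fun y => ∫ q, eI (f (y, q)) * g q :=
      meas_int (fun z => eI (f (z.1, z.2)) * g z.2) (by fun_prop)
    calc _ ≤ (∫⁻ y, ‖u y‖ₑ * ‖(θ (y - p) : ℂ) * ∫ q, eI (f (y, q)) * g q‖ₑ) ^ 2 := by
          gcongr
          refine (enorm_integral_le_lintegral_enorm _).trans (le_of_eq ?_)
          simp_rw [enorm_mul]
      _ ≤ n2 u * ∫⁻ y, ‖(θ (y - p) : ℂ) * ∫ q, eI (f (y, q)) * g q‖ₑ ^ 2 := by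
          refine cs_lint volume _ _ hum.enorm.aemeasurable (Measurable.aemeasurable ?_)
          fun_prop
      _ ≤ n2 u * (C * n2 g) := by gcongr; exact H f hf p g hgm hgi
      _ = _ := by ring

/-! ### Fourier transform -/

/-- Fourier transform with explicit kernel. -/
def ft {n : ℕ} (h : EE n → ℂ) (κ : EE n) : ℂ := ∫ y, eI (-(2 * π * ⟪κ, y⟫)) * h y

/-- inverse Fourier transform with explicit kernel. -/
def fti {n : ℕ} (h : EE n → ℂ) (κ : EE n) : ℂ := ∫ y, eI (2 * π * ⟪κ, y⟫) * h y

lemma ft_eq {n : ℕ} (h : EE n → ℂ) : FourierTransform.fourier h = ft h := by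
  funext κ
  rw [Real.fourier_eq']
  unfold ft eI
  congr 1; funext y
  rw [smul_eq_mul, real_inner_comm]
  congr 2
  push_cast; ring

lemma fti_eq {n : ℕ} (h : EE n → ℂ) : FourierTransformInv.fourierInv h = fti h := by
  funext κ
  rw [Real.fourierInv_eq']
  unfold fti eI
  congr 1; funext y
  rw [smul_eq_mul, real_inner_comm]
  congr 2
  push_cast; ring

lemma fti_ft {n : ℕ} (h : EE n → ℂ) (hc : Continuous h) (hi : Integrable h) (hi' : Integrable (ft h)) :
    fti (ft h) = h := by
  rw [← fti_eq, ← ft_eq]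
  exact hc.fourierInv_fourier_eq hi (by rw [ft_eq]; exact hi')

lemma fti_meas {n : ℕ} (h : EE n → ℂ) (hm : Measurable h) : Measurable (fti h) :=
  meas_int (fun z => eI (2 * π * ⟪z.1, z.2⟫) * h z.2) (by fun_prop)

lemma ft_meas {n : ℕ} (h : EE n → ℂ) (hm : Measurable h) : Measurable (ft h) :=
  meas_int (fun z => eI (-(2 * π * ⟪z.1, z.2⟫)) * h z.2) (by fun_prop)

lemma fti_bound {n : ℕ} (h : EE n → ℂ) (hi : Integrable h) (κ : EE n) : ‖fti h κ‖ ≤ ∫ y, ‖h y‖ := by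
  have := norm_int_le_L1 (fun y => eI (2 * π * ⟪κ, y⟫) * h y) h 1 (fun y => by simp [norm_eI]) hi
  rw [one_mul] at this
  exact this

lemma ft_bound {n : ℕ} (h : EE n → ℂ) (hi : Integrable h) (κ : EE n) : ‖ft h κ‖ ≤ ∫ y, ‖h y‖ := by
  have := norm_int_le_L1 (fun y => eI (-(2 * π * ⟪κ, y⟫)) * h y) h 1 (fun y => by simp [norm_eI]) hi
  rw [one_mul] at this
  exact this

lemma fourier_pair {n : ℕ} (h W : EE n → ℂ) (hc : Continuous h) (hi : Integrable h)
    (hi' : Integrable (ft h)) (hW : Integrable W) (hWm : Measurable W) :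
    ∫ y, h y * W y = ∫ κ, ft h κ * fti W κ := by
  set G : EE n → EE n → ℂ := fun y κ => eI (2 * π * ⟪y, κ⟫) * ft h κ * W y with hG
  have hfm : Measurable (ft h) := ft_meas h hc.measurable
  have hGi : Integrable (Function.uncurry G) (volume.prod volume) := by
    refine (hW.mul_prod hi').mono ?_ ?_
    · have : Measurable (Function.uncurry G) := by
        simp only [hG, Function.uncurry_def]; fun_prop
      exact this.aestronglyMeasurable
    · filter_upwards with z
      simp [hG, Function.uncurry_def, norm_eI, mul_comm]
  calc _ = ∫ y, ∫ κ, G y κ := by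
        congr 1; funext y
        conv_lhs => rw [← fti_ft h hc hi hi']
        simp only [hG]
        rw [fti, ← integral_mul_const]
    _ = ∫ κ, ∫ y, G y κ := integral_integral_swap hGi
    _ = _ := by
        congr 1; funext κ
        rw [fti, ← integral_const_mul]
        congr 1; funext y
        simp only [hG]
        rw [real_inner_comm]; ring

lemma exists_big_coord {n : ℕ} (κ : EE n) (h : κ ≠ 0) : ∃ j, ‖κ‖ / (n + 1) ≤ |κ j| := by
  by_contra hcon
  push Not at hcon
  have h1 := euclid_norm_le κ (‖κ‖ / (n + 1)) fun j => (hcon j).le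
  have h2 : 0 < ‖κ‖ := norm_pos_iff.2 h
  have h3 : n * (‖κ‖ / (n + 1)) = n / (n + 1) * ‖κ‖ := by ring
  have a6 : (n : ℝ) / (n + 1) < 1 := by rw [div_lt_one (by positivity)]; linarith
  rw [h3] at h1
  nlinarith

lemma lin_smooth {n : ℕ} (κ : EE n) : ContDiff ℝ (⊤ : ℕ∞) fun y : EE n => -(2 * π * ⟪κ, y⟫) :=
  (contDiff_const.mul (contDiff_const.inner ℝ contDiff_id)).neg

lemma ld_linear {n : ℕ} (κ : EE n) (j : Fin n) (k : ℕ) (hk : 1 ≤ k) (z : EE n) :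
    |ld (EuclideanSpace.single j (1 : ℝ)) k (fun y => -(2 * π * ⟪κ, y⟫)) z| ≤ 2 * π * ‖κ‖ ∧
    dLine (EuclideanSpace.single j (1 : ℝ)) (fun y => -(2 * π * ⟪κ, y⟫)) z = -(2 * π * κ j) := by
  have hs : ContDiff ℝ (⊤ : ℕ∞) fun y : EE n => -(2 * π * ⟪κ, y⟫) := lin_smooth κ
  have e1 : dLine (EuclideanSpace.single j (1 : ℝ)) (fun y : EE n => -(2 * π * ⟪κ, y⟫)) =
      fun _ => -(2 * π * κ j) := by
    funext z
    have h := deriv_line (EuclideanSpace.single j (1 : ℝ)) z (fun y : EE n => -(2 * π * ⟪κ, y⟫)) 0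
      (hs.differentiable (by simp) _)
    have h2 : HasDerivAt (fun t : ℝ => -(2 * π * ⟪κ, z + t • EuclideanSpace.single j (1 : ℝ)⟫))
        (-(2 * π * κ j)) 0 := by
      have : (fun t : ℝ => -(2 * π * ⟪κ, z + t • EuclideanSpace.single j (1 : ℝ)⟫)) =
          fun t => -(2 * π * (⟪κ, z⟫ + t * κ j)) := by
        funext t
        rw [inner_add_right, inner_smul_right, EuclideanSpace.inner_single_right]
        simp
      rw [this]
      have := ((((hasDerivAt_id (0:ℝ)).mul_const (κ j)).const_add ⟪κ, z⟫).const_mul (2 * π)).fun_neg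
      simp only [id, one_mul] at this
      exact this
    have h3 := h.unique h2
    simpa using h3
  refine ⟨?_, by rw [e1]⟩
  obtain ⟨k, rfl⟩ : ∃ k', k = k' + 1 := ⟨k - 1, by omega⟩
  rw [ld_succ _ _ _ _ hs, e1]
  unfold ld
  rw [iteratedDeriv_const]
  split_ifs
  · rw [abs_neg, abs_mul, abs_of_pos (by positivity : (0:ℝ) < 2 * π)]
    gcongr
    exact coord_le κ j
  · simp; positivity

lemma ft_decay (n N : ℕ) (D : ℝ) (hD : 0 ≤ D) : ∃ C : ℝ, 0 ≤ C ∧ ∀ (h : EE n → ℂ) (p : EE n),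
    ContDiff ℝ (⊤ : ℕ∞) h → tsupport h ⊆ Metric.closedBall p 1 → (∀ z, ‖h z‖ ≤ D) →
    (∀ (j : Fin n) (k : ℕ), k ≤ N → ∀ z, ‖ld (EuclideanSpace.single j (1 : ℝ)) k h z‖ ≤ D) →
    ∀ κ, ‖ft h κ‖ ≤ C * ((1 + ‖κ‖)⁻¹) ^ N := by
  obtain ⟨C, hC0, hC⟩ := nsp N ((n + 1 : ℝ)⁻¹) (max D (2 * π)) (by positivity)
  set V := volume.real (Metric.closedBall (0 : EE n) 1) with hV
  refine ⟨2 ^ N * (D * V + C * V), by positivity, fun h p hs hsupp hb hld κ => ?_⟩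
  have hV' : V = volume.real (Metric.closedBall p 1) := by
    rw [hV, Measure.real, Measure.real, Measure.addHaar_closedBall_center volume p]
  have hcs : HasCompactSupport h :=
    (isCompact_closedBall p 1).of_isClosed_subset (isClosed_tsupport _) hsupp
  have hl0 : 0 ≤ ‖κ‖ := norm_nonneg _
  rcases le_or_gt ‖κ‖ 1 with hk | hk
  · have a1 : ‖ft h κ‖ ≤ D * V := by
      refine (ft_bound h (hs.continuous.integrable_of_hasCompactSupport hcs) κ).trans ?_
      have : ∫ y, ‖h y‖ = ∫ y in Metric.closedBall p 1, ‖h y‖ := by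
        rw [setIntegral_eq_integral_of_forall_compl_eq_zero]
        intro x hx
        rw [image_eq_zero_of_notMem_tsupport (fun hh => hx (hsupp hh)), norm_zero]
      rw [this, hV', mul_comm]
      have h3 := norm_setIntegral_le_of_norm_le_const (μ := volume) (s := Metric.closedBall p 1)
        (f := fun y => ‖h y‖) (C := D) measure_closedBall_lt_top (fun x _ => by simpa using hb x)
      rw [mul_comm]
      exact (le_abs_self _).trans h3
    have a2 : 1 ≤ 2 ^ N * ((1 + ‖κ‖)⁻¹) ^ N := by
      rw [← mul_pow]
      apply one_le_pow₀
      rw [← div_eq_mul_inv, one_le_div (by positivity)]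
      linarith
    have a3 : 0 ≤ C * V := by positivity
    have a4 : 0 ≤ D * V := by positivity
    calc _ ≤ D * V := a1
      _ ≤ (D * V + C * V) * (2 ^ N * ((1 + ‖κ‖)⁻¹) ^ N) := by nlinarith
      _ = _ := by ring
  · have hne : κ ≠ 0 := by
      rintro rfl
      simp at hk
      linarith
    obtain ⟨j, hj⟩ := exists_big_coord κ hne
    have := hC n (EuclideanSpace.single j (1 : ℝ)) (fun y => -(2 * π * ⟪κ, y⟫)) h ‖κ‖ (by linarith)
      (lin_smooth κ) hs hcs ?_ ?_ ?_
    · have hvol : volume.real (tsupport h) ≤ V := by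
        rw [hV']
        exact measureReal_mono hsupp measure_closedBall_lt_top.ne
      have a2 : ‖κ‖⁻¹ ^ N ≤ 2 ^ N * ((1 + ‖κ‖)⁻¹) ^ N := by
        rw [← mul_pow]
        refine pow_le_pow_left₀ (by positivity) ?_ _
        rw [← div_eq_mul_inv, inv_eq_one_div, div_le_div_iff₀ (by positivity) (by positivity)]
        linarith
      refine this.trans ?_
      calc C * ‖κ‖⁻¹ ^ N * volume.real (tsupport h)
          ≤ C * (2 ^ N * ((1 + ‖κ‖)⁻¹) ^ N) * V := by gcongr
        _ ≤ (D * V + C * V) * (2 ^ N * ((1 + ‖κ‖)⁻¹) ^ N) := by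
            have : 0 ≤ D * V * (2 ^ N * ((1 + ‖κ‖)⁻¹) ^ N) := by positivity
            linarith
        _ = _ := by ring
    · intro z _
      rw [(ld_linear κ j 1 le_rfl z).2, abs_neg, abs_mul, abs_of_pos (by positivity : (0:ℝ) < 2 * π)]
      have : 1 ≤ 2 * π := by linarith [Real.pi_gt_three]
      have h0 := abs_nonneg (κ j)
      calc _ = ‖κ‖ / (n + 1) := by ring
        _ ≤ |κ j| := hj
        _ ≤ _ := by nlinarith
    · intro z _ k hk1 _
      refine (ld_linear κ j k hk1 z).1.trans ?_
      gcongr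
      exact le_max_right _ _
    · intro z k hk
      exact (hld j k hk z).trans (le_max_left _ _)

/-! ### Lemma C -/

lemma meas_int' {n : ℕ} {α : Type*} [MeasurableSpace α] (F : α × EE n → ℂ) (hF : Measurable F) :
    Measurable fun x => ∫ y, F (x, y) :=
  hF.stronglyMeasurable.integral_prod_right'.measurable

/-- half weight. -/
def om (n : ℕ) (κ : EE n) : ℝ := (1 + ‖κ‖) ^ (-((n : ℝ) + 1 / 2))

lemma om_pos (n : ℕ) (κ : EE n) : 0 < om n κ := Real.rpow_pos_of_pos (by positivity) _

lemma om_sq (n : ℕ) (κ : EE n) : om n κ ^ 2 = ((1 + ‖κ‖)⁻¹) ^ (2 * n + 1) := by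
  unfold om
  rw [← Real.rpow_natCast, ← Real.rpow_mul (by positivity), inv_pow, ← Real.rpow_natCast,
    ← Real.rpow_neg (by positivity)]
  congr 1
  push_cast; ring

lemma om_meas (n : ℕ) : Measurable (om n) := by
  unfold om; fun_prop

lemma om_int (n : ℕ) : ∫⁻ x, ENNReal.ofReal (om n x) ≠ ⊤ := by
  have h := integrable_one_add_norm (E := EE n) (μ := volume) (r := (n : ℝ) + 1 / 2) (by simp)
  exact h.lintegral_lt_top.ne

lemma decay_int (n : ℕ) : Integrable fun κ : EE n => ((1 + ‖κ‖)⁻¹) ^ (2 * n + 1) := by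
  have h := integrable_one_add_norm (E := EE n) (μ := volume) (r := 2 * (n : ℝ) + 1) (by
    simp; linarith [Nat.cast_nonneg (α := ℝ) n])
  refine h.congr ?_
  filter_upwards with x
  rw [Real.rpow_neg (by positivity), inv_pow]
  congr 1
  exact_mod_cast Real.rpow_natCast (1 + ‖x‖) (2 * n + 1)

lemma int_of_decay {n : ℕ} (h : EE n → ℂ) (hm : Measurable h) (C : ℝ)
    (hC : ∀ κ, ‖h κ‖ ≤ C * ((1 + ‖κ‖)⁻¹) ^ (2 * n + 1)) : Integrable h :=
  ((decay_int n).const_mul C).mono' hm.aestronglyMeasurable (by filter_upwards with κ using hC κ)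

set_option maxHeartbeats 1600000 in
lemma lemC_abs (n : ℕ) (D : ℝ) (hD : 0 ≤ D) : ∃ C : ℝ, 0 ≤ C ∧ ∀ (F : EE n → EE n → ℂ) (p q : EE n),
    Continuous (Function.uncurry F) →
    (∀ ξ, ContDiff ℝ (⊤ : ℕ∞) fun y => F y ξ) → (∀ y, ContDiff ℝ (⊤ : ℕ∞) fun ξ => F y ξ) →
    (∀ y ξ, F y ξ ≠ 0 → ‖y - p‖ ≤ 1 ∧ ‖ξ - q‖ ≤ 1) → (∀ y ξ, ‖F y ξ‖ ≤ D) →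
    (∀ (ξ : EE n) (j : Fin n) (k : ℕ), k ≤ 2 * n + 1 → ∀ z,
      ‖ld (EuclideanSpace.single j (1 : ℝ)) k (fun y => F y ξ) z‖ ≤ D) →
    (∀ (y : EE n) (j : Fin n) (k : ℕ), k ≤ 2 * n + 1 → ∀ z,
      ‖ld (EuclideanSpace.single j (1 : ℝ)) k (fun ξ => F y ξ) z‖ ≤ D) →
    ∀ U W : EE n → ℂ, Measurable U → Integrable U → Measurable W → Integrable W →
      ‖∫ ξ, W ξ * ∫ y, F y ξ * U y‖ₑ ≤ ENNReal.ofReal C *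
        ∫⁻ κ, ∫⁻ l, ENNReal.ofReal (om n κ) * ENNReal.ofReal (om n l) * (‖fti U κ‖ₑ * ‖fti W l‖ₑ) := by
  obtain ⟨C1, hC10, hC1⟩ := ft_decay n (2 * n + 1) D hD
  set V := volume.real (Metric.closedBall (0 : EE n) 1) with hV
  refine ⟨V * C1, by positivity, fun F p q hFc hFs1 hFs2 hsupp hFD hld1 hld2 U W hUm hUi hWm hWi => ?_⟩
  have hVp : ∀ p : EE n, volume.real (Metric.closedBall p 1) = V := by
    intro p
    rw [hV, Measure.real, Measure.real, Measure.addHaar_closedBall_center volume p]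
  have ts1 : ∀ ξ, tsupport (fun y => F y ξ) ⊆ Metric.closedBall p 1 := fun ξ =>
    closure_minimal (fun y hy => by rw [mem_closedBall_iff_norm]; exact (hsupp y ξ hy).1)
      Metric.isClosed_closedBall
  have ts2 : ∀ y, tsupport (fun ξ => F y ξ) ⊆ Metric.closedBall q 1 := fun y =>
    closure_minimal (fun ξ hy => by rw [mem_closedBall_iff_norm]; exact (hsupp y ξ hy).2)
      Metric.isClosed_closedBall
  have cs1 : ∀ ξ, HasCompactSupport (fun y => F y ξ) := fun ξ =>
    (isCompact_closedBall p 1).of_isClosed_subset (isClosed_tsupport _) (ts1 ξ)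
  have cs2 : ∀ y, HasCompactSupport (fun ξ => F y ξ) := fun y =>
    (isCompact_closedBall q 1).of_isClosed_subset (isClosed_tsupport _) (ts2 y)
  have dec1 : ∀ ξ κ, ‖ft (fun y => F y ξ) κ‖ ≤ C1 * ((1 + ‖κ‖)⁻¹) ^ (2 * n + 1) := fun ξ =>
    hC1 _ p (hFs1 ξ) (ts1 ξ) (fun z => hFD z ξ) (hld1 ξ)
  have dec2 : ∀ y l, ‖ft (fun ξ => F y ξ) l‖ ≤ C1 * ((1 + ‖l‖)⁻¹) ^ (2 * n + 1) := fun y =>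
    hC1 _ q (hFs2 y) (ts2 y) (fun z => hFD y z) (hld2 y)
  have hFm : Measurable (Function.uncurry F) := hFc.measurable
  have hFm' : Measurable fun z : EE n × EE n => F z.1 z.2 := hFm
  set F1 : EE n → EE n → ℂ := fun κ ξ => ft (fun y => F y ξ) κ with hF1
  have hF1m : Measurable fun z : EE n × EE n => F1 z.1 z.2 := by
    simp only [hF1, ft]
    refine meas_int' (fun w : (EE n × EE n) × EE n => eI (-(2 * π * ⟪w.1.1, w.2⟫)) * F w.2 w.1.2) ?_
    have : Measurable fun w : (EE n × EE n) × EE n => F w.2 w.1.2 :=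
      hFm'.comp (measurable_snd.prodMk measurable_fst.snd)
    fun_prop
  have hF1z : ∀ κ ξ, ξ ∉ Metric.closedBall q 1 → F1 κ ξ = 0 := by
    intro κ ξ hξ
    have : ∀ y, F y ξ = 0 := fun y => by
      by_contra hne
      exact hξ (by rw [mem_closedBall_iff_norm]; exact (hsupp y ξ hne).2)
    simp [hF1, ft, this]
  have hF1c : ∀ κ, Continuous (F1 κ) := by
    intro κ
    simp only [hF1]
    refine continuous_of_dominated (bound := (Metric.closedBall p 1).indicator fun _ => D) ?_ ?_ ?_ ?_
    · intro ξ
      have : Continuous fun y => F y ξ := (hFs1 ξ).continuous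
      exact Continuous.aestronglyMeasurable (by fun_prop)
    · intro ξ
      filter_upwards with y
      rw [norm_mul, norm_eI, one_mul]
      by_cases hy : y ∈ Metric.closedBall p 1
      · simpa [hy] using hFD y ξ
      · have : F y ξ = 0 := by
          by_contra hne
          exact hy (by rw [mem_closedBall_iff_norm]; exact (hsupp y ξ hne).1)
        simp [hy, this]
    · rw [integrable_indicator_iff measurableSet_closedBall]
      exact integrableOn_const measure_closedBall_lt_top.ne
    · filter_upwards with y
      have : Continuous fun ξ => F y ξ := (hFs2 y).continuous
      fun_prop
  have hF1i : ∀ κ, Integrable (F1 κ) := fun κ =>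
    (hF1c κ).integrable_of_hasCompactSupport
      (HasCompactSupport.intro (isCompact_closedBall q 1) (hF1z κ))
  -- double transform
  have swap : ∀ κ l, ft (F1 κ) l = ∫ y, eI (-(2 * π * ⟪κ, y⟫)) * ft (fun ξ => F y ξ) l := by
    intro κ l
    set G : EE n → EE n → ℂ := fun ξ y => eI (-(2 * π * ⟪l, ξ⟫)) * (eI (-(2 * π * ⟪κ, y⟫)) * F y ξ) with hG
    have hGm : Measurable (Function.uncurry G) := by
      have : Measurable fun w : EE n × EE n => F w.2 w.1 := hFm'.comp (measurable_snd.prodMk measurable_fst)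
      simp only [hG, Function.uncurry_def]; fun_prop
    have hGi : Integrable (Function.uncurry G) (volume.prod volume) := by
      have i1 : Integrable (fun z : EE n × EE n =>
          ((Metric.closedBall q 1).indicator (fun _ => D) z.1 : ℝ) *
          ((Metric.closedBall p 1).indicator (fun _ => 1) z.2 : ℝ)) (volume.prod volume) := by
        refine Integrable.mul_prod ?_ ?_ <;>
        · rw [integrable_indicator_iff measurableSet_closedBall]
          exact integrableOn_const measure_closedBall_lt_top.ne
      refine i1.mono' hGm.aestronglyMeasurable ?_
      filter_upwards with z
      simp only [hG, Function.uncurry_def, norm_mul, norm_eI, one_mul]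
      by_cases hz : F z.2 z.1 = 0
      · rw [hz, norm_zero]
        exact mul_nonneg (Set.indicator_nonneg (fun _ _ => hD) _)
          (Set.indicator_nonneg (fun _ _ => zero_le_one) _)
      · have := hsupp _ _ hz
        have m1 : z.1 ∈ Metric.closedBall q 1 := by rw [mem_closedBall_iff_norm]; exact this.2
        have m2 : z.2 ∈ Metric.closedBall p 1 := by rw [mem_closedBall_iff_norm]; exact this.1
        simpa [m1, m2] using hFD z.2 z.1
    calc _ = ∫ ξ, ∫ y, G ξ y := by
          rw [ft]; congr 1; funext ξ
          simp only [hF1, hG, ft]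
          rw [← integral_const_mul]
      _ = ∫ y, ∫ ξ, G ξ y := integral_integral_swap hGi
      _ = _ := by
          congr 1; funext y
          rw [ft, ← integral_const_mul]
          congr 1; funext ξ
          simp only [hG]; ring
  have b2 : ∀ κ l, ‖ft (F1 κ) l‖ ≤ V * (C1 * ((1 + ‖l‖)⁻¹) ^ (2 * n + 1)) := by
    intro κ l
    rw [swap]
    have e : ∫ y, eI (-(2 * π * ⟪κ, y⟫)) * ft (fun ξ => F y ξ) l =
        ∫ y in Metric.closedBall p 1, eI (-(2 * π * ⟪κ, y⟫)) * ft (fun ξ => F y ξ) l := by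
      rw [setIntegral_eq_integral_of_forall_compl_eq_zero]
      intro y hy
      have : ∀ ξ, F y ξ = 0 := fun ξ => by
        by_contra hne
        exact hy (by rw [mem_closedBall_iff_norm]; exact (hsupp y ξ hne).1)
      simp [ft, this]
    rw [e]
    have := norm_setIntegral_le_of_norm_le_const (μ := volume) (s := Metric.closedBall p 1)
        (f := fun y => eI (-(2 * π * ⟪κ, y⟫)) * ft (fun ξ => F y ξ) l)
        (C := C1 * ((1 + ‖l‖)⁻¹) ^ (2 * n + 1)) measure_closedBall_lt_top
        (fun y _ => by rw [norm_mul, norm_eI, one_mul]; exact dec2 y l)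
    rw [hVp] at this
    exact this.trans (le_of_eq (mul_comm _ _))
  have b1 : ∀ κ l, ‖ft (F1 κ) l‖ ≤ V * (C1 * ((1 + ‖κ‖)⁻¹) ^ (2 * n + 1)) := by
    intro κ l
    rw [ft]
    have e : ∫ ξ, eI (-(2 * π * ⟪l, ξ⟫)) * F1 κ ξ =
        ∫ ξ in Metric.closedBall q 1, eI (-(2 * π * ⟪l, ξ⟫)) * F1 κ ξ := by
      rw [setIntegral_eq_integral_of_forall_compl_eq_zero]
      intro y hy
      rw [hF1z κ y hy, mul_zero]
    rw [e]
    have := norm_setIntegral_le_of_norm_le_const (μ := volume) (s := Metric.closedBall q 1)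
        (f := fun ξ => eI (-(2 * π * ⟪l, ξ⟫)) * F1 κ ξ)
        (C := C1 * ((1 + ‖κ‖)⁻¹) ^ (2 * n + 1)) measure_closedBall_lt_top
        (fun y _ => by rw [norm_mul, norm_eI, one_mul]; exact dec1 y κ)
    rw [hVp] at this
    exact this.trans (le_of_eq (mul_comm _ _))
  have b12 : ∀ κ l, ‖ft (F1 κ) l‖ ≤ V * C1 * (om n κ * om n l) := by
    intro κ l
    have h1 := b1 κ l
    have h2 := b2 κ l
    rw [← om_sq] at h1 h2
    have p1 := om_pos n κ
    have p2 := om_pos n l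
    refine abs_le_of_sq_le_sq' ?_ (by positivity) |>.2
    calc ‖ft (F1 κ) l‖ ^ 2 = ‖ft (F1 κ) l‖ * ‖ft (F1 κ) l‖ := sq _
      _ ≤ (V * (C1 * om n κ ^ 2)) * (V * (C1 * om n l ^ 2)) := by gcongr
      _ = _ := by ring
  -- main computation
  have ftm : ∀ h : EE n → ℂ, Continuous h → Measurable (ft h) := fun h hc => ft_meas h hc.measurable
  have step1 : ∀ ξ, ∫ y, F y ξ * U y = ∫ κ, F1 κ ξ * fti U κ := fun ξ =>
    fourier_pair (fun y => F y ξ) U (hFs1 ξ).continuous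
      ((hFs1 ξ).continuous.integrable_of_hasCompactSupport (cs1 ξ))
      (int_of_decay (ft (fun y => F y ξ)) (ftm _ (hFs1 ξ).continuous) C1 (dec1 ξ)) hUi hUm
  have dec1 : ∀ ξ κ, ‖F1 κ ξ‖ ≤ C1 * ((1 + ‖κ‖)⁻¹) ^ (2 * n + 1) := dec1
  clear_value F1
  have step2 : ∀ κ, ∫ ξ, F1 κ ξ * W ξ = ∫ l, ft (F1 κ) l * fti W l := fun κ =>
    fourier_pair (F1 κ) W (hF1c κ) (hF1i κ)
      (int_of_decay (ft (F1 κ)) (ftm _ (hF1c κ)) (V * C1) (fun l => by rw [mul_assoc]; exact b2 κ l)) hWi hWm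
  have hfU : Measurable (fti U) := fti_meas U hUm
  have step3 : ∫ ξ, W ξ * ∫ y, F y ξ * U y = ∫ κ, fti U κ * ∫ l, ft (F1 κ) l * fti W l := by
    set G : EE n → EE n → ℂ := fun ξ κ => W ξ * (F1 κ ξ * fti U κ) with hG
    have hGm : Measurable (Function.uncurry G) := by
      have : Measurable fun w : EE n × EE n => F1 w.2 w.1 := hF1m.comp measurable_swap
      simp only [hG, Function.uncurry_def]; fun_prop
    have hGi : Integrable (Function.uncurry G) (volume.prod volume) := by
      have i1 := hWi.norm.mul_prod ((decay_int n).const_mul (C1 * ∫ y, ‖U y‖))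
      refine i1.mono' hGm.aestronglyMeasurable ?_
      filter_upwards with z
      simp only [hG, Function.uncurry_def, norm_mul]
      have h1 := dec1 z.1 z.2
      have h2 := fti_bound U hUi z.2
      have h3 : 0 ≤ ∫ y, ‖U y‖ := by positivity
      calc _ ≤ ‖W z.1‖ * ((C1 * ((1 + ‖z.2‖)⁻¹) ^ (2 * n + 1)) * ∫ y, ‖U y‖) := by gcongr
        _ = _ := by ring
    calc _ = ∫ ξ, ∫ κ, G ξ κ := by
          congr 1; funext ξ
          rw [step1, ← integral_const_mul]
      _ = ∫ κ, ∫ ξ, G ξ κ := integral_integral_swap hGi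
      _ = _ := by
          congr 1; funext κ
          rw [← step2, ← integral_const_mul]
          congr 1; funext ξ
          simp only [hG]; ring
  rw [step3]
  refine (enorm_integral_le_lintegral_enorm _).trans ?_
  rw [← lintegral_const_mul' _ _ ENNReal.ofReal_ne_top]
  refine lintegral_mono fun κ => ?_
  show ‖fti U κ * _‖ₑ ≤ _
  rw [enorm_mul, ← lintegral_const_mul' _ _ ENNReal.ofReal_ne_top]
  calc _ ≤ ‖fti U κ‖ₑ * ∫⁻ l, ‖ft (F1 κ) l * fti W l‖ₑ := by
        gcongr; exact enorm_integral_le_lintegral_enorm _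
    _ = ∫⁻ l, ‖fti U κ‖ₑ * ‖ft (F1 κ) l * fti W l‖ₑ := by
        rw [lintegral_const_mul' _ _ (by finiteness)]
    _ ≤ _ := by
        refine lintegral_mono fun l => ?_
        show ‖fti U κ‖ₑ * ‖ft (F1 κ) l * fti W l‖ₑ ≤ _
        rw [enorm_mul]
        have h1 : ‖ft (F1 κ) l‖ₑ ≤ ENNReal.ofReal (V * C1) *
            (ENNReal.ofReal (om n κ) * ENNReal.ofReal (om n l)) := by
          rw [← ENNReal.ofReal_mul (om_pos n κ).le, ← ENNReal.ofReal_mul (by positivity), ← ofReal_norm]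
          exact ENNReal.ofReal_le_ofReal (b12 κ l)
        calc _ ≤ ‖fti U κ‖ₑ * (ENNReal.ofReal (V * C1) *
            (ENNReal.ofReal (om n κ) * ENNReal.ofReal (om n l)) * ‖fti W l‖ₑ) := by gcongr
          _ = _ := by ring

/-! ### The localized amplitude -/

/-- The localized amplitude. -/
def Ff {n : ℕ} (f : EE n × EE n → ℝ) (θ : EE n → ℝ) (p q y ξ : EE n) : ℂ :=
  eI (-(f (p, ξ) - f (p, q))) * (θ (ξ - q) : ℂ) * (eI (f (y, ξ) - f (y, q)) * (θ (y - p) : ℂ))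

lemma Ff_swap {n : ℕ} (f : EE n × EE n → ℝ) (θ : EE n → ℝ) (p q y ξ : EE n) :
    Ff f θ p q y ξ = Ff (f ∘ Prod.swap) θ q p ξ y := by
  unfold Ff
  have : eI (-(f (p, ξ) - f (p, q))) * eI (f (y, ξ) - f (y, q)) =
      eI (-((f ∘ Prod.swap) (q, y) - (f ∘ Prod.swap) (q, p))) *
        eI ((f ∘ Prod.swap) (ξ, y) - (f ∘ Prod.swap) (ξ, p)) := by
    rw [← eI_add, ← eI_add]
    congr 1
    simp
    ring
  linear_combination (θ (ξ - q) : ℂ) * (θ (y - p) : ℂ) * this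

lemma Ff_smooth {n : ℕ} (f : EE n × EE n → ℝ) (hf : ContDiff ℝ (⊤ : ℕ∞) f) (θ : EE n → ℝ)
    (hθ : ContDiff ℝ (⊤ : ℕ∞) θ) (p q ξ : EE n) : ContDiff ℝ (⊤ : ℕ∞) fun y => Ff f θ p q y ξ := by
  unfold Ff
  have s1 : ContDiff ℝ (⊤ : ℕ∞) fun y => f (y, ξ) := hf.comp (by fun_prop)
  have s2 : ContDiff ℝ (⊤ : ℕ∞) fun y => f (y, q) := hf.comp (by fun_prop)
  have s3 : ContDiff ℝ (⊤ : ℕ∞) fun y => (θ (y - p) : ℂ) :=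
    Complex.ofRealCLM.contDiff.comp (hθ.comp (contDiff_id.sub contDiff_const))
  exact contDiff_const.mul ((eI_contDiff.comp (s1.sub s2)).mul s3)

lemma Ff_cont {n : ℕ} (f : EE n × EE n → ℝ) (hf : Continuous f) (θ : EE n → ℝ)
    (hθ : Continuous θ) (p q : EE n) : Continuous (Function.uncurry (Ff f θ p q)) := by
  unfold Ff
  simp only [Function.uncurry_def]
  fun_prop

lemma ld_const_mul {W : Type*} [NormedAddCommGroup W] [NormedSpace ℝ W] (v : W) (k : ℕ)
    (c : ℂ) (g : W → ℂ) (z : W) : ld v k (fun y => c * g y) z = c * ld v k g z := by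
  unfold ld
  exact iteratedDeriv_const_mul_field c (fun t : ℝ => g (z + t • v))

lemma lemF (n : ℕ) (c B : ℝ) (hB : 1 ≤ B) (θ : EE n → ℝ) (hθ : ContDiff ℝ (⊤ : ℕ∞) θ)
    (hθc : HasCompactSupport θ) (hθ1 : ∀ z, |θ z| ≤ 1) (hθz : ∀ z, θ z ≠ 0 → ‖z‖ ≤ 1) :
    ∃ D : ℝ, 0 ≤ D ∧ ∀ f, PhH n c B f → ∀ (p q ξ : EE n) (j : Fin n) (k : ℕ), k ≤ 2 * n + 1 → ∀ z,
      ‖ld (EuclideanSpace.single j (1 : ℝ)) k (fun y => Ff f θ p q y ξ) z‖ ≤ D := by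
  have hθs : ContDiff ℝ (⊤ : ℕ∞) fun z => (θ z : ℂ) := Complex.ofRealCLM.contDiff.comp hθ
  obtain ⟨B1, hB1⟩ := bump_bounds (fun z => (θ z : ℂ)) hθs
    (hθc.comp_left (g := fun r : ℝ => (r : ℂ)) (by simp)) (2 * n + 1)
  obtain ⟨B2, hB2⟩ := iter_exp_bound (2 * n + 1) B
  refine ⟨|2 ^ (2 * n + 1) * (B2 * B1)|, abs_nonneg _, fun f hf p q ξ j k hk z => ?_⟩
  obtain ⟨f1, f2, f3, f4⟩ := hf
  unfold Ff
  rw [ld_const_mul, norm_mul, norm_mul, norm_eI, one_mul]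
  by_cases h0 : θ (ξ - q) = 0
  · rw [h0]
    simp only [Complex.ofReal_zero, norm_zero, zero_mul]
    exact abs_nonneg _
  have hq := hθz _ h0
  set v : EE n := EuclideanSpace.single j (1 : ℝ) with hv
  set Φ : EE n → ℝ := fun y => f (y, ξ) - f (y, q) with hΦ
  have s1 : ContDiff ℝ (⊤ : ℕ∞) fun y => f (y, ξ) := f1.comp (by fun_prop)
  have s2 : ContDiff ℝ (⊤ : ℕ∞) fun y => f (y, q) := f1.comp (by fun_prop)
  have hΦs : ContDiff ℝ (⊤ : ℕ∞) Φ := s1.sub s2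
  have hld : ∀ k z, ld v k Φ z = (dLine (dX j))^[k] f (z, ξ) - (dLine (dX j))^[k] f (z, q) := by
    intro k z
    rw [hΦ, ld_sub _ _ _ _ _ s1 s2, ld_sliceX, ld_sliceX, ld_eq_dLine_iter _ _ _ _ f1,
      ld_eq_dLine_iter _ _ _ _ f1]
  have hs3 : ContDiff ℝ (⊤ : ℕ∞) fun y => (θ (y - p) : ℂ) :=
    hθs.comp (contDiff_id.sub contDiff_const)
  have hE : ContDiff ℝ (⊤ : ℕ∞) fun y => eI (Φ y) := eI_contDiff.comp hΦs
  have key := ld_mul_bound v (2 * n + 1) (fun y => eI (Φ y)) (fun y => (θ (y - p) : ℂ)) z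
    (contDiff_infty.1 hE (2 * n + 1)).contDiffAt (contDiff_infty.1 hs3 (2 * n + 1)).contDiffAt
    B2 B1 ?_ ?_ k hk
  · calc _ ≤ 1 * ‖ld v k (fun y => eI (Φ y) * (θ (y - p) : ℂ)) z‖ := by
          gcongr
          rw [Complex.norm_real]; exact hθ1 _
      _ ≤ _ := by rw [one_mul]; exact key.trans (le_abs_self _)
  · have hg : ContDiff ℝ (⊤ : ℕ∞) fun t : ℝ => Complex.I * ((Φ (z + t • v) : ℝ) : ℂ) :=
      contDiff_const.mul (Complex.ofRealCLM.contDiff.comp (hΦs.comp (line_contDiff v z)))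
    refine fun i hi => hB2 (fun t : ℝ => Complex.I * ((Φ (z + t • v) : ℝ) : ℂ)) 0 hg ?_ ?_ i hi
    · exact (norm_eI _).le
    · intro i hi1 hi2
      have e : iteratedDeriv i (fun t : ℝ => Complex.I * ((Φ (z + t • v) : ℝ) : ℂ)) 0 =
          Complex.I * ((ld v i Φ z : ℝ) : ℂ) := by
        rw [← ld_ofReal v i Φ z hΦs]
        exact ld_const_mul v i Complex.I (fun y => (Φ y : ℂ)) z
      rw [e, norm_mul, Complex.norm_I, one_mul, Complex.norm_real, hld]
      calc _ ≤ B * ‖ξ - q‖ := f4 j i hi1 (by omega) z ξ q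
        _ ≤ B * 1 := by gcongr
        _ = B := mul_one B
  · intro i hi
    rw [ld_trans v i (fun z => (θ z : ℂ)) p z]
    exact hB1 j i hi _

/-! ### Step 1: the L² bound for the operator without amplitude -/

lemma int_bdd_mul {α : Type*} [MeasurableSpace α] {μ : Measure α} (b u : α → ℂ) (hb : Measurable b) (M : ℝ)
    (hM : ∀ x, ‖b x‖ ≤ M) (hum : Measurable u) (hu : Integrable u μ) : Integrable (fun x => b x * u x) μ := by
  refine (hu.norm.const_mul M).mono' (hb.mul hum).aestronglyMeasurable ?_
  filter_upwards with x
  rw [norm_mul]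
  gcongr
  exact hM x

lemma cs_weight {n : ℕ} (N : EE n → ℝ≥0∞) (hN : Measurable N) :
    (∫⁻ κ, ENNReal.ofReal (om n κ) * N κ) ^ 2 ≤
      (∫⁻ κ, ENNReal.ofReal (om n κ)) * ∫⁻ κ, ENNReal.ofReal (om n κ) * N κ ^ 2 := by
  have hs : ∀ κ, ENNReal.ofReal (om n κ) = ENNReal.ofReal (Real.sqrt (om n κ)) ^ 2 := fun κ => by
    rw [← ENNReal.ofReal_pow (Real.sqrt_nonneg _), Real.sq_sqrt (om_pos n κ).le]
  have hm : Measurable fun κ => ENNReal.ofReal (Real.sqrt (om n κ)) := by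
    have := om_meas n
    fun_prop
  have := cs_lint volume (fun κ => ENNReal.ofReal (Real.sqrt (om n κ)))
    (fun κ => ENNReal.ofReal (Real.sqrt (om n κ)) * N κ) hm.aemeasurable (hm.mul hN).aemeasurable
  simp_rw [mul_pow, ← mul_assoc, ← sq, ← hs] at this
  exact this

set_option maxHeartbeats 1600000 in
lemma lemX (n : ℕ) (c B ε : ℝ) (hc : 0 < c) (hB : 1 ≤ B) (hε : B * ε ≤ c / 2)
    (θ : EE n → ℝ) (hθ : ContDiff ℝ (⊤ : ℕ∞) θ) (hθc : HasCompactSupport θ)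
    (hθs : tsupport θ ⊆ Metric.closedBall 0 ε) :
    ∃ C : ℝ≥0∞, C ≠ ⊤ ∧ ∀ f, PhH n c B f → ∀ (u : EE n → ℂ), Measurable u → Integrable u →
      ∫⁻ z : EE n × EE n, (∫⁻ κ, ENNReal.ofReal (om n κ) *
        ‖fti (fun y => eI (f (y, z.2)) * ((θ (y - z.1) : ℂ) * u y)) κ‖ₑ) ^ 2 ≤ C * n2 u := by
  obtain ⟨C, hC, H⟩ := lemB n c B ε hc hB hε θ hθ hθc hθs
  set Ω := ∫⁻ κ, ENNReal.ofReal (om n κ) with hΩ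
  set V := volume (Metric.closedBall (0 : EE n) ε) with hV
  have hVt : V ≠ ⊤ := measure_closedBall_lt_top.ne
  have hΩt : Ω ≠ ⊤ := om_int n
  refine ⟨Ω * (Ω * (C * V)), by finiteness, fun f hf u hum hui => ?_⟩
  have hfc : Continuous f := hf.1.continuous
  have hθcont : Continuous θ := hθ.continuous
  set N : EE n × EE n → EE n → ℝ≥0∞ :=
    fun z κ => ‖fti (fun y => eI (f (y, z.2)) * ((θ (y - z.1) : ℂ) * u y)) κ‖ₑ with hN
  have hNm : Measurable fun w : (EE n × EE n) × EE n => N w.1 w.2 := by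
    simp only [hN, fti]
    refine Measurable.enorm ?_
    refine meas_int' (fun w : ((EE n × EE n) × EE n) × EE n =>
      eI (2 * π * ⟪w.1.2, w.2⟫) * (eI (f (w.2, w.1.1.2)) * ((θ (w.2 - w.1.1.1) : ℂ) * u w.2))) ?_
    have h1 : Measurable fun w : ((EE n × EE n) × EE n) × EE n => u w.2 := hum.comp measurable_snd
    have h2 : Continuous fun w : ((EE n × EE n) × EE n) × EE n =>
      eI (2 * π * ⟪w.1.2, w.2⟫) * (eI (f (w.2, w.1.1.2)) * ((θ (w.2 - w.1.1.1) : ℂ))) := by fun_prop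
    convert h2.measurable.mul h1 using 2
    simp only [Pi.mul_apply]
    ring
  have key : ∀ κ, ∫⁻ z, N z κ ^ 2 ≤ C * V * n2 u := by
    intro κ
    have m1 : Measurable fun z => N z κ ^ 2 :=
      (hNm.comp (measurable_id.prodMk measurable_const)).pow_const 2
    rw [Measure.volume_eq_prod, lintegral_prod _ m1.aemeasurable]
    have b : ∀ p, ∫⁻ q, N (p, q) κ ^ 2 ≤
        C * ∫⁻ y, (Metric.closedBall y ε).indicator (fun _ => 1) p * ‖u y‖ₑ ^ 2 := by
      intro p
      set u' : EE n → ℂ := fun y =>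
        (Metric.closedBall p ε).indicator (fun y => eI (2 * π * ⟪κ, y⟫)) y * u y with hu'
      have hb : Measurable fun y : EE n => (Metric.closedBall p ε).indicator (fun y => eI (2 * π * ⟪κ, y⟫)) y :=
        Measurable.indicator (by fun_prop) measurableSet_closedBall
      have hu'm : Measurable u' := hb.mul hum
      have hu'i : Integrable u' := int_bdd_mul _ _ hb 1 (fun y => by
        by_cases hy : y ∈ Metric.closedBall p ε <;> simp [hy, norm_eI]) hum hui
      have := H f hf p u' hu'm hu'i
      refine (le_of_eq ?_).trans (this.trans (le_of_eq ?_))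
      · refine lintegral_congr fun q => ?_
        simp only [hN, fti]
        congr 3
        funext y
        by_cases hy : y ∈ Metric.closedBall p ε
        · simp only [hu', Set.indicator_of_mem hy]; ring
        · have : θ (y - p) = 0 := by
            by_contra hne
            apply hy
            have := hθs (subset_tsupport _ hne)
            rwa [mem_closedBall_zero_iff, ← mem_closedBall_iff_norm] at this
          simp [this]
      · congr 1
        unfold n2
        refine lintegral_congr fun y => ?_
        by_cases hy : y ∈ Metric.closedBall p ε
        · have hy' : p ∈ Metric.closedBall y ε := Metric.mem_closedBall_comm.1 hy
          simp [hu', hy, hy', enorm_eI]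
        · have hy' : p ∉ Metric.closedBall y ε := fun h => hy (Metric.mem_closedBall_comm.1 h)
          simp [hu', hy, hy']
    have m2 : Measurable fun w : EE n × EE n =>
        (Metric.closedBall w.2 ε).indicator (fun _ => (1 : ℝ≥0∞)) w.1 * ‖u w.2‖ₑ ^ 2 := by
      refine Measurable.mul ?_ ((hum.comp measurable_snd).enorm.pow_const 2)
      have : (fun w : EE n × EE n => (Metric.closedBall w.2 ε).indicator (fun _ => (1 : ℝ≥0∞)) w.1) =
          {w : EE n × EE n | dist w.1 w.2 ≤ ε}.indicator fun _ => 1 := by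
        funext w
        simp [Set.indicator, Metric.mem_closedBall]
      rw [this]
      exact measurable_const.indicator (measurableSet_le (by fun_prop) measurable_const)
    calc _ ≤ ∫⁻ p, C * ∫⁻ y, (Metric.closedBall y ε).indicator (fun _ => 1) p * ‖u y‖ₑ ^ 2 :=
          lintegral_mono b
      _ = C * ∫⁻ p, ∫⁻ y, (Metric.closedBall y ε).indicator (fun _ => 1) p * ‖u y‖ₑ ^ 2 :=
          lintegral_const_mul' _ _ hC
      _ = C * ∫⁻ y, ∫⁻ p, (Metric.closedBall y ε).indicator (fun _ => 1) p * ‖u y‖ₑ ^ 2 := by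
          rw [lintegral_lintegral_swap m2.aemeasurable]
      _ = C * ∫⁻ y, V * ‖u y‖ₑ ^ 2 := by
          congr 1
          refine lintegral_congr fun y => ?_
          rw [lintegral_mul_const' _ _ (by finiteness), lintegral_indicator measurableSet_closedBall]
          simp [hV, Measure.addHaar_closedBall_center volume y]
      _ = _ := by rw [lintegral_const_mul' _ _ hVt, n2, mul_assoc]
  change ∫⁻ z : EE n × EE n, (∫⁻ κ, ENNReal.ofReal (om n κ) * N z κ) ^ 2 ≤ _
  clear_value N
  calc _ ≤ ∫⁻ z : EE n × EE n, Ω * ∫⁻ κ, ENNReal.ofReal (om n κ) * N z κ ^ 2 :=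
        lintegral_mono fun z => cs_weight (N z) (hNm.comp (measurable_const.prodMk measurable_id))
    _ = Ω * ∫⁻ z : EE n × EE n, ∫⁻ κ, ENNReal.ofReal (om n κ) * N z κ ^ 2 :=
        lintegral_const_mul' _ _ hΩt
    _ = Ω * ∫⁻ κ, ∫⁻ z : EE n × EE n, ENNReal.ofReal (om n κ) * N z κ ^ 2 := by
        rw [lintegral_lintegral_swap]
        have := om_meas n
        exact (((this.comp measurable_snd).ennreal_ofReal).mul (hNm.pow_const 2)).aemeasurable
    _ ≤ Ω * ∫⁻ κ, ENNReal.ofReal (om n κ) * (C * V * n2 u) := by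
        gcongr with κ
        rw [lintegral_const_mul' _ _ ENNReal.ofReal_ne_top]
        gcongr
        exact key κ
    _ = Ω * (Ω * (C * V)) * n2 u := by
        rw [lintegral_mul_const _ (om_meas n).ennreal_ofReal, ← hΩ]
        ring

lemma Ff_norm {n : ℕ} (f : EE n × EE n → ℝ) (θ : EE n → ℝ) (hθ1 : ∀ z, |θ z| ≤ 1) (p q y ξ : EE n) :
    ‖Ff f θ p q y ξ‖ ≤ 1 := by
  unfold Ff
  rw [norm_mul, norm_mul, norm_mul, norm_eI, norm_eI, one_mul, one_mul, Complex.norm_real, Complex.norm_real]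
  exact mul_le_one₀ (hθ1 _) (norm_nonneg _) (hθ1 _)

/-- The averaged localization identity. -/
lemma local_avg {n : ℕ} (θ : EE n → ℝ) (hθ : Continuous θ) (hθc : HasCompactSupport θ)
    (G : EE n × EE n → ℂ) (hGm : Measurable G) (hG : Integrable G) :
    ((∫ y, θ y ^ 2 : ℝ) : ℂ) ^ 2 * ∫ w, G w = ∫ z : EE n × EE n, ∫ w : EE n × EE n,
      G w * ((θ (w.1 - z.2) : ℂ) ^ 2 * (θ (w.2 - z.1) : ℂ) ^ 2) := by
  set cθ := ∫ y, θ y ^ 2 with hcθ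
  have hi : Integrable fun y => (θ y) ^ 2 := by
    refine Continuous.integrable_of_hasCompactSupport (by fun_prop) ?_
    exact hθc.comp_left (g := fun r : ℝ => r ^ 2) (by simp)
  have hi' : ∀ x, Integrable fun y => (θ (x - y)) ^ 2 := fun x => hi.comp_sub_left x
  have he : ∀ x, ∫ y, (θ (x - y)) ^ 2 = cθ := fun x =>
    integral_sub_left_eq_self (fun y => θ y ^ 2) volume x
  have hprod : ∀ w : EE n × EE n, Integrable fun z : EE n × EE n => θ (w.2 - z.1) ^ 2 * θ (w.1 - z.2) ^ 2 :=
    fun w => (hi' w.2).mul_prod (hi' w.1)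
  have hprode : ∀ w : EE n × EE n, ∫ z : EE n × EE n, θ (w.2 - z.1) ^ 2 * θ (w.1 - z.2) ^ 2 = cθ ^ 2 := by
    intro w
    have := integral_prod_mul (μ := volume) (ν := volume) (fun y : EE n => θ (w.2 - y) ^ 2)
      (fun y : EE n => θ (w.1 - y) ^ 2)
    rw [Measure.volume_eq_prod, this, he, he, sq]
  set Q : (EE n × EE n) → (EE n × EE n) → ℂ := fun z w =>
      G w * ((θ (w.1 - z.2) : ℂ) ^ 2 * (θ (w.2 - z.1) : ℂ) ^ 2) with hQ
  have hQe : ∀ z w, Q z w = G w * ((θ (w.2 - z.1) ^ 2 * θ (w.1 - z.2) ^ 2 : ℝ) : ℂ) := by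
    intro z w; simp only [hQ]; push_cast; ring
  have hQm : Measurable (Function.uncurry Q) := by
    have h1 : Measurable fun w : (EE n × EE n) × (EE n × EE n) => G w.2 := hGm.comp measurable_snd
    have h2 : Continuous fun w : (EE n × EE n) × (EE n × EE n) =>
      ((θ (w.2.1 - w.1.2) : ℂ) ^ 2 * (θ (w.2.2 - w.1.1) : ℂ) ^ 2) := by fun_prop
    exact h1.mul h2.measurable
  have hQi : Integrable (Function.uncurry Q) (volume.prod volume) := by
    rw [integrable_prod_iff' hQm.aestronglyMeasurable]
    refine ⟨?_, ?_⟩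
    · filter_upwards with w
      simp only [Function.uncurry_apply_pair, hQe]
      exact ((hprod w).ofReal).const_mul _
    · have : (fun w => ∫ z, ‖Function.uncurry Q (z, w)‖) = fun w => ‖G w‖ * cθ ^ 2 := by
        funext w
        simp only [Function.uncurry_apply_pair, hQe, norm_mul, Complex.norm_real]
        rw [integral_const_mul, ← hprode w]
        congr 2
        funext z
        rw [← norm_mul, Real.norm_of_nonneg (by positivity)]
      rw [this]
      exact hG.norm.mul_const _
  have := integral_integral_swap hQi
  rw [this, ← integral_const_mul]
  congr 1
  funext w
  simp only [hQe]
  rw [integral_const_mul, integral_complex_ofReal, hprode w]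
  push_cast
  ring

set_option maxHeartbeats 1600000 in
lemma step1_bilin (n : ℕ) (c B : ℝ) (hc : 0 < c) (hB : 1 ≤ B) :
    ∃ C : ℝ≥0∞, C ≠ ⊤ ∧ ∀ f, PhH n c B f → PhH n c B (f ∘ Prod.swap) → ∀ u g : EE n → ℂ,
      Measurable u → Integrable u → Measurable g → Integrable g →
      ‖∫ ξ, g ξ * ∫ y, eI (f (y, ξ)) * u y‖ₑ ^ 2 ≤ C * (n2 u * n2 g) := by
  set ε := min 1 (c / (2 * B)) with hεd
  have hε0 : 0 < ε := lt_min one_pos (by positivity)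
  have hε1 : ε ≤ 1 := min_le_left _ _
  have hε : B * ε ≤ c / 2 := by
    calc B * ε ≤ B * (c / (2 * B)) := by gcongr; exact min_le_right _ _
      _ = c / 2 := by field_simp
  let b : ContDiffBump (0 : EE n) := ⟨ε / 2, ε, by positivity, by linarith⟩
  obtain ⟨θ, hθd⟩ : ∃ θ : EE n → ℝ, θ = b := ⟨_, rfl⟩
  have hθ : ContDiff ℝ (⊤ : ℕ∞) θ := hθd ▸ b.contDiff
  have hθc : HasCompactSupport θ := hθd ▸ b.hasCompactSupport
  have hθs : tsupport θ ⊆ Metric.closedBall 0 ε := by rw [hθd, b.tsupport_eq]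
  have hθ1 : ∀ z, |θ z| ≤ 1 := fun z => by
    rw [hθd, abs_of_nonneg b.nonneg]; exact b.le_one
  have hθz : ∀ z, θ z ≠ 0 → ‖z‖ ≤ 1 := fun z hz => by
    have := hθs (subset_tsupport _ hz)
    rw [mem_closedBall_zero_iff] at this
    exact this.trans hε1
  have hθcont := hθ.continuous
  set cθ := ∫ y, θ y ^ 2 with hcθ
  have hcθ0 : 0 < cθ := by
    refine Continuous.integral_pos_of_hasCompactSupport_nonneg_nonzero (x := 0) (by fun_prop)
      (hθc.comp_left (g := fun r : ℝ => r ^ 2) (by simp)) (fun x => by positivity) ?_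
    have : θ 0 = 1 := by
      rw [hθd]; exact b.one_of_mem_closedBall (Metric.mem_closedBall_self (by positivity))
    simp [this]
  clear_value ε b
  obtain ⟨D, hD0, hD⟩ := lemF n c B hB θ hθ hθc hθ1 hθz
  obtain ⟨C1, hC10, hC1⟩ := lemC_abs n (max D 1) (by positivity)
  obtain ⟨C2, hC2, hX⟩ := lemX n c B ε hc hB hε θ hθ hθc hθs
  set k := ENNReal.ofReal (cθ ^ 2) with hk
  have hk0 : k ≠ 0 := by simp [hk]; positivity
  have hkt : k ≠ ⊤ := ENNReal.ofReal_ne_top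
  refine ⟨k⁻¹ ^ 2 * (ENNReal.ofReal C1 ^ 2 * (C2 * C2)), by finiteness, fun f hf hf' u g hum hui hgm hgi => ?_⟩
  have hfc : Continuous f := hf.1.continuous
  set U : EE n × EE n → EE n → ℂ := fun z y => eI (f (y, z.2)) * ((θ (y - z.1) : ℂ) * u y) with hU
  set W : EE n × EE n → EE n → ℂ := fun z ξ =>
    eI ((f ∘ Prod.swap) (ξ, z.2)) * ((θ (ξ - z.1) : ℂ) * g ξ) with hW
  set X : EE n × EE n → ℝ≥0∞ := fun z => ∫⁻ κ, ENNReal.ofReal (om n κ) * ‖fti (U z) κ‖ₑ with hXd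
  set Y : EE n × EE n → ℝ≥0∞ := fun z => ∫⁻ κ, ENNReal.ofReal (om n κ) * ‖fti (W z) κ‖ₑ with hYd
  have bX : ∫⁻ z, X z ^ 2 ≤ C2 * n2 u := hX f hf u hum hui
  have bY : ∫⁻ z, Y z ^ 2 ≤ C2 * n2 g := hX _ hf' g hgm hgi
  have measg : ∀ (f : EE n × EE n → ℝ) (u : EE n → ℂ), Continuous f → Measurable u →
      Measurable fun z : EE n × EE n => ∫⁻ κ, ENNReal.ofReal (om n κ) *
        ‖fti (fun y => eI (f (y, z.2)) * ((θ (y - z.1) : ℂ) * u y)) κ‖ₑ := by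
    intro f u hfc hum
    refine Measurable.lintegral_prod_right' (f := fun w : (EE n × EE n) × EE n =>
      ENNReal.ofReal (om n w.2) * ‖fti (fun y => eI (f (y, w.1.2)) * ((θ (y - w.1.1) : ℂ) * u y)) w.2‖ₑ) ?_
    refine ((om_meas n).comp measurable_snd).ennreal_ofReal.mul (Measurable.enorm ?_)
    simp only [fti]
    refine meas_int' (fun w : ((EE n × EE n) × EE n) × EE n =>
      eI (2 * π * ⟪w.1.2, w.2⟫) * (eI (f (w.2, w.1.1.2)) * ((θ (w.2 - w.1.1.1) : ℂ) * u w.2))) ?_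
    have h1 : Measurable fun w : ((EE n × EE n) × EE n) × EE n => u w.2 := hum.comp measurable_snd
    have h2 : Continuous fun w : ((EE n × EE n) × EE n) × EE n =>
      eI (2 * π * ⟪w.1.2, w.2⟫) * (eI (f (w.2, w.1.1.2)) * ((θ (w.2 - w.1.1.1) : ℂ))) := by fun_prop
    convert h2.measurable.mul h1 using 2
    simp only [Pi.mul_apply]
    ring
  have mX : Measurable X := measg f u hfc hum
  have mY : Measurable Y := measg (f ∘ Prod.swap) g (hfc.comp continuous_swap) hgm
  clear measg
  have hUm : ∀ z, Measurable (U z) := fun z => by simp only [hU]; fun_prop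
  have hWm : ∀ z, Measurable (W z) := fun z => by
    have := hfc.comp continuous_swap
    simp only [hW]; fun_prop
  have hbd : ∀ (r : ℝ) (s : EE n), ‖eI r * (θ s : ℂ)‖ ≤ 1 := fun r s => by
    rw [norm_mul, norm_eI, one_mul, Complex.norm_real]; exact hθ1 s
  have hUi : ∀ z, Integrable (U z) := fun z => by
    simp only [hU, ← mul_assoc]
    exact int_bdd_mul _ _ (by fun_prop) 1 (fun y => hbd _ _) hum hui
  have hWi : ∀ z, Integrable (W z) := fun z => by
    have := hfc.comp continuous_swap
    simp only [hW, ← mul_assoc]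
    exact int_bdd_mul _ _ (by fun_prop) 1 (fun y => hbd _ _) hgm hgi
  -- the full double integral
  set G : EE n × EE n → ℂ := fun w => eI (f (w.2, w.1)) * (g w.1 * u w.2) with hG
  have hgu : Measurable fun w : EE n × EE n => g w.1 * u w.2 :=
    (hgm.comp measurable_fst).mul (hum.comp measurable_snd)
  have hGm : Measurable G := by simp only [hG]; fun_prop
  have hGi : Integrable G :=
    int_bdd_mul _ _ (by fun_prop) 1 (fun w => (norm_eI _).le) hgu (hgi.mul_prod hui)
  have hI : ∫ ξ, g ξ * ∫ y, eI (f (y, ξ)) * u y = ∫ w, G w := by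
    rw [Measure.volume_eq_prod, integral_prod _ hGi]
    congr 1; funext ξ
    rw [← integral_const_mul]
    congr 1; funext y
    simp only [hG]; ring
  have hJ : ∀ z : EE n × EE n, ∫ w : EE n × EE n,
      G w * ((θ (w.1 - z.2) : ℂ) ^ 2 * (θ (w.2 - z.1) : ℂ) ^ 2) =
      eI (-(f z)) * ∫ ξ, W z.swap ξ * ∫ y, Ff f θ z.1 z.2 y ξ * U z y := by
    intro z
    have hi : Integrable fun w : EE n × EE n =>
        G w * ((θ (w.1 - z.2) : ℂ) ^ 2 * (θ (w.2 - z.1) : ℂ) ^ 2) := by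
      simp_rw [mul_comm (G _)]
      refine int_bdd_mul _ _ (by fun_prop) 1 (fun w => ?_) hGm hGi
      rw [norm_mul, norm_pow, norm_pow, Complex.norm_real, Complex.norm_real]
      have h1 := hθ1 (w.1 - z.2)
      have h2 := hθ1 (w.2 - z.1)
      exact mul_le_one₀ (pow_le_one₀ (abs_nonneg _) h1) (by positivity) (pow_le_one₀ (abs_nonneg _) h2)
    rw [Measure.volume_eq_prod, integral_prod _ hi, ← integral_const_mul]
    congr 1; funext ξ
    rw [← integral_const_mul, ← integral_const_mul]
    congr 1; funext y
    simp only [hG, hW, hU, Ff]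
    have : eI (f (y, ξ)) = eI (-(f z)) * (eI ((f ∘ Prod.swap) (ξ, z.swap.2)) *
        ((eI (-(f (z.1, ξ) - f (z.1, z.2))) * eI (f (y, ξ) - f (y, z.2))) * eI (f (y, z.2)))) := by
      rw [← eI_add, ← eI_add, ← eI_add, ← eI_add]
      congr 1
      simp
      ring
    rw [this]
    simp only [Prod.fst_swap, Prod.snd_swap]
    ring
  have hJb : ∀ z : EE n × EE n, ‖eI (-(f z)) * ∫ ξ, W z.swap ξ * ∫ y, Ff f θ z.1 z.2 y ξ * U z y‖ₑ ≤
      ENNReal.ofReal C1 * (X z * Y z.swap) := by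
    intro z
    rw [enorm_mul, enorm_eI, one_mul]
    refine (hC1 (Ff f θ z.1 z.2) z.1 z.2 (Ff_cont f hfc θ hθcont _ _)
      (fun ξ => Ff_smooth f hf.1 θ hθ _ _ ξ) (fun y => ?_) (fun y ξ hne => ?_)
      (fun y ξ => (Ff_norm f θ hθ1 _ _ _ _).trans (le_max_right _ _))
      (fun ξ j k hk w => (hD f hf _ _ ξ j k hk w).trans (le_max_left _ _))
      (fun y j k hk w => ?_) (U z) (W z.swap) (hUm z) (hUi z) (hWm _) (hWi _)).trans (le_of_eq ?_)
    · simp_rw [Ff_swap f]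
      exact Ff_smooth _ hf'.1 θ hθ _ _ y
    · unfold Ff at hne
      constructor
      · apply hθz; intro h; simp [h] at hne
      · apply hθz; intro h; simp [h] at hne
    · simp_rw [Ff_swap f]
      exact (hD _ hf' _ _ y j k hk w).trans (le_max_left _ _)
    · congr 1
      simp only [hXd, hYd]
      have m1 : Measurable fun κ => ENNReal.ofReal (om n κ) * ‖fti (U z) κ‖ₑ :=
        (om_meas n).ennreal_ofReal.mul (fti_meas _ (hUm z)).enorm
      have m2 : Measurable fun κ => ENNReal.ofReal (om n κ) * ‖fti (W z.swap) κ‖ₑ :=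
        (om_meas n).ennreal_ofReal.mul (fti_meas _ (hWm _)).enorm
      rw [← lintegral_mul_const _ m1]
      refine lintegral_congr fun κ => ?_
      rw [← lintegral_const_mul _ m2]
      refine lintegral_congr fun l => ?_
      ring
  have main := local_avg θ hθcont hθc G hGm hGi
  rw [← hI] at main
  simp_rw [hJ] at main
  have b1 : k * ‖∫ ξ, g ξ * ∫ y, eI (f (y, ξ)) * u y‖ₑ ≤ ENNReal.ofReal C1 * ∫⁻ z, X z * Y z.swap := by
    have e : k = ‖((cθ : ℝ) : ℂ) ^ 2‖ₑ := by
      rw [hk, ← ofReal_norm, norm_pow, Complex.norm_real, Real.norm_of_nonneg hcθ0.le]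
    rw [e, ← enorm_mul, main, ← lintegral_const_mul' _ _ ENNReal.ofReal_ne_top]
    exact (enorm_integral_le_lintegral_enorm _).trans (lintegral_mono hJb)
  have b2 : (∫⁻ z, X z * Y z.swap) ^ 2 ≤ (C2 * n2 u) * (C2 * n2 g) := by
    refine (cs_lint volume X (fun z => Y z.swap) mX.aemeasurable
      (mY.comp measurable_swap).aemeasurable).trans ?_
    have : ∫⁻ z : EE n × EE n, Y z.swap ^ 2 = ∫⁻ z, Y z ^ 2 :=
      (Measure.measurePreserving_swap (μ := (volume : Measure (EE n))) (ν := (volume : Measure (EE n)))).lintegral_comp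
        (f := fun z => Y z ^ 2) (mY.pow_const 2)
    rw [this]
    gcongr
  calc _ = k⁻¹ ^ 2 * (k * ‖∫ ξ, g ξ * ∫ y, eI (f (y, ξ)) * u y‖ₑ) ^ 2 := by
        rw [mul_pow, ← mul_assoc, ← mul_pow, ENNReal.inv_mul_cancel hk0 hkt, one_pow, one_mul]
    _ ≤ k⁻¹ ^ 2 * (ENNReal.ofReal C1 * ∫⁻ z, X z * Y z.swap) ^ 2 := by gcongr
    _ = k⁻¹ ^ 2 * (ENNReal.ofReal C1 ^ 2 * (∫⁻ z, X z * Y z.swap) ^ 2) := by rw [mul_pow]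
    _ ≤ k⁻¹ ^ 2 * (ENNReal.ofReal C1 ^ 2 * ((C2 * n2 u) * (C2 * n2 g))) := by gcongr
    _ = _ := by ring

/-- Step 1: L² boundedness of the operator with kernel `exp(i f)`. -/
lemma step1 (n : ℕ) (c B : ℝ) (hc : 0 < c) (hB : 1 ≤ B) :
    ∃ C : ℝ≥0∞, C ≠ ⊤ ∧ ∀ f, PhH n c B f → PhH n c B (f ∘ Prod.swap) → ∀ u : EE n → ℂ,
      Measurable u → Integrable u → n2 (fun ξ => ∫ y, eI (f (y, ξ)) * u y) ≤ C * n2 u := by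
  obtain ⟨C, hC, H⟩ := step1_bilin n c B hc hB
  refine ⟨C, hC, fun f hf hf' u hum hui => ?_⟩
  have hfc : Continuous f := hf.1.continuous
  refine duality _ ?_ (∫ y, ‖u y‖) (fun ξ => ?_) _ (fun g hgm hgi _ _ => ?_)
  · refine meas_int' (fun w : EE n × EE n => eI (f (w.2, w.1)) * u w.2) ?_
    have : Measurable fun w : EE n × EE n => u w.2 := hum.comp measurable_snd
    exact (show Continuous fun w : EE n × EE n => eI (f (w.2, w.1)) by fun_prop).measurable.mul this
  · refine (norm_integral_le_integral_norm _).trans (le_of_eq ?_)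
    simp [norm_mul, norm_eI]
  · have := H f hf hf' u g hum hui hgm hgi
    simp_rw [mul_comm (g _)] at this
    rw [mul_assoc]
    exact this

lemma dX_inner {n : ℕ} (r : ℝ) (j : Fin n) :
    dLine (dY j) (fun z : EE n × EE n => r * ⟪z.1, z.2⟫) = fun z => r * z.1 j := by
  funext z
  unfold dLine
  have h : HasFDerivAt (fun z : EE n × EE n => r * ⟪z.1, z.2⟫) _ z :=
    ((hasFDerivAt_fst (𝕜 := ℝ) (p := z)).inner ℝ (hasFDerivAt_snd (𝕜 := ℝ) (p := z))).const_mul r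
  rw [h.fderiv]
  simp [dY]
  exact Or.inl (by simp [EuclideanSpace.inner_single_right])

lemma mixed_inner {n : ℕ} (r : ℝ) (i j : Fin n) :
    mixedHessXY (fun z : EE n × EE n => r * ⟪z.1, z.2⟫) i j = fun _ => if i = j then r else 0 := by
  funext z
  rw [mixedHessXY, dX_inner]
  unfold dLine
  have h : HasFDerivAt (fun z : EE n × EE n => r * z.1 j)
      (r • ((EuclideanSpace.proj (𝕜 := ℝ) j).comp (ContinuousLinearMap.fst ℝ (EE n) (EE n)))) z :=
    (((EuclideanSpace.proj (𝕜 := ℝ) j).comp (ContinuousLinearMap.fst ℝ (EE n) (EE n))).hasFDerivAt).const_mul r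
  rw [h.fderiv]
  simp [dX, Pi.single_apply, eq_comm]

lemma hyp_inner (n : ℕ) (r : ℝ) : HypPh n (|r| ^ n) |r| (fun z : EE n × EE n => r * ⟪z.1, z.2⟫) := by
  refine ⟨?_, fun z => ?_, fun i j m k _ z => ?_⟩
  · exact contDiff_const.mul (contDiff_fst.inner ℝ contDiff_snd)
  · have : (Matrix.of fun i j => mixedHessXY (fun z : EE n × EE n => r * ⟪z.1, z.2⟫) i j z) =
        r • (1 : Matrix (Fin n) (Fin n) ℝ) := by
      ext i j
      simp [mixed_inner, Matrix.one_apply]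
    rw [this]
    simp [Matrix.det_smul, abs_pow]
  · have hz : ∀ (v : EE n × EE n) (s : ℝ) (k : ℕ) (z), |(dLine v)^[k] (fun _ : EE n × EE n => s) z| ≤ |s| := by
      intro v s k z
      rcases k with _ | k
      · simp
      · have h0 : ∀ s : ℝ, dLine v (fun _ : EE n × EE n => s) = fun _ => 0 := by
          intro s; funext z; simp [dLine]
        have : ∀ k, (dLine v)^[k] (fun _ : EE n × EE n => (0 : ℝ)) = fun _ => 0 := by
          intro k
          induction k with
          | zero => rfl
          | succ k ih => rw [Function.iterate_succ_apply, h0, ih]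
        rw [Function.iterate_succ_apply, h0, this]
        simp
    have hs : |if i = j then r else 0| ≤ |r| := by split_ifs <;> simp
    rw [mixed_inner]
    exact ⟨(hz _ _ _ _).trans hs, (hz _ _ _ _).trans hs⟩

/-- Plancherel-type inequality for integrable functions. -/
lemma planch (n : ℕ) (r : ℝ) (hr : r ≠ 0) : ∃ C : ℝ≥0∞, C ≠ ⊤ ∧ ∀ u : EE n → ℂ,
    Measurable u → Integrable u → n2 (fun ξ => ∫ y, eI (r * ⟪y, ξ⟫) * u y) ≤ C * n2 u := by
  obtain ⟨c, B, hc, hB, H⟩ := HypPh.toPhH n (|r| ^ n) |r| (by positivity)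
  obtain ⟨C, hC, H1⟩ := step1 n c B hc hB
  exact ⟨C, hC, fun u => H1 _ (H _ (hyp_inner n r)) (H _ (hyp_inner n r).swap) u⟩

/-! ### Step 2a: representation of the amplitude -/

/-- one-dimensional exponential kernel -/
def e1 (s : ℝ) : ℝ := (Set.Ioi 0).indicator (fun s => Real.exp (-s)) s

lemma e1_nonneg (s : ℝ) : 0 ≤ e1 s := Set.indicator_nonneg (fun _ _ => (Real.exp_pos _).le) _

lemma e1_meas : Measurable e1 := by
  unfold e1
  exact Measurable.indicator (by fun_prop) measurableSet_Ioi

lemma e1_int : Integrable e1 := by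
  unfold e1
  rw [integrable_indicator_iff measurableSet_Ioi]
  exact integrableOn_exp_neg_Ioi 0

/-- product exponential kernel -/
def eN {n : ℕ} (s : Fin n → ℝ) : ℝ := ∏ i, e1 (s i)

lemma eN_nonneg {n : ℕ} (s : Fin n → ℝ) : 0 ≤ eN s := Finset.prod_nonneg fun _ _ => e1_nonneg _

lemma eN_meas {n : ℕ} : Measurable (eN (n := n)) := by
  unfold eN
  exact Finset.measurable_prod _ fun i _ => e1_meas.comp (measurable_pi_apply i)

lemma eN_int {n : ℕ} : Integrable (eN (n := n)) := by
  unfold eN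
  exact Integrable.fintype_prod (f := fun _ : Fin n => e1) fun _ => e1_int

section lop
variable {W : Type*} [NormedAddCommGroup W] [NormedSpace ℝ W]

/-- the operator `∏ (1 - ∂_i)` -/
def Lop : (n : ℕ) → (Fin n → W) → (W → ℂ) → W → ℂ
  | 0, _, f => f
  | n + 1, dirs, f => fun z => Lop n (fun i => dirs i.succ) f z -
      dLine (dirs 0) (Lop n (fun i => dirs i.succ) f) z

lemma Lop_smooth (n : ℕ) (dirs : Fin n → W) (f : W → ℂ) (hf : ContDiff ℝ (⊤ : ℕ∞) f) :
    ContDiff ℝ (⊤ : ℕ∞) (Lop n dirs f) := by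
  induction n with
  | zero => exact hf
  | succ n ih =>
    have := ih (fun i => dirs i.succ)
    exact this.sub (dLine_smooth _ _ this)

lemma dLine_sub (v : W) (f g : W → ℂ) (hf : ContDiff ℝ (⊤ : ℕ∞) f) (hg : ContDiff ℝ (⊤ : ℕ∞) g) :
    dLine v (fun z => f z - g z) = fun z => dLine v f z - dLine v g z := by
  funext z
  unfold dLine
  have h1 := (hf.differentiable (by simp)) z
  have h2 := (hg.differentiable (by simp)) z
  rw [fderiv_fun_sub h1 h2]
  simp

lemma dLine_iter_sub (v : W) (f g : W → ℂ) (hf : ContDiff ℝ (⊤ : ℕ∞) f) (hg : ContDiff ℝ (⊤ : ℕ∞) g)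
    (k : ℕ) : (dLine v)^[k] (fun z => f z - g z) = fun z => (dLine v)^[k] f z - (dLine v)^[k] g z := by
  induction k with
  | zero => rfl
  | succ k ih =>
    rw [Function.iterate_succ_apply', ih, dLine_sub _ _ _ (dLine_iter_smooth v f hf k)
      (dLine_iter_smooth v g hg k), Function.iterate_succ_apply', Function.iterate_succ_apply']

lemma Lop_bound (n : ℕ) (dirs : Fin n → W) (f : W → ℂ) (hf : ContDiff ℝ (⊤ : ℕ∞) f)
    (A : ℝ) (D : (W → ℂ) → ℂ)
    (hD : ∀ f g, ContDiff ℝ (⊤ : ℕ∞) f → ContDiff ℝ (⊤ : ℕ∞) g → D (fun z => f z - g z) = D f - D g)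
    (h : ∀ β : Fin n → ℕ, (∀ i, β i ≤ 1) → ‖D (mderiv dirs β f)‖ ≤ A) :
    ‖D (Lop n dirs f)‖ ≤ 2 ^ n * A := by
  induction n generalizing D with
  | zero => simpa [Lop, mderiv] using h (fun i => i.elim0) (fun i => i.elim0)
  | succ n ih =>
    have hs := Lop_smooth n (fun i => dirs i.succ) f hf
    have e : D (Lop (n + 1) dirs f) = D (Lop n (fun i => dirs i.succ) f) -
        D (dLine (dirs 0) (Lop n (fun i => dirs i.succ) f)) := hD _ _ hs (dLine_smooth _ _ hs)
    rw [e]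
    have b1 := ih (fun i => dirs i.succ) D hD (fun β hβ => by
      have := h (Fin.cons 0 β) (fun i => Fin.cases (by simp) (fun j => by simpa using hβ j) i)
      rw [mderiv_succ] at this
      simpa using this)
    have b2 := ih (fun i => dirs i.succ) (fun g => D (dLine (dirs 0) g))
      (fun f g hf hg => by
        show D (dLine (dirs 0) fun z => f z - g z) = _
        rw [dLine_sub _ _ _ hf hg]
        exact hD _ _ (dLine_smooth _ _ hf) (dLine_smooth _ _ hg)) (fun β hβ => by
      have := h (Fin.cons 1 β) (fun i => Fin.cases (by simp) (fun j => by simpa using hβ j) i)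
      rw [mderiv_succ] at this
      simpa using this)
    calc _ ≤ _ := norm_sub_le _ _
      _ ≤ 2 ^ n * A + 2 ^ n * A := add_le_add b1 b2
      _ = _ := by ring

lemma rep1 (d : W) (h : W → ℂ) (hh : ContDiff ℝ (⊤ : ℕ∞) h) (A : ℝ) (h1 : ∀ z, ‖h z‖ ≤ A)
    (h2 : ∀ z, ‖dLine d h z‖ ≤ A) (z : W) :
    h z = ∫ s : ℝ, (e1 s : ℂ) * (h (z + s • d) - dLine d h (z + s • d)) := by
  have hc1 : Continuous h := hh.continuous
  have hc2 : Continuous (dLine d h) := (dLine_smooth d h hh).continuous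
  have e : ∀ s : ℝ, (e1 s : ℂ) * (h (z + s • d) - dLine d h (z + s • d)) =
      (Set.Ioi (0 : ℝ)).indicator (fun s : ℝ => ((Real.exp (-s) : ℝ) : ℂ) *
        (h (z + s • d) - dLine d h (z + s • d))) s := by
    intro s
    unfold e1
    by_cases hs : s ∈ Set.Ioi (0 : ℝ) <;> simp [hs]
  simp_rw [e]
  rw [integral_indicator measurableSet_Ioi]
  have hd : ∀ s ∈ Set.Ici (0 : ℝ), HasDerivAt (fun s : ℝ => -(((Real.exp (-s) : ℝ) : ℂ) * h (z + s • d)))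
      (((Real.exp (-s) : ℝ) : ℂ) * (h (z + s • d) - dLine d h (z + s • d))) s := by
    intro s _
    have d1 := deriv_line d z h s (hh.differentiable (by simp) _)
    have d2 : HasDerivAt (fun s : ℝ => ((Real.exp (-s) : ℝ) : ℂ)) ((-Real.exp (-s) : ℝ) : ℂ) s := by
      have : HasDerivAt (fun s : ℝ => Real.exp (-s)) (-Real.exp (-s)) s := by
        simpa using (hasDerivAt_neg s).exp
      exact this.ofReal_comp
    refine (d2.mul d1).neg.congr_deriv ?_
    push_cast; ring
  have hi : IntegrableOn (fun s : ℝ => ((Real.exp (-s) : ℝ) : ℂ) *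
      (h (z + s • d) - dLine d h (z + s • d))) (Set.Ioi 0) := by
    refine Integrable.mono' ((integrableOn_exp_neg_Ioi 0).mul_const (A + A))
      (Continuous.aestronglyMeasurable (by fun_prop)) ?_
    filter_upwards with s
    rw [norm_mul, Complex.norm_real, Real.norm_of_nonneg (Real.exp_pos _).le]
    gcongr
    exact (norm_sub_le _ _).trans (add_le_add (h1 _) (h2 _))
  have ht : Filter.Tendsto (fun s : ℝ => -(((Real.exp (-s) : ℝ) : ℂ) * h (z + s • d)))
      Filter.atTop (nhds 0) := by
    refine squeeze_zero_norm (a := fun s : ℝ => Real.exp (-s) * A) (fun s => ?_) ?_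
    · rw [norm_neg, norm_mul, Complex.norm_real, Real.norm_of_nonneg (Real.exp_pos _).le]
      gcongr
      exact h1 _
    · simpa using Real.tendsto_exp_neg_atTop_nhds_zero.mul_const A
  rw [integral_Ioi_of_hasDerivAt_of_tendsto' hd hi ht]
  simp

lemma repN (n : ℕ) (dirs : Fin n → W) (f : W → ℂ) (hf : ContDiff ℝ (⊤ : ℕ∞) f) (A : ℝ)
    (h : ∀ β : Fin n → ℕ, (∀ i, β i ≤ 1) → ∀ z, ‖mderiv dirs β f z‖ ≤ A) (z : W) :
    f z = ∫ s : Fin n → ℝ, (eN s : ℂ) * Lop n dirs f (z + ∑ i, s i • dirs i) := by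
  induction n generalizing z with
  | zero =>
    have hv : (volume : Measure (Fin 0 → ℝ)).real Set.univ = 1 := by
      simp [Measure.real, volume_pi, Measure.pi_of_empty]
    simp [eN, Lop, hv]
  | succ n ih =>
    have ih' := ih (fun i => dirs i.succ) (fun β hβ z => by
      have := h (Fin.cons 0 β) (fun i => Fin.cases (by simp) (fun j => by simpa using hβ j) i) z
      rw [mderiv_succ] at this
      simpa using this)
    set L := Lop n (fun i => dirs i.succ) f with hL
    have hLs : ContDiff ℝ (⊤ : ℕ∞) L := Lop_smooth _ _ _ hf
    have b1 : ∀ z, ‖L z‖ ≤ 2 ^ n * A := fun z =>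
      Lop_bound n (fun i => dirs i.succ) f hf A (fun g => g z) (fun _ _ _ _ => rfl) (fun β hβ => by
      have := h (Fin.cons 0 β) (fun i => Fin.cases (by simp) (fun j => by simpa using hβ j) i) z
      rw [mderiv_succ] at this
      simpa using this)
    have b2 : ∀ z, ‖dLine (dirs 0) L z‖ ≤ 2 ^ n * A := fun z =>
      Lop_bound n (fun i => dirs i.succ) f hf A (fun g => dLine (dirs 0) g z)
        (fun f g hf hg => by
          show dLine (dirs 0) (fun z => f z - g z) z = _
          rw [dLine_sub _ _ _ hf hg]) (fun β hβ => by
      have := h (Fin.cons 1 β) (fun i => Fin.cases (by simp) (fun j => by simpa using hβ j) i) z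
      rw [mderiv_succ] at this
      simpa using this)
    have hM : ∀ w, Lop (n + 1) dirs f w = L w - dLine (dirs 0) L w := fun w => rfl
    have hMc : Continuous (Lop (n + 1) dirs f) := (Lop_smooth _ _ _ hf).continuous
    have hMb : ∀ w, ‖Lop (n + 1) dirs f w‖ ≤ 2 ^ n * A + 2 ^ n * A := fun w =>
      (norm_sub_le _ _).trans (add_le_add (b1 w) (b2 w))
    have hmp := volume_preserving_piFinSuccAbove (fun _ : Fin (n + 1) => ℝ) 0
    have e2 : ∀ s : Fin (n + 1) → ℝ, (eN s : ℂ) * Lop (n + 1) dirs f (z + ∑ i, s i • dirs i) =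
        (fun w : ℝ × (Fin n → ℝ) => (e1 w.1 : ℂ) * (eN w.2 : ℂ) *
          Lop (n + 1) dirs f (z + ∑ i, w.2 i • dirs i.succ + w.1 • dirs 0))
          (MeasurableEquiv.piFinSuccAbove (fun _ : Fin (n + 1) => ℝ) 0 s) := by
      intro s
      have e3 : MeasurableEquiv.piFinSuccAbove (fun _ : Fin (n + 1) => ℝ) 0 s = (s 0, fun i => s i.succ) := by
        rfl
      rw [e3]
      simp only [eN, Fin.prod_univ_succ, Fin.sum_univ_succ]
      push_cast
      congr 2
      abel
    rw [integral_congr_ae (Filter.Eventually.of_forall e2), hmp.integral_comp'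
      (g := fun w : ℝ × (Fin n → ℝ) => (e1 w.1 : ℂ) * (eN w.2 : ℂ) *
          Lop (n + 1) dirs f (z + ∑ i, w.2 i • dirs i.succ + w.1 • dirs 0))]
    have hIntg : Integrable (fun w : ℝ × (Fin n → ℝ) => (e1 w.1 : ℂ) * (eN w.2 : ℂ) *
          Lop (n + 1) dirs f (z + ∑ i, w.2 i • dirs i.succ + w.1 • dirs 0)) := by
      have i1 : Integrable (fun w : ℝ × (Fin n → ℝ) => e1 w.1 * eN w.2) := e1_int.mul_prod eN_int
      refine Integrable.mono' (i1.mul_const (2 ^ n * A + 2 ^ n * A)) ?_ ?_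
      · have m1 := i1.aestronglyMeasurable
        have m2 : AEStronglyMeasurable (fun w : ℝ × (Fin n → ℝ) => ((e1 w.1 * eN w.2 : ℝ) : ℂ)) volume :=
          Complex.continuous_ofReal.comp_aestronglyMeasurable m1
        refine AEStronglyMeasurable.mul ?_ (Continuous.aestronglyMeasurable (by fun_prop))
        simpa using m2
      · filter_upwards with w
        rw [norm_mul, norm_mul, Complex.norm_real, Complex.norm_real,
          Real.norm_of_nonneg (e1_nonneg _), Real.norm_of_nonneg (eN_nonneg _)]
        have := e1_nonneg w.1
        have := eN_nonneg w.2
        gcongr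
        exact hMb _
    rw [ih' z, Measure.volume_eq_prod, integral_prod_symm _ hIntg]
    congr 1
    funext s
    rw [rep1 (dirs 0) L hLs (2 ^ n * A) b1 b2, ← integral_const_mul]
    congr 1
    funext t
    rw [hM]
    ring

end lop

/-! ### Step 2b: the kernel on Euclidean space and oscillatory integrals -/

/-- product exponential kernel on Euclidean space -/
def Ee {n : ℕ} (s : EE n) : ℝ := eN (WithLp.ofLp s)

lemma Ee_nonneg {n : ℕ} (s : EE n) : 0 ≤ Ee s := eN_nonneg _

@[fun_prop]
lemma Ee_meas {n : ℕ} : Measurable (Ee (n := n)) :=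
  eN_meas.comp (PiLp.volume_preserving_ofLp (Fin n)).measurable

lemma Ee_le {n : ℕ} (s : EE n) : Ee s ≤ Real.exp (-‖s‖) := by
  unfold Ee eN
  by_cases h : ∀ i, 0 < s i
  · have e : ∏ i, e1 (s i) = Real.exp (-∑ i, s i) := by
      rw [← Finset.sum_neg_distrib, Real.exp_sum]
      refine Finset.prod_congr rfl fun i _ => ?_
      unfold e1
      rw [Set.indicator_of_mem (by exact h i)]
    rw [e]
    apply Real.exp_le_exp.2
    apply neg_le_neg
    conv_lhs => rw [euclid_sum s]
    refine (norm_sum_le _ _).trans (Finset.sum_le_sum fun i _ => ?_)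
    rw [norm_smul]
    simp [abs_of_pos (h i)]
  · push Not at h
    obtain ⟨i, hi⟩ := h
    rw [Finset.prod_eq_zero (Finset.mem_univ i)]
    · positivity
    · unfold e1
      rw [Set.indicator_of_notMem (by simpa using hi)]

lemma Ee_le_one {n : ℕ} (s : EE n) : Ee s ≤ 1 :=
  (Ee_le s).trans (by simp)

lemma Ee_moment {n : ℕ} (k : ℕ) (j : Fin n) :
    ∫⁻ s : EE n, ‖((s j : ℂ) ^ k * (Ee s : ℂ))‖ₑ ^ 2 ≠ ⊤ := by
  have hIntg := integrable_one_add_norm (μ := (volume : Measure (EE n))) (r := (n : ℝ) + 1) (by simp)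
  set N := 2 * k + (n + 1) with hN
  have hIntg2 := hIntg.const_mul ((N.factorial : ℝ) * Real.exp 1)
  refine ne_of_lt (lt_of_le_of_lt (lintegral_mono fun s => ?_) hIntg2.lintegral_lt_top)
  rw [← ofReal_norm, ← ENNReal.ofReal_pow (norm_nonneg _)]
  apply ENNReal.ofReal_le_ofReal
  have ht : (0 : ℝ) ≤ ‖s‖ := norm_nonneg s
  set t := ‖s‖ with htt
  rw [norm_mul, norm_pow, Complex.norm_real, Complex.norm_real, Real.norm_eq_abs, Real.norm_eq_abs,
    abs_of_nonneg (Ee_nonneg s)]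
  have h1 : (|s j| ^ k * Ee s) ≤ (1 + t) ^ k * Real.exp (-t) := by
    apply mul_le_mul _ (Ee_le s) (Ee_nonneg s) (by positivity)
    apply pow_le_pow_left₀ (abs_nonneg _)
    linarith [coord_le s j]
  have h2 := Real.pow_div_factorial_le_exp (1 + t) (by positivity) N
  rw [div_le_iff₀ (by positivity)] at h2
  have h3 : (1 + t) ^ (-((n : ℝ) + 1)) = ((1 + t) ^ (n + 1))⁻¹ := by
    rw [Real.rpow_neg (by positivity)]
    congr 1
    exact_mod_cast Real.rpow_natCast (1 + t) (n + 1)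
  rw [h3]
  calc (|s j| ^ k * Ee s) ^ 2 ≤ ((1 + t) ^ k * Real.exp (-t)) ^ 2 :=
        pow_le_pow_left₀ (mul_nonneg (by positivity) (Ee_nonneg s)) h1 2
    _ = ((1 + t) ^ N * ((1 + t) ^ (n + 1))⁻¹) * (Real.exp (-t) * Real.exp (-t)) := by
        rw [hN, pow_add, mul_assoc ((1 + t) ^ (2 * k)), mul_inv_cancel₀ (by positivity)]
        ring
    _ ≤ ((Real.exp (1 + t) * N.factorial) * ((1 + t) ^ (n + 1))⁻¹) * (Real.exp (-t) * 1) := by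
        gcongr
        simpa using ht
    _ = N.factorial * Real.exp 1 * ((1 + t) ^ (n + 1))⁻¹ := by
        rw [Real.exp_add, Real.exp_neg]
        field_simp

lemma Ee_int {n : ℕ} : Integrable (Ee (n := n)) :=
  (PiLp.volume_preserving_ofLp (Fin n)).integrable_comp_of_integrable eN_int

lemma Ee_sq {n : ℕ} : ∫⁻ s : EE n, ‖(Ee s : ℂ)‖ₑ ^ 2 ≠ ⊤ := by
  refine ne_of_lt (lt_of_le_of_lt (lintegral_mono fun s => ?_) (Ee_int (n := n)).lintegral_lt_top)
  rw [← ofReal_norm, ← ENNReal.ofReal_pow (norm_nonneg _)]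
  apply ENNReal.ofReal_le_ofReal
  rw [Complex.norm_real, Real.norm_eq_abs, abs_of_nonneg (Ee_nonneg s)]
  nlinarith [Ee_le_one s, Ee_nonneg s]

lemma rep_amp {n : ℕ} (a : EE n × EE n → ℂ) (ha : ContDiff ℝ (⊤ : ℕ∞) a) (A : ℝ)
    (h : ∀ β : Fin n → ℕ, (∀ i, β i ≤ 1) → ∀ z, ‖mderiv dY β a z‖ ≤ A) (x ξ : EE n) :
    a (x, ξ) = ∫ s : EE n, (Ee s : ℂ) * Lop n dY a (x, ξ + s) := by
  rw [repN n dY a ha A h (x, ξ)]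
  rw [← (PiLp.volume_preserving_ofLp (Fin n)).integral_comp
    (MeasurableEquiv.toLp 2 (Fin n → ℝ)).symm.measurableEmbedding]
  congr 1
  funext s
  congr 2
  have : ∑ i, (WithLp.ofLp s) i • (dY i : EE n × EE n) = (0, s) := by
    apply Prod.ext
    · simp [dY, Prod.fst_sum]
    · simp only [dY, Prod.snd_sum, Prod.smul_snd]
      exact (euclid_sum s).symm
  rw [this]
  simp

/-- bounded, measurable, vanishing outside a ball -/
def Nice {n : ℕ} (w : EE n → ℂ) : Prop :=
  Measurable w ∧ (∃ M, ∀ x, ‖w x‖ ≤ M) ∧ ∃ R, ∀ x, R ≤ ‖x‖ → w x = 0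

lemma Nice.mul_cont {n : ℕ} {w : EE n → ℂ} (hw : Nice w) (g : EE n → ℂ) (hg : Continuous g) :
    Nice (fun s => g s * w s) := by
  obtain ⟨hm, ⟨M, hM⟩, R, hR⟩ := hw
  obtain ⟨M', hM'⟩ := (isCompact_closedBall (0 : EE n) R).exists_bound_of_continuousOn hg.continuousOn
  refine ⟨hg.measurable.mul hm, ⟨|M'| * M, fun x => ?_⟩, R, fun x hx => by simp [hR x hx]⟩
  have hM0 := (norm_nonneg _).trans (hM x)
  by_cases hx : R ≤ ‖x‖
  · simp only [hR x hx]; simp; positivity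
  · rw [norm_mul]
    push Not at hx
    have := hM' x (by simpa using hx.le)
    exact mul_le_mul (this.trans (le_abs_self _)) (hM x) (norm_nonneg _) (abs_nonneg _)

lemma Nice.integrable {n : ℕ} {w : EE n → ℂ} (hw : Nice w) : Integrable w := by
  obtain ⟨hm, ⟨M, hM⟩, R, hR⟩ := hw
  have : IntegrableOn w (Metric.closedBall 0 R) :=
    Measure.integrableOn_of_bounded (M := M) (measure_closedBall_lt_top).ne hm.aestronglyMeasurable
      (Filter.Eventually.of_forall hM)
  refine (integrableOn_iff_integrable_of_support_subset ?_).1 this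
  intro x hx
  by_contra hc
  exact hx (hR x (by simp at hc; exact hc.le))

/-- oscillatory integral -/
def osc {n : ℕ} (w : EE n → ℂ) (x : EE n) : ℂ := ∫ s, eI (-⟪x, s⟫) * w s

lemma osc_eq {n : ℕ} (w : EE n → ℂ) : osc w = fun x => ft w ((2 * π)⁻¹ • x) := by
  funext x
  unfold osc ft
  congr 1; funext s
  congr 3
  rw [real_inner_smul_left]
  field_simp

lemma Nice.pow_int {n : ℕ} {w : EE n → ℂ} (hw : Nice w) (k : ℕ) :
    Integrable (fun v => ‖v‖ ^ k * ‖w v‖) := by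
  have := (hw.mul_cont (fun v => ((‖v‖ ^ k : ℝ) : ℂ)) (by fun_prop)).integrable.norm
  simpa using this

lemma osc_smooth {n : ℕ} (w : EE n → ℂ) (hw : Nice w) : ContDiff ℝ (⊤ : ℕ∞) (osc w) := by
  rw [osc_eq, ← ft_eq]
  have : ContDiff ℝ (⊤ : ℕ∞) (FourierTransform.fourier w) :=
    Real.contDiff_fourier (fun k _ => hw.pow_int k)
  exact this.comp (contDiff_const_smul _)

lemma osc_deriv {n : ℕ} (w : EE n → ℂ) (hw : Nice w) (j : Fin n) :
    dLine (EuclideanSpace.single j 1) (osc w) = osc (fun s => (-Complex.I * (s j : ℂ)) * w s) := by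
  funext x
  set e : EE n := EuclideanSpace.single j 1 with he
  have hin : ∀ s : EE n, ⟪e, s⟫ = s j := fun s => by simp [he, EuclideanSpace.inner_single_left]
  have hN := hw.mul_cont (fun s => (-Complex.I * (s j : ℂ))) (by fun_prop)
  have hwm := hw.1
  have key := hasDerivAt_integral_of_dominated_loc_of_deriv_le (μ := (volume : Measure (EE n)))
    (F := fun (t : ℝ) s => eI (-⟪x + t • e, s⟫) * w s)
    (F' := fun (t : ℝ) s => eI (-⟪x + t • e, s⟫) * ((-Complex.I * (s j : ℂ)) * w s))
    (x₀ := 0) (s := Set.univ) (bound := fun s => ‖(-Complex.I * (s j : ℂ)) * w s‖) Filter.univ_mem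
    (Filter.Eventually.of_forall fun t => by
      have : Measurable fun s => eI (-⟪x + t • e, s⟫) * w s := by fun_prop
      exact this.aestronglyMeasurable)
    (by
      refine hw.integrable.norm.mono ?_ ?_
      · have : Measurable fun s => eI (-⟪x + (0:ℝ) • e, s⟫) * w s := by fun_prop
        exact this.aestronglyMeasurable
      · filter_upwards with s
        simp [norm_eI])
    (by
      have h1 := hN.1
      have : Measurable fun s => eI (-⟪x + (0:ℝ) • e, s⟫) * ((-Complex.I * (s j : ℂ)) * w s) := by
        fun_prop
      exact this.aestronglyMeasurable)
    (by
      filter_upwards with s t _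
      rw [norm_mul, norm_eI, one_mul])
    hN.integrable.norm
    (by
      filter_upwards with s t _
      have h0 : HasDerivAt (fun t : ℝ => -⟪x + t • e, s⟫) (-(s j)) t := by
        have e1 : (fun t : ℝ => -⟪x + t • e, s⟫) = fun t => -⟪x, s⟫ + t * (-(s j)) := by
          funext t
          rw [inner_add_left, real_inner_smul_left, hin]; ring
        rw [e1]
        simpa using ((hasDerivAt_id t).mul_const (-(s j))).const_add (-⟪x, s⟫)
      have h1 : HasDerivAt (fun t : ℝ => eI (-⟪x + t • e, s⟫))
          (eI (-⟪x + t • e, s⟫) * (Complex.I * ((-(s j) : ℝ) : ℂ))) t :=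
        (h0.ofReal_comp.const_mul Complex.I).cexp
      refine (h1.mul_const (w s)).congr_deriv ?_
      push_cast; ring)
  have h2 : HasDerivAt (fun t : ℝ => osc w (x + t • e)) _ 0 := key.2
  have h3 : dLine e (osc w) x = deriv (fun t : ℝ => osc w (x + t • e)) 0 := by
    have := deriv_line e x (osc w) 0 ((osc_smooth w hw).differentiable (by simp) _)
    rw [this.deriv]; simp
  rw [h3, h2.deriv]
  simp [osc]

lemma osc_deriv_iter {n : ℕ} (w : EE n → ℂ) (hw : Nice w) (j : Fin n) (k : ℕ) :
    Nice (fun s => (-Complex.I * (s j : ℂ)) ^ k * w s) ∧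
    (dLine (EuclideanSpace.single j 1))^[k] (osc w) =
      osc (fun s => (-Complex.I * (s j : ℂ)) ^ k * w s) := by
  have hN : ∀ k : ℕ, Nice (fun s => (-Complex.I * (s j : ℂ)) ^ k * w s) := fun k =>
    hw.mul_cont (fun s => (-Complex.I * (s j : ℂ)) ^ k) (by fun_prop)
  refine ⟨hN k, ?_⟩
  induction k with
  | zero => simp
  | succ k ih =>
    rw [Function.iterate_succ_apply', ih, osc_deriv _ (hN k)]
    congr 1; funext s; ring

lemma osc_n2 (n : ℕ) : ∃ C : ℝ≥0∞, C ≠ ⊤ ∧ ∀ w : EE n → ℂ, Nice w → ∀ j k,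
    n2 ((dLine (EuclideanSpace.single j 1))^[k] (osc w)) ≤
      C * ∫⁻ s, ‖(s j : ℂ) ^ k * w s‖ₑ ^ 2 := by
  obtain ⟨C, hC, h⟩ := planch n (-1) (by norm_num)
  refine ⟨C, hC, fun w hw j k => ?_⟩
  obtain ⟨hN, he⟩ := osc_deriv_iter w hw j k
  rw [he]
  have := h _ hN.1 hN.integrable
  refine le_trans (le_of_eq ?_) (this.trans (le_of_eq ?_))
  · unfold osc
    congr 1; funext x
    congr 1; funext s
    rw [real_inner_comm]
    congr 2
    ring
  · unfold n2
    congr 2; funext s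
    rw [enorm_mul, enorm_mul]
    congr 2
    rw [← ofReal_norm, ← ofReal_norm]
    simp

lemma osc_n2' (n : ℕ) : ∃ C : ℝ≥0∞, C ≠ ⊤ ∧ ∀ w : EE n → ℂ, Nice w →
    n2 (osc w) ≤ C * ∫⁻ s, ‖w s‖ₑ ^ 2 := by
  obtain ⟨C, hC, h⟩ := planch n (-1) (by norm_num)
  refine ⟨C, hC, fun w hw => ?_⟩
  refine le_trans (le_of_eq ?_) (h _ hw.1 hw.integrable)
  unfold osc
  congr 1; funext x
  congr 1; funext s
  rw [real_inner_comm]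
  congr 2
  ring

/-! ### Step 2c: weighted Fourier estimate -/

lemma dLine_cs {n : ℕ} (v : EE n) (b : EE n → ℂ) (hc : HasCompactSupport b) :
    HasCompactSupport (dLine v b) := hc.fderiv_apply ℝ v

lemma dLine_iter_cs {n : ℕ} (v : EE n) (b : EE n → ℂ) (hc : HasCompactSupport b) (k : ℕ) :
    HasCompactSupport ((dLine v)^[k] b) := by
  induction k with
  | zero => exact hc
  | succ k ih => rw [Function.iterate_succ_apply']; exact dLine_cs v _ ih

lemma ft_deriv {n : ℕ} (b : EE n → ℂ) (hb : ContDiff ℝ (⊤ : ℕ∞) b) (hc : HasCompactSupport b)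
    (j : Fin n) (κ : EE n) :
    ft (dLine (EuclideanSpace.single j 1) b) κ = (2 * π * Complex.I * (κ j : ℂ)) * ft b κ := by
  set e : EE n := EuclideanSpace.single j 1 with he
  set f : EE n → ℂ := fun y => eI (-(2 * π * ⟪κ, y⟫)) with hf
  have hfs : ContDiff ℝ (⊤ : ℕ∞) f := eI_contDiff.comp (lin_smooth κ)
  have hfd : ∀ y, fderiv ℝ f y e = -(2 * π * Complex.I * (κ j : ℂ)) * f y := by
    intro y
    have h0 : HasFDerivAt (fun y : EE n => -(2 * π * ⟪κ, y⟫)) (-((2 * π) • innerSL ℝ κ)) y := by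
      have := ((innerSL ℝ κ).hasFDerivAt (x := y)).const_mul (2 * π)
      exact this.neg
    have h1 : HasDerivAt eI (eI (-(2 * π * ⟪κ, y⟫)) * (Complex.I * 1)) (-(2 * π * ⟪κ, y⟫)) :=
      ((Complex.ofRealCLM.hasDerivAt (x := -(2 * π * ⟪κ, y⟫))).const_mul Complex.I).cexp
    have h2 := h1.hasFDerivAt.comp y h0
    have h3 : HasFDerivAt f _ y := h2
    rw [h3.fderiv]
    simp [he, hf, EuclideanSpace.inner_single_right]
    ring
  have h := integral_mul_fderiv_eq_neg_fderiv_mul_of_integrable (μ := (volume : Measure (EE n)))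
    (f := f) (g := b) (v := e) ?_ ?_ ?_ (fun x _ => (hfs.differentiable (by simp)) x)
    (fun x _ => (hb.differentiable (by simp)) x)
  · change ∫ y, f y * dLine e b y = _
    have h' : ∫ y, f y * dLine e b y = _ := h
    rw [h']
    simp_rw [hfd, mul_assoc]
    rw [integral_const_mul]
    simp only [ft, hf]
    ring
  · have hcs : HasCompactSupport (fun x => fderiv ℝ f x e * b x) := hc.mul_left
    exact ((dLine_smooth e f hfs).continuous.mul hb.continuous).integrable_of_hasCompactSupport hcs
  · have hcs : HasCompactSupport (fun x => f x * fderiv ℝ b x e) := (dLine_cs e b hc).mul_left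
    exact (hfs.continuous.mul (dLine_smooth e b hb).continuous).integrable_of_hasCompactSupport hcs
  · have hcs : HasCompactSupport (fun x => f x * b x) := hc.mul_left
    exact (hfs.continuous.mul hb.continuous).integrable_of_hasCompactSupport hcs

lemma ft_deriv_iter {n : ℕ} (b : EE n → ℂ) (hb : ContDiff ℝ (⊤ : ℕ∞) b) (hc : HasCompactSupport b)
    (j : Fin n) (κ : EE n) (k : ℕ) :
    ft ((dLine (EuclideanSpace.single j 1))^[k] b) κ = (2 * π * Complex.I * (κ j : ℂ)) ^ k * ft b κ := by
  induction k with
  | zero => simp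
  | succ k ih =>
    rw [Function.iterate_succ_apply', ft_deriv _ (dLine_iter_smooth _ b hb k) (dLine_iter_cs _ b hc k),
      ih]
    ring

/-- the weight -/
def Qw {n : ℕ} (m : ℕ) (κ : EE n) : ℝ := 1 + ∑ j, |κ j| ^ (2 * m)

lemma Qw_pos {n : ℕ} (m : ℕ) (κ : EE n) : 0 < Qw m κ := by
  unfold Qw; positivity

lemma Qw_cont {n : ℕ} (m : ℕ) : Continuous (Qw (n := n) m) := by
  unfold Qw; fun_prop

lemma Qw_int (n m : ℕ) (hm : n < 2 * m) :
    ∫⁻ κ : EE n, ENNReal.ofReal ((Qw m κ)⁻¹) ≠ ⊤ := by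
  have hIntg := integrable_one_add_norm (μ := (volume : Measure (EE n))) (r := ((2 * m : ℕ) : ℝ))
    (by simpa using mod_cast hm)
  have hIntg2 := hIntg.const_mul ((4 : ℝ) ^ m * ((n : ℝ) + 1) ^ (2 * m))
  refine ne_of_lt (lt_of_le_of_lt (lintegral_mono fun κ => ?_) hIntg2.lintegral_lt_top)
  apply ENNReal.ofReal_le_ofReal
  have ht : (0 : ℝ) ≤ ‖κ‖ := norm_nonneg κ
  rw [Real.rpow_neg (by positivity), Real.rpow_natCast, ← div_eq_mul_inv, inv_eq_one_div,
    div_le_div_iff₀ (Qw_pos m κ) (by positivity), one_mul]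
  have h4 : (4 : ℝ) ^ m = 2 ^ (2 * m) := by rw [pow_mul]; norm_num
  have hn1 : (1 : ℝ) ≤ ((n : ℝ) + 1) ^ (2 * m) := one_le_pow₀ (by linarith [n.cast_nonneg (α := ℝ)])
  have hQ1 : 1 ≤ Qw m κ := by
    unfold Qw
    have : 0 ≤ ∑ j, |κ j| ^ (2 * m) := by positivity
    linarith
  by_cases h1 : ‖κ‖ ≤ 1
  · calc (1 + ‖κ‖) ^ (2 * m) ≤ 2 ^ (2 * m) := pow_le_pow_left₀ (by positivity) (by linarith) _
      _ = 4 ^ m * 1 * 1 := by rw [h4]; ring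
      _ ≤ _ := by gcongr
  · push Not at h1
    obtain ⟨j, hj⟩ := exists_big_coord κ (by rintro rfl; norm_num at h1)
    have hj' : ‖κ‖ ≤ (n + 1) * |κ j| := by
      rw [div_le_iff₀ (by positivity)] at hj; linarith
    have hQj : |κ j| ^ (2 * m) ≤ Qw m κ := by
      unfold Qw
      have := Finset.single_le_sum (f := fun j => |κ j| ^ (2 * m)) (fun i _ => by positivity)
        (Finset.mem_univ j)
      simp only at this
      linarith
    calc (1 + ‖κ‖) ^ (2 * m) ≤ (2 * ((n + 1) * |κ j|)) ^ (2 * m) :=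
          pow_le_pow_left₀ (by positivity) (by linarith) _
      _ = 4 ^ m * (n + 1) ^ (2 * m) * |κ j| ^ (2 * m) := by rw [h4, mul_pow, mul_pow]; ring
      _ ≤ _ := by gcongr

lemma ft_weight (n m : ℕ) : ∃ C : ℝ≥0∞, C ≠ ⊤ ∧ ∀ b : EE n → ℂ, ContDiff ℝ (⊤ : ℕ∞) b →
    HasCompactSupport b → ∫⁻ κ, ‖ft b κ‖ₑ ^ 2 * ENNReal.ofReal (Qw m κ) ≤
      C * (n2 b + ∑ j, n2 ((dLine (EuclideanSpace.single j 1))^[m] b)) := by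
  obtain ⟨C, hC, h⟩ := planch n (-(2 * π)) (by simp [Real.pi_ne_zero])
  have h' : ∀ b : EE n → ℂ, ContDiff ℝ (⊤ : ℕ∞) b → HasCompactSupport b →
      ∫⁻ κ, ‖ft b κ‖ₑ ^ 2 ≤ C * n2 b := by
    intro b hb hc
    refine le_trans (le_of_eq ?_)
      (h b hb.continuous.measurable (hb.continuous.integrable_of_hasCompactSupport hc))
    unfold n2 ft
    congr 1; funext κ
    congr 3; funext y
    congr 2
    rw [real_inner_comm]; ring
  refine ⟨C, hC, fun b hb hc => ?_⟩
  have hpt : ∀ κ, ‖ft b κ‖ₑ ^ 2 * ENNReal.ofReal (Qw m κ) ≤ ‖ft b κ‖ₑ ^ 2 +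
      ∑ j, ‖ft ((dLine (EuclideanSpace.single j 1))^[m] b) κ‖ₑ ^ 2 := by
    intro κ
    unfold Qw
    rw [ENNReal.ofReal_add (by norm_num) (by positivity),
      ENNReal.ofReal_sum_of_nonneg (fun i _ => by positivity), mul_add, Finset.mul_sum]
    simp only [ENNReal.ofReal_one, mul_one]
    gcongr with j _
    rw [ft_deriv_iter b hb hc, enorm_mul, mul_pow, mul_comm]
    gcongr
    rw [← ofReal_norm, ← ENNReal.ofReal_pow (norm_nonneg _)]
    apply ENNReal.ofReal_le_ofReal
    rw [norm_pow, ← pow_mul, mul_comm m 2]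
    apply pow_le_pow_left₀ (abs_nonneg _)
    simp only [norm_mul, Complex.norm_I, Complex.norm_real, Complex.norm_ofNat, Real.norm_eq_abs,
      abs_of_pos Real.pi_pos, mul_one]
    nlinarith [abs_nonneg (κ j), Real.pi_gt_three]
  refine (lintegral_mono hpt).trans ?_
  have hm : ∀ j : Fin n, Measurable fun κ =>
      ‖ft ((dLine (EuclideanSpace.single j 1))^[m] b) κ‖ₑ ^ 2 := fun j =>
    ((ft_meas _ (dLine_iter_smooth _ b hb m).continuous.measurable).enorm).pow_const 2
  rw [lintegral_add_right _ (Finset.measurable_fun_sum _ fun j _ => hm j), lintegral_finset_sum _ (fun j _ => hm j),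
    mul_add, Finset.mul_sum]
  gcongr with j _
  · exact h' b hb hc
  · exact h' _ (dLine_iter_smooth _ b hb m) (dLine_iter_cs _ b hc m)

lemma ft_integrable {n : ℕ} (b : EE n → ℂ) (hb : ContDiff ℝ (⊤ : ℕ∞) b) (hc : HasCompactSupport b) :
    Integrable (ft b) := by
  rw [← ft_eq]
  exact (FourierTransform.fourier (hc.toSchwartzMap hb)).integrable

/-- weighted duality estimate for a single compactly supported function -/
lemma weight_pair (n m : ℕ) : ∃ C : ℝ≥0∞, C ≠ ⊤ ∧ ∀ b W : EE n → ℂ, ContDiff ℝ (⊤ : ℕ∞) b →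
    HasCompactSupport b → Measurable W → Integrable W →
    ‖∫ y, b y * W y‖ₑ ^ 2 ≤ (C * (n2 b + ∑ j, n2 ((dLine (EuclideanSpace.single j 1))^[m] b))) *
      ∫⁻ κ, ENNReal.ofReal ((Qw m κ)⁻¹) * ‖fti W κ‖ₑ ^ 2 := by
  obtain ⟨C, hC, h⟩ := ft_weight n m
  refine ⟨C, hC, fun b W hb hc hWm hW => ?_⟩
  rw [fourier_pair b W hb.continuous (hb.continuous.integrable_of_hasCompactSupport hc)
    (ft_integrable b hb hc) hW hWm]
  have hq : Measurable fun κ : EE n => ENNReal.ofReal (Real.sqrt (Qw m κ)) :=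
    (Real.continuous_sqrt.comp (Qw_cont m)).measurable.ennreal_ofReal
  have hqi : Measurable fun κ : EE n => ENNReal.ofReal (Real.sqrt (Qw m κ)⁻¹) :=
    (Real.continuous_sqrt.measurable.comp (Qw_cont m).measurable.inv).ennreal_ofReal
  have hfm := ft_meas b hb.continuous.measurable
  have hgm := fti_meas W hWm
  have cs := cs_lint volume (fun κ => ‖ft b κ‖ₑ * ENNReal.ofReal (Real.sqrt (Qw m κ)))
    (fun κ => ENNReal.ofReal (Real.sqrt (Qw m κ)⁻¹) * ‖fti W κ‖ₑ)
    (hfm.enorm.mul hq).aemeasurable (hqi.mul hgm.enorm).aemeasurable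
  have e1 : ∀ κ : EE n, ENNReal.ofReal (Real.sqrt (Qw m κ)) ^ 2 = ENNReal.ofReal (Qw m κ) := fun κ => by
    rw [← ENNReal.ofReal_pow (Real.sqrt_nonneg _), Real.sq_sqrt (Qw_pos m κ).le]
  have e2 : ∀ κ : EE n, ENNReal.ofReal (Real.sqrt (Qw m κ)⁻¹) ^ 2 = ENNReal.ofReal (Qw m κ)⁻¹ := fun κ => by
    rw [← ENNReal.ofReal_pow (Real.sqrt_nonneg _), Real.sq_sqrt (inv_pos.2 (Qw_pos m κ)).le]
  have e3 : ∀ κ : EE n, ENNReal.ofReal (Real.sqrt (Qw m κ)) * ENNReal.ofReal (Real.sqrt (Qw m κ)⁻¹) = 1 := by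
    intro κ
    rw [← ENNReal.ofReal_mul (Real.sqrt_nonneg _), ← Real.sqrt_mul (Qw_pos m κ).le,
      mul_inv_cancel₀ (Qw_pos m κ).ne']
    simp
  simp_rw [mul_pow, e1, e2] at cs
  refine le_trans (pow_le_pow_left₀ (by simp) ?_ 2) (cs.trans (mul_le_mul_left (h b hb hc) _))
  refine (enorm_integral_le_lintegral_enorm _).trans (lintegral_mono fun κ => ?_)
  rw [enorm_mul]
  calc ‖ft b κ‖ₑ * ‖fti W κ‖ₑ = ‖ft b κ‖ₑ * 1 * ‖fti W κ‖ₑ := by rw [mul_one]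
    _ ≤ _ := by rw [← e3 κ]; apply le_of_eq; ring

/-! ### Step 2d: the core bilinear estimate -/

lemma sum_sq_enorm {N : ℕ} (f : ℕ → ℂ) (y : ℂ) (M : ℝ) (hM : 0 ≤ M)
    (h : ‖y‖ ≤ M * ∑ k ∈ Finset.range N, ‖f k‖) :
    ‖y‖ₑ ^ 2 ≤ ENNReal.ofReal (M ^ 2 * N) * ∑ k ∈ Finset.range N, ‖f k‖ₑ ^ 2 := by
  have h1 : ‖y‖ ^ 2 ≤ M ^ 2 * N * ∑ k ∈ Finset.range N, ‖f k‖ ^ 2 := by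
    have := sq_sum_le_card_mul_sum_sq (s := Finset.range N) (f := fun k => ‖f k‖)
    rw [Finset.card_range] at this
    calc ‖y‖ ^ 2 ≤ (M * ∑ k ∈ Finset.range N, ‖f k‖) ^ 2 := pow_le_pow_left₀ (norm_nonneg _) h 2
      _ = M ^ 2 * (∑ k ∈ Finset.range N, ‖f k‖) ^ 2 := by ring
      _ ≤ M ^ 2 * (N * ∑ k ∈ Finset.range N, ‖f k‖ ^ 2) := by gcongr
      _ = _ := by ring
  have e : ∀ z : ℂ, ‖z‖ₑ ^ 2 = ENNReal.ofReal (‖z‖ ^ 2) := fun z => by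
    rw [← ofReal_norm, ENNReal.ofReal_pow (norm_nonneg _)]
  simp_rw [e]
  rw [← ENNReal.ofReal_sum_of_nonneg (fun i _ => by positivity), ← ENNReal.ofReal_mul (by positivity)]
  exact ENNReal.ofReal_le_ofReal h1

/-- the quantity controlling the weighted norm -/
def Pw {n : ℕ} (m : ℕ) (w : EE n → ℂ) : ℝ≥0∞ :=
  (∫⁻ s, ‖w s‖ₑ ^ 2) + ∑ j : Fin n, ∑ k ∈ Finset.range (m + 1), ∫⁻ s, ‖(s j : ℂ) ^ k * w s‖ₑ ^ 2

lemma prod_n2 (n m : ℕ) (A : ℝ) (hA : 0 ≤ A) : ∃ C : ℝ≥0∞, C ≠ ⊤ ∧ ∀ h w : EE n → ℂ,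
    ContDiff ℝ (⊤ : ℕ∞) h → (∀ z, ‖h z‖ ≤ A) →
    (∀ j, ∀ k ≤ m, ∀ z, ‖ld (EuclideanSpace.single j (1 : ℝ)) k h z‖ ≤ A) → Nice w →
    n2 (fun x => h x * osc w x) +
      ∑ j, n2 ((dLine (EuclideanSpace.single j 1))^[m] (fun x => h x * osc w x)) ≤ C * Pw m w := by
  obtain ⟨C1, hC1, h1⟩ := osc_n2 n
  obtain ⟨C2, hC2, h2⟩ := osc_n2' n
  set L := ENNReal.ofReal ((2 ^ m * A) ^ 2 * ((m + 1 : ℕ) : ℝ)) with hL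
  set L0 := ENNReal.ofReal (A ^ 2) with hL0
  refine ⟨L0 * C2 + L * C1, by finiteness, fun h w hh hb hd hw => ?_⟩
  have hos := osc_smooth w hw
  have b1 : n2 (fun x => h x * osc w x) ≤ L0 * C2 * ∫⁻ s, ‖w s‖ₑ ^ 2 := by
    rw [mul_assoc]
    refine le_trans ?_ (mul_le_mul_right (h2 w hw) L0)
    unfold n2
    rw [← lintegral_const_mul' _ _ (by finiteness)]
    refine lintegral_mono fun x => ?_
    rw [enorm_mul, mul_pow]
    gcongr
    rw [← ofReal_norm, ← ENNReal.ofReal_pow (norm_nonneg _)]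
    exact ENNReal.ofReal_le_ofReal (pow_le_pow_left₀ (norm_nonneg _) (hb x) 2)
  have b2 : ∀ j, n2 ((dLine (EuclideanSpace.single j 1))^[m] (fun x => h x * osc w x)) ≤
      L * C1 * ∑ k ∈ Finset.range (m + 1), ∫⁻ s, ‖(s j : ℂ) ^ k * w s‖ₑ ^ 2 := by
    intro j
    set e : EE n := EuclideanSpace.single j 1 with he
    have pt : ∀ x, ‖(dLine e)^[m] (fun x => h x * osc w x) x‖ₑ ^ 2 ≤
        L * ∑ k ∈ Finset.range (m + 1), ‖(dLine e)^[k] (osc w) x‖ₑ ^ 2 := by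
      intro x
      apply sum_sq_enorm (fun k => (dLine e)^[k] (osc w) x) _ (2 ^ m * A) (by positivity)
      rw [← ld_eq_dLine_iter e m _ x (hh.mul hos), mul_assoc]
      refine ld_mul_bound e m h (osc w) x ((contDiff_infty.1 hh m).contDiffAt)
        ((contDiff_infty.1 hos m).contDiffAt) A _ (fun i hi => hd j i hi x) (fun i hi => ?_) m le_rfl
      rw [ld_eq_dLine_iter e i _ x hos]
      exact Finset.single_le_sum (f := fun k => ‖(dLine e)^[k] (osc w) x‖)
        (fun _ _ => norm_nonneg _) (Finset.mem_range.2 (by omega))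
    refine (lintegral_mono pt).trans ?_
    rw [lintegral_const_mul' _ _ (by finiteness), lintegral_finset_sum]
    · rw [mul_assoc, Finset.mul_sum _ _ C1]
      refine mul_le_mul_right (Finset.sum_le_sum fun k _ => h1 w hw j k) L
    · intro k _
      exact ((dLine_iter_smooth e _ hos k).continuous.measurable.enorm).pow_const 2
  unfold Pw
  rw [mul_add]
  apply add_le_add
  · exact b1.trans (by gcongr; exact le_self_add)
  · rw [Finset.mul_sum]
    gcongr with j _
    exact (b2 j).trans (by gcongr; exact le_add_self)

/-- the localized density -/
def wz {n : ℕ} (v : EE n → ℂ) (ζ s : EE n) : ℂ := (Ee s : ℂ) * v (ζ - s)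

lemma wz_nice {n : ℕ} (v : EE n → ℂ) (hv : Nice v) (ζ : EE n) : Nice (wz v ζ) := by
  obtain ⟨hm, ⟨M, hM⟩, R, hR⟩ := hv
  refine ⟨?_, ⟨M, fun s => ?_⟩, R + ‖ζ‖, fun s hs => ?_⟩
  · unfold wz; fun_prop
  · unfold wz
    rw [norm_mul, Complex.norm_real, Real.norm_of_nonneg (Ee_nonneg s)]
    have := hM (ζ - s)
    nlinarith [Ee_le_one s, Ee_nonneg s, norm_nonneg (v (ζ - s))]
  · unfold wz
    rw [hR _ _, mul_zero]
    have := norm_sub_norm_le s ζ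
    rw [norm_sub_rev] at this
    linarith

lemma conv_sq {n : ℕ} (E v : EE n → ℂ) (hE : Measurable E) (hv : Measurable v) :
    Measurable (fun ζ => ∫⁻ s, ‖E s * v (ζ - s)‖ₑ ^ 2) ∧
    ∫⁻ ζ, ∫⁻ s, ‖E s * v (ζ - s)‖ₑ ^ 2 = (∫⁻ s, ‖E s‖ₑ ^ 2) * n2 v := by
  have hm : Measurable fun p : EE n × EE n => ‖E p.2 * v (p.1 - p.2)‖ₑ ^ 2 := by fun_prop
  refine ⟨hm.lintegral_prod_right', ?_⟩
  rw [lintegral_lintegral_swap hm.aemeasurable]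
  have : ∀ s, ∫⁻ ζ, ‖E s * v (ζ - s)‖ₑ ^ 2 = ‖E s‖ₑ ^ 2 * n2 v := by
    intro s
    simp_rw [enorm_mul, mul_pow]
    rw [lintegral_const_mul _ (by fun_prop)]
    congr 1
    exact lintegral_sub_right_eq_self (fun ζ => ‖v ζ‖ₑ ^ 2) s
  simp_rw [this]
  rw [lintegral_mul_const _ (by fun_prop)]

lemma Pw_int (n m : ℕ) : ∃ C : ℝ≥0∞, C ≠ ⊤ ∧ ∀ v : EE n → ℂ, Measurable v →
    Measurable (fun ζ => Pw m (wz v ζ)) ∧ ∫⁻ ζ, Pw m (wz v ζ) = C * n2 v := by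
  refine ⟨(∫⁻ s : EE n, ‖(Ee s : ℂ)‖ₑ ^ 2) + ∑ j : Fin n, ∑ k ∈ Finset.range (m + 1),
    ∫⁻ s : EE n, ‖(s j : ℂ) ^ k * (Ee s : ℂ)‖ₑ ^ 2, ?_, fun v hv => ?_⟩
  · refine ENNReal.add_ne_top.2 ⟨Ee_sq, ENNReal.sum_ne_top.2 fun j _ => ENNReal.sum_ne_top.2 fun k _ => ?_⟩
    exact Ee_moment k j
  · have h0 := conv_sq (fun s : EE n => (Ee s : ℂ)) v (by fun_prop) hv
    have h1 := fun (j : Fin n) (k : ℕ) =>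
      conv_sq (fun s : EE n => (s j : ℂ) ^ k * (Ee s : ℂ)) v (by fun_prop) hv
    unfold Pw wz
    simp_rw [← mul_assoc]
    have hs : Measurable fun ζ => ∑ j : Fin n, ∑ k ∈ Finset.range (m + 1),
        ∫⁻ s : EE n, ‖(s j : ℂ) ^ k * (Ee s : ℂ) * v (ζ - s)‖ₑ ^ 2 :=
      Finset.measurable_fun_sum _ fun j _ => Finset.measurable_fun_sum _ fun k _ => (h1 j k).1
    refine ⟨h0.1.add hs, ?_⟩
    rw [lintegral_add_left h0.1, h0.2, add_mul, lintegral_finset_sum _ (fun j _ =>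
      Finset.measurable_fun_sum _ fun k _ => (h1 j k).1), Finset.sum_mul]
    congr 1
    refine Finset.sum_congr rfl fun j _ => ?_
    rw [lintegral_finset_sum _ (fun k _ => (h1 j k).1), Finset.sum_mul]
    exact Finset.sum_congr rfl fun k _ => (h1 j k).2

lemma gamma_int (n m : ℕ) (hm : n < 2 * m) : ∃ C : ℝ≥0∞, C ≠ ⊤ ∧ ∀ g : EE n → ℂ, Measurable g →
    Integrable g →
    Measurable (fun ζ => ∫⁻ κ, ENNReal.ofReal ((Qw m κ)⁻¹) * ‖fti (fun x => eI ⟪x, ζ⟫ * g x) κ‖ₑ ^ 2) ∧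
    ∫⁻ ζ, ∫⁻ κ, ENNReal.ofReal ((Qw m κ)⁻¹) * ‖fti (fun x => eI ⟪x, ζ⟫ * g x) κ‖ₑ ^ 2 ≤ C * n2 g := by
  obtain ⟨C1, hC1, h1⟩ := planch n 1 (by norm_num)
  refine ⟨(∫⁻ κ : EE n, ENNReal.ofReal ((Qw m κ)⁻¹)) * C1, ENNReal.mul_ne_top (Qw_int n m hm) hC1,
    fun g hgm hg => ?_⟩
  set γ : EE n → ℂ := fun z => ∫ x, eI (1 * ⟪x, z⟫) * g x with hγ
  have hγm : Measurable γ := meas_int (fun p : EE n × EE n => eI (1 * ⟪p.2, p.1⟫) * g p.2) (by fun_prop)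
  have e : ∀ ζ κ, fti (fun x => eI ⟪x, ζ⟫ * g x) κ = γ (ζ + (2 * π) • κ) := by
    intro ζ κ
    simp only [fti, hγ]
    congr 1; funext x
    rw [← mul_assoc, ← eI_add]
    congr 2
    rw [inner_add_right, real_inner_smul_right, real_inner_comm]
    ring
  simp_rw [e]
  have hQm : Measurable fun κ : EE n => ENNReal.ofReal ((Qw m κ)⁻¹) :=
    (Qw_cont m).measurable.inv.ennreal_ofReal
  have hjm : Measurable fun p : EE n × EE n =>
      ENNReal.ofReal ((Qw m p.2)⁻¹) * ‖γ (p.1 + (2 * π) • p.2)‖ₑ ^ 2 := by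
    have h1 : Measurable fun p : EE n × EE n => ENNReal.ofReal ((Qw m p.2)⁻¹) := hQm.comp measurable_snd
    have h2 : Measurable fun p : EE n × EE n => γ (p.1 + (2 * π) • p.2) := hγm.comp (by fun_prop)
    exact h1.mul (h2.enorm.pow_const 2)
  refine ⟨hjm.lintegral_prod_right', ?_⟩
  rw [lintegral_lintegral_swap hjm.aemeasurable]
  have : ∀ κ, ∫⁻ ζ, ENNReal.ofReal ((Qw m κ)⁻¹) * ‖γ (ζ + (2 * π) • κ)‖ₑ ^ 2 =
      ENNReal.ofReal ((Qw m κ)⁻¹) * n2 γ := by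
    intro κ
    rw [lintegral_const_mul' _ _ (by finiteness)]
    congr 1
    exact lintegral_add_right_eq_self (fun ζ => ‖γ ζ‖ₑ ^ 2) _
  simp_rw [this]
  rw [lintegral_mul_const _ hQm, mul_assoc]
  gcongr
  exact h1 g hgm hg

lemma core (n m : ℕ) (hm : n < 2 * m) (A : ℝ) (hA : 0 ≤ A) : ∃ C : ℝ≥0∞, C ≠ ⊤ ∧
    ∀ t : EE n × EE n → ℂ, (∀ ζ, ContDiff ℝ (⊤ : ℕ∞) fun x => t (x, ζ)) →
    (∀ ζ, HasCompactSupport fun x => t (x, ζ)) → (∀ z, ‖t z‖ ≤ A) →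
    (∀ j, ∀ k ≤ m, ∀ ζ z, ‖ld (EuclideanSpace.single j (1 : ℝ)) k (fun x => t (x, ζ)) z‖ ≤ A) →
    ∀ v g : EE n → ℂ, Nice v → Measurable g → Integrable g →
    ‖∫ ζ, ∫ x, (t (x, ζ) * osc (wz v ζ) x) * (eI ⟪x, ζ⟫ * g x)‖ₑ ^ 2 ≤ C * n2 v * n2 g := by
  obtain ⟨C1, hC1, h1⟩ := weight_pair n m
  obtain ⟨C2, hC2, h2⟩ := prod_n2 n m A hA
  obtain ⟨C3, hC3, h3⟩ := Pw_int n m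
  obtain ⟨C4, hC4, h4⟩ := gamma_int n m hm
  refine ⟨C1 * C2 * C3 * C4, by finiteness, fun t ht htc htb htd v g hv hgm hg => ?_⟩
  obtain ⟨hPm, hP⟩ := h3 v hv.1
  obtain ⟨hHm, hH⟩ := h4 g hgm hg
  set P : EE n → ℝ≥0∞ := fun ζ => Pw m (wz v ζ) with hPdef
  set H : EE n → ℝ≥0∞ := fun ζ =>
    ∫⁻ κ, ENNReal.ofReal ((Qw m κ)⁻¹) * ‖fti (fun x => eI ⟪x, ζ⟫ * g x) κ‖ₑ ^ 2 with hHdef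
  have pt : ∀ ζ, ‖∫ x, (t (x, ζ) * osc (wz v ζ) x) * (eI ⟪x, ζ⟫ * g x)‖ₑ ^ 2 ≤
      C1 * C2 * (P ζ * H ζ) := by
    intro ζ
    have hw := wz_nice v hv ζ
    have hWi : Integrable (fun x => eI ⟪x, ζ⟫ * g x) :=
      int_bdd_mul _ _ (by fun_prop) 1 (fun x => (norm_eI _).le) hgm hg
    refine (h1 (fun x => t (x, ζ) * osc (wz v ζ) x) (fun x => eI ⟪x, ζ⟫ * g x)
      ((ht ζ).mul (osc_smooth _ hw)) ((htc ζ).mul_right) (by fun_prop) hWi).trans ?_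
    have e : C1 * C2 * (P ζ * H ζ) = C1 * (C2 * P ζ) * H ζ := by ring
    rw [e]
    refine mul_le_mul_left (mul_le_mul_right ?_ C1) _
    exact h2 (fun x => t (x, ζ)) (wz v ζ) (ht ζ) (fun z => htb _) (fun j k hk z => htd j k hk ζ z) hw
  have hsq : ∀ x : ℝ≥0∞, (x ^ (1 / (2:ℝ))) ^ 2 = x := by
    intro x
    rw [← ENNReal.rpow_natCast, ← ENNReal.rpow_mul]; norm_num
  have cs := cs_lint volume (fun ζ => (P ζ) ^ (1 / (2:ℝ))) (fun ζ => (H ζ) ^ (1 / (2:ℝ)))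
    (hPm.pow_const _).aemeasurable (hHm.pow_const _).aemeasurable
  simp_rw [hsq] at cs
  set r := (C1 * C2) ^ (1 / (2:ℝ)) with hr
  have hrt : r ≠ ⊤ := by rw [hr]; exact ENNReal.rpow_ne_top_of_nonneg (by norm_num) (by finiteness)
  have pt2 : ∀ ζ, ‖∫ x, (t (x, ζ) * osc (wz v ζ) x) * (eI ⟪x, ζ⟫ * g x)‖ₑ ≤
      r * ((P ζ) ^ (1 / (2:ℝ)) * (H ζ) ^ (1 / (2:ℝ))) := by
    intro ζ
    rw [← ENNReal.pow_le_pow_left_iff (n := 2) (by norm_num), mul_pow, mul_pow, hr, hsq, hsq, hsq]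
    exact pt ζ
  calc _ ≤ (∫⁻ ζ, r * ((P ζ) ^ (1 / (2:ℝ)) * (H ζ) ^ (1 / (2:ℝ)))) ^ 2 := by
        refine pow_le_pow_left₀ (by simp) ?_ 2
        exact (enorm_integral_le_lintegral_enorm _).trans (lintegral_mono pt2)
    _ = C1 * C2 * (∫⁻ ζ, ((P ζ) ^ (1 / (2:ℝ)) * (H ζ) ^ (1 / (2:ℝ)))) ^ 2 := by
        rw [lintegral_const_mul' _ _ hrt, mul_pow, hr, hsq]
    _ ≤ C1 * C2 * ((∫⁻ ζ, P ζ) * ∫⁻ ζ, H ζ) := by gcongr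
    _ ≤ C1 * C2 * ((C3 * n2 v) * (C4 * n2 g)) := by
        gcongr
        exact hP.le
    _ = _ := by ring

/-! ### Step 2e: boundedness of the pseudodifferential part -/

lemma ld_smul_arg {n : ℕ} (v : EE n) (k : ℕ) (χ : EE n → ℂ) (hχ : ContDiff ℝ (⊤ : ℕ∞) χ) (r : ℝ) (z : EE n) :
    ld v k (fun x => χ (r • x)) z = (r : ℂ) ^ k * ld v k χ (r • z) := by
  have hs : ContDiff ℝ (⊤ : ℕ∞) fun x : EE n => χ (r • x) := hχ.comp (contDiff_const_smul r)
  have : ∀ (k : ℕ), (dLine v)^[k] (fun x => χ (r • x)) = fun x => (r : ℂ) ^ k * (dLine v)^[k] χ (r • x) := by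
    intro k
    induction k with
    | zero => simp
    | succ k ih =>
      rw [Function.iterate_succ_apply', ih]
      funext x
      have hd := (dLine_iter_smooth v χ hχ k).differentiable (by simp) (r • x)
      have h1 := (hd.hasFDerivAt.comp x ((hasFDerivAt_id x).const_smul r)).const_mul ((r : ℂ) ^ k)
      have h2 : HasFDerivAt (fun x => (r : ℂ) ^ k * (dLine v)^[k] χ (r • x)) _ x := h1
      conv_lhs => unfold dLine
      change fderiv ℝ (fun x => (r : ℂ) ^ k * (dLine v)^[k] χ (r • x)) x v = _
      rw [h2.fderiv, Function.iterate_succ_apply']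
      simp [dLine, pow_succ, mul_assoc]
  rw [ld_eq_dLine_iter v k _ z hs, this k, ld_eq_dLine_iter v k _ _ hχ]

lemma ld_slice {n : ℕ} (j : Fin n) (k : ℕ) (f : EE n × EE n → ℂ) (y q : EE n) :
    ld (EuclideanSpace.single j (1 : ℝ)) k (fun y => f (y, q)) y = ld (dX j) k f (y, q) := by
  unfold ld
  congr 1
  funext t
  simp [dX]

/-- uniform family of cutoffs -/
lemma cutoffs (n m : ℕ) : ∃ B : ℝ, 1 ≤ B ∧ ∀ R : ℝ, 1 ≤ R → ∃ χ : EE n → ℂ, ContDiff ℝ (⊤ : ℕ∞) χ ∧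
    HasCompactSupport χ ∧ (∀ x, ‖x‖ ≤ R → χ x = 1) ∧ (∀ x, ‖χ x‖ ≤ 1) ∧
    ∀ j, ∀ k ≤ m, ∀ z, ‖ld (EuclideanSpace.single j (1 : ℝ)) k χ z‖ ≤ B := by
  let b : ContDiffBump (0 : EE n) := ⟨1, 2, by norm_num, by norm_num⟩
  set χ : EE n → ℂ := fun x => ((b x : ℝ) : ℂ) with hχ
  have hs : ContDiff ℝ (⊤ : ℕ∞) χ := Complex.ofRealCLM.contDiff.comp b.contDiff
  have hc : HasCompactSupport χ := b.hasCompactSupport.comp_left (g := fun r : ℝ => (r : ℂ)) (by simp)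
  obtain ⟨B, hB⟩ := bump_bounds χ hs hc m
  refine ⟨max B 1, le_max_right _ _, fun R hR => ⟨fun x => χ (R⁻¹ • x), ?_, ?_, ?_, ?_, ?_⟩⟩
  · exact hs.comp (contDiff_const_smul _)
  · exact hc.comp_smul (inv_ne_zero (by positivity))
  · intro x hx
    simp only [hχ]
    rw [b.one_of_mem_closedBall]
    · simp
    · simp only [mem_closedBall_zero_iff, norm_smul, norm_inv, Real.norm_of_nonneg (zero_le_one.trans hR)]
      change R⁻¹ * ‖x‖ ≤ 1
      rw [inv_mul_le_iff₀ (by positivity)]; linarith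
  · intro x
    simp only [hχ]
    rw [Complex.norm_real, Real.norm_of_nonneg b.nonneg]
    exact b.le_one
  · intro j k hk z
    rw [ld_smul_arg _ _ _ hs, norm_mul]
    have h1 : ‖((R⁻¹ : ℝ) : ℂ) ^ k‖ ≤ 1 := by
      rw [norm_pow, Complex.norm_real, Real.norm_of_nonneg (by positivity)]
      exact pow_le_one₀ (by positivity) (inv_le_one_of_one_le₀ hR)
    calc _ ≤ 1 * B := by
          apply mul_le_mul h1 (hB j k hk _) (norm_nonneg _) zero_le_one
      _ ≤ _ := by rw [one_mul]; exact le_max_left _ _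

lemma osc_wz_bound {n : ℕ} (v : EE n → ℂ) (ζ x : EE n) :
    ‖osc (wz v ζ) x‖ ≤ ∫ s, Ee s * ‖v (ζ - s)‖ := by
  unfold osc
  refine (norm_integral_le_integral_norm _).trans (le_of_eq ?_)
  congr 1; funext s
  unfold wz
  rw [norm_mul, norm_eI, one_mul, norm_mul, Complex.norm_real, Real.norm_of_nonneg (Ee_nonneg s)]

lemma conv_int {n : ℕ} (v : EE n → ℂ) (hv : Integrable v) :
    Integrable (fun p : EE n × EE n => (Ee p.2 : ℂ) * v (p.1 - p.2)) (volume.prod volume) :=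
  (Integrable.convolution_integrand (ContinuousLinearMap.mul ℝ ℂ) (Ee_int (n := n)).ofReal hv)

lemma conv_int' {n : ℕ} (v : EE n → ℂ) (hv : Integrable v) :
    Integrable (fun ζ : EE n => ∫ s, Ee s * ‖v (ζ - s)‖) := by
  refine (conv_int v hv).norm.integral_prod_left.congr (Filter.Eventually.of_forall fun ζ => ?_)
  simp only
  congr 1; funext s
  rw [norm_mul, Complex.norm_real, Real.norm_of_nonneg (Ee_nonneg s)]

lemma osc_wz_meas {n : ℕ} (v : EE n → ℂ) (hv : Measurable v) :
    Measurable fun p : EE n × EE n => osc (wz v p.2) p.1 := by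
  unfold osc
  refine meas_int' (fun p : (EE n × EE n) × EE n => eI (-⟪p.1.1, p.2⟫) * wz v p.1.2 p.2) ?_
  unfold wz
  fun_prop

lemma Tv_rep {n : ℕ} (a : EE n × EE n → ℂ) (ha : ContDiff ℝ (⊤ : ℕ∞) a) (A A2 : ℝ)
    (h : ∀ β : Fin n → ℕ, (∀ i, β i ≤ 1) → ∀ z, ‖mderiv dY β a z‖ ≤ A)
    (h2 : ∀ z, ‖Lop n dY a z‖ ≤ A2) (v : EE n → ℂ) (hv : Nice v) (x : EE n) :
    ∫ ξ, eI ⟪x, ξ⟫ * a (x, ξ) * v ξ = ∫ ζ, eI ⟪x, ζ⟫ * (Lop n dY a (x, ζ) * osc (wz v ζ) x) := by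
  have hLc : Continuous (Lop n dY a) := (Lop_smooth n dY a ha).continuous
  have hvm := hv.1
  set L := Lop n dY a with hL
  clear_value L
  have hvi := hv.integrable
  set G : EE n → EE n → ℂ := fun ξ s => (eI ⟪x, ξ⟫ * L (x, ξ + s)) * (v ξ * (Ee s : ℂ)) with hG
  have hGi : Integrable (Function.uncurry G) (volume.prod volume) := by
    have hLm : Measurable fun p : EE n × EE n => L (x, p.1 + p.2) :=
      hLc.measurable.comp (by fun_prop)
    refine int_bdd_mul (fun p : EE n × EE n => eI ⟪x, p.1⟫ * L (x, p.1 + p.2))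
      (fun p => v p.1 * (Ee p.2 : ℂ)) (by fun_prop) A2 (fun p => ?_) ?_ ?_
    · rw [norm_mul, norm_eI, one_mul]; exact h2 _
    · fun_prop
    · exact hvi.mul_prod (Ee_int (n := n)).ofReal
  set H : EE n → EE n → ℂ := fun ζ s => (eI ⟪x, ζ - s⟫ * L (x, ζ)) * ((Ee s : ℂ) * v (ζ - s)) with hH
  have hHi : Integrable (Function.uncurry H) (volume.prod volume) := by
    have hLm : Measurable fun p : EE n × EE n => L (x, p.1) :=
      hLc.measurable.comp (by fun_prop)
    refine int_bdd_mul (fun p : EE n × EE n => eI ⟪x, p.1 - p.2⟫ * L (x, p.1))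
      (fun p => (Ee p.2 : ℂ) * v (p.1 - p.2)) (by fun_prop) A2 (fun p => ?_) ?_ ?_
    · rw [norm_mul, norm_eI, one_mul]; exact h2 _
    · fun_prop
    · exact conv_int v hvi
  calc _ = ∫ ξ, ∫ s, G ξ s := by
        congr 1; funext ξ
        rw [rep_amp a ha A h x ξ, ← hL, ← integral_const_mul, ← integral_mul_const]
        congr 1; funext s
        simp only [hG]; ring
    _ = ∫ s, ∫ ξ, G ξ s := integral_integral_swap hGi
    _ = ∫ s, ∫ ζ, H ζ s := by
        congr 1; funext s
        rw [← integral_sub_right_eq_self (fun ξ => G ξ s) s]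
        congr 1; funext ζ
        simp only [hG, hH, sub_add_cancel]; ring
    _ = ∫ ζ, ∫ s, H ζ s := (integral_integral_swap hHi).symm
    _ = _ := by
        congr 1; funext ζ
        unfold osc wz
        rw [← integral_const_mul, ← integral_const_mul]
        congr 1; funext s
        have e : eI ⟪x, ζ - s⟫ = eI ⟪x, ζ⟫ * eI (-⟪x, s⟫) := by
          rw [inner_sub_right, sub_eq_add_neg, eI_add]
        simp only [hH, e]
        ring

lemma step2 (n : ℕ) (A : ℝ) (hA : 0 ≤ A) : ∃ C : ℝ≥0∞, C ≠ ⊤ ∧ ∀ a : EE n × EE n → ℂ,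
    ContDiff ℝ (⊤ : ℕ∞) a →
    (∀ α β : Fin n → ℕ, mdeg α ≤ n / 2 + 1 → (∀ i, β i ≤ 1) →
      ∀ z, ‖mderiv dX α (mderiv dY β a) z‖ ≤ A) →
    ∀ v : EE n → ℂ, Nice v → n2 (fun x => ∫ ξ, eI ⟪x, ξ⟫ * a (x, ξ) * v ξ) ≤ C * n2 v := by
  set m := n / 2 + 1 with hm
  obtain ⟨B, hB1, hB⟩ := cutoffs n m
  set A2 := 2 ^ n * A with hA2
  have hA20 : 0 ≤ A2 := by positivity
  have hB0 : 0 ≤ B := zero_le_one.trans hB1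
  obtain ⟨C, hC, hcore⟩ := core n m (by omega) (A2 + 2 ^ m * (B * A2)) (by positivity)
  refine ⟨C, hC, fun a ha hab v hv => ?_⟩
  have hvm := hv.1
  have hvi := hv.integrable
  have h0 : ∀ β : Fin n → ℕ, (∀ i, β i ≤ 1) → ∀ z, ‖mderiv dY β a z‖ ≤ A := by
    intro β hβ z
    have := hab (fun _ => 0) β (by simp [mdeg]) hβ z
    rwa [mderiv_zero] at this
  have hLs := Lop_smooth n dY a ha
  have hL0 : ∀ z, ‖Lop n dY a z‖ ≤ A2 := fun z =>
    Lop_bound n dY a ha A (fun g => g z) (fun _ _ _ _ => rfl) (fun β hβ => h0 β hβ z)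
  have hLd : ∀ j, ∀ k ≤ m, ∀ z, ‖(dLine (dX j))^[k] (Lop n dY a) z‖ ≤ A2 := fun j k hk z =>
    Lop_bound n dY a ha A (fun g => (dLine (dX j))^[k] g z)
      (fun f g hf hg => congrFun (dLine_iter_sub (dX j) f g hf hg k) z) (fun β hβ => by
        have := hab (Pi.single j k) β (by rw [mdeg_single]; exact hk) hβ z
        rwa [mderiv_single] at this)
  have hrep := Tv_rep a ha A A2 h0 hL0 v hv
  have ham : Measurable a := ha.continuous.measurable
  have ha0 : ∀ z, ‖a z‖ ≤ A := fun z => by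
    have := h0 (fun _ => 0) (by simp) z
    rwa [mderiv_zero] at this
  refine duality _ ?_ (A * ∫ ξ, ‖v ξ‖) ?_ _ ?_
  · refine meas_int (fun p => eI ⟪p.1, p.2⟫ * a (p.1, p.2) * v p.2) ?_
    fun_prop
  · intro x
    refine norm_int_le_L1 _ _ _ (fun ξ => ?_) hvi
    rw [norm_mul, norm_mul, norm_eI, one_mul]
    gcongr
    exact ha0 _
  intro g hgm hgi hgR _
  obtain ⟨R, hR⟩ := hgR
  obtain ⟨χ, hχs, hχc, hχ1, hχb, hχd⟩ := hB (max R 1) (le_max_right _ _)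
  set L := Lop n dY a with hL
  clear_value L
  have hcr := hcore (fun p => χ p.1 * L p) (fun ζ => hχs.mul (hLs.comp (contDiff_id.prodMk contDiff_const)))
    (fun ζ => hχc.mul_right) (fun z => by
      rw [norm_mul]
      have : ‖χ z.1‖ * ‖L z‖ ≤ 1 * A2 := mul_le_mul (hχb _) (hL0 z) (norm_nonneg _) zero_le_one
      have : 0 ≤ 2 ^ m * (B * A2) := by positivity
      linarith) (fun j k hk ζ z => by
      have hLz : ContDiff ℝ (⊤ : ℕ∞) fun x => L (x, ζ) := hLs.comp (contDiff_id.prodMk contDiff_const)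
      refine (ld_mul_bound _ m χ (fun x => L (x, ζ)) z (contDiff_infty.1 hχs m).contDiffAt
        (contDiff_infty.1 hLz m).contDiffAt B A2 (fun i hi => hχd j i hi z) (fun i hi => ?_) k hk).trans ?_
      · rw [ld_slice, ld_eq_dLine_iter _ _ _ _ hLs]
        exact hLd j i hi _
      · linarith) v g hv hgm hgi
  refine le_trans (le_of_eq ?_) hcr
  congr 2
  have hom := osc_wz_meas v hvm
  set F : EE n → EE n → ℂ := fun x ζ => (χ x * L (x, ζ) * osc (wz v ζ) x) * (eI ⟪x, ζ⟫ * g x) with hF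
  have hFi : Integrable (Function.uncurry F) (volume.prod volume) := by
    have hcm := hχs.continuous.measurable
    have hLm := hLs.continuous.measurable
    have hFm : Measurable (Function.uncurry F) := by
      simp only [hF, Function.uncurry_def]
      fun_prop
    refine ((hgi.norm.mul_prod (conv_int' v hvi)).const_mul A2).mono' hFm.aestronglyMeasurable ?_
    filter_upwards with p
    simp only [hF, Function.uncurry_def, norm_mul, norm_eI, one_mul]
    have b1 := osc_wz_bound v p.2 p.1
    have b2 : ‖χ p.1‖ * ‖L (p.1, p.2)‖ ≤ 1 * A2 := mul_le_mul (hχb _) (hL0 _) (norm_nonneg _) zero_le_one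
    have b3 := mul_le_mul b2 b1 (norm_nonneg _) (by linarith)
    have b4 := mul_le_mul_of_nonneg_right b3 (norm_nonneg (g p.1))
    linarith
  rw [← integral_integral_swap hFi]
  congr 1; funext x
  rw [hrep x, ← integral_mul_const]
  congr 1; funext ζ
  simp only [hF]
  by_cases hx : R ≤ ‖x‖
  · rw [hR x hx]; simp
  · rw [hχ1 x ((le_of_not_ge hx).trans (le_max_left _ _))]
    ring

/-! ### Assembly -/

lemma eLpNorm_n2 {n : ℕ} (f : EE n → ℂ) : eLpNorm f 2 volume = (n2 f) ^ (1 / (2:ℝ)) := by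
  rw [eLpNorm_eq_lintegral_rpow_enorm_toReal (by norm_num) (by norm_num)]
  simp [n2]

lemma main_n2 (n : ℕ) (C₀ : ℝ) (hC₀ : 0 < C₀) (Cph : (Fin n → ℕ) → ℝ) (A : ℝ) :
    ∃ C : ℝ≥0∞, C ≠ ⊤ ∧
      ∀ (φ : EE n × EE n → ℝ) (a : EE n × EE n → ℂ) (K : Set (EE n)), IsCompact K →
        ContDiff ℝ (⊤ : ℕ∞) φ →
        (∀ z, C₀ ≤ |Matrix.det (Matrix.of fun i j => mixedHessXY φ i j z)|) →
        (∀ i j : Fin n, ∀ α : Fin n → ℕ, mdeg α ≤ 2 * n + 1 →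
          (∀ z, |mderiv dX α (mixedHessXY φ i j) z| ≤ Cph α) ∧
          (∀ z, |mderiv dY α (mixedHessXY φ i j) z| ≤ Cph α)) →
        (∀ x ξ, ξ ∉ K → a (x, ξ) = 0) →
        ContDiff ℝ (⊤ : ℕ∞) a →
        (∀ α β : Fin n → ℕ, mdeg α ≤ n / 2 + 1 → (∀ i, β i ≤ 1) →
          ∀ z, ‖mderiv dX α (mderiv dY β a) z‖ ≤ A) →
        ∀ u : 𝓢(EE n, ℂ),
          n2 (fun x => ∫ ξ, ∫ y,
              Complex.exp (Complex.I * ((⟪x, ξ⟫ + φ (y, ξ) : ℝ) : ℂ)) * a (x, ξ) * u y)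
            ≤ C * n2 (⇑u) := by
  set D : ℝ := ∑ m : Fin n, ∑ k ∈ Finset.range (2 * n + 2), |Cph (Pi.single m k)| with hD
  have hDle : ∀ (m : Fin n), ∀ k ≤ 2 * n + 1, Cph (Pi.single m k) ≤ D := by
    intro m k hk
    refine (le_abs_self _).trans ?_
    refine (Finset.single_le_sum (f := fun k => |Cph (Pi.single m k)|) (fun _ _ => abs_nonneg _)
      (Finset.mem_range.2 (by omega : k < 2 * n + 2))).trans ?_
    exact Finset.single_le_sum (f := fun m : Fin n => ∑ k ∈ Finset.range (2 * n + 2), |Cph (Pi.single m k)|)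
      (fun _ _ => Finset.sum_nonneg fun _ _ => abs_nonneg _) (Finset.mem_univ m)
  obtain ⟨c, B, hc, hB, hph⟩ := HypPh.toPhH n C₀ D hC₀
  obtain ⟨C1, hC1, h1⟩ := step1 n c B hc hB
  obtain ⟨C2, hC2, h2⟩ := step2 n |A| (abs_nonneg A)
  refine ⟨C2 * C1, ENNReal.mul_ne_top hC2 hC1, fun φ a K hK hφ hdet hder haK ha hab u => ?_⟩
  have hyp : HypPh n C₀ D φ := by
    refine ⟨hφ, hdet, fun i j m k hk z => ?_⟩
    have := hder i j (Pi.single m k) (by rw [mdeg_single]; exact hk)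
    rw [mderiv_single, mderiv_single] at this
    exact ⟨(this.1 z).trans (hDle m k hk), (this.2 z).trans (hDle m k hk)⟩
  have hum : Measurable (⇑u) := u.continuous.measurable
  have hui : Integrable (⇑u) := u.integrable
  have hS := h1 φ (hph φ hyp) (hph _ hyp.swap) u hum hui
  set S : EE n → ℂ := fun ξ => ∫ y, eI (φ (y, ξ)) * u y with hSdef
  have hφm : Measurable φ := hφ.continuous.measurable
  have hSm : Measurable S := by
    refine meas_int (fun p => eI (φ (p.2, p.1)) * u p.2) ?_
    have : Measurable fun p : EE n × EE n => u p.2 := hum.comp measurable_snd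
    fun_prop
  have hv : Nice (K.indicator S) := by
    refine ⟨hSm.indicator hK.measurableSet, ⟨∫ y, ‖u y‖, fun ξ => ?_⟩, ?_⟩
    · refine (norm_indicator_le_norm_self _ _).trans ?_
      have := norm_int_le_L1 (fun y => eI (φ (y, ξ)) * u y) u 1
        (fun y => by rw [norm_mul, norm_eI]) hui
      rwa [one_mul] at this
    · obtain ⟨R, hR⟩ := hK.isBounded.subset_closedBall (0 : EE n)
      refine ⟨R + 1, fun x hx => Set.indicator_of_notMem (fun hxK => ?_) _⟩
      have := hR hxK
      rw [mem_closedBall_zero_iff] at this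
      linarith
  have hT := h2 a ha (fun α β h1 h2 z => (hab α β h1 h2 z).trans (le_abs_self A)) _ hv
  have e : (fun x => ∫ ξ, ∫ y,
      Complex.exp (Complex.I * ((⟪x, ξ⟫ + φ (y, ξ) : ℝ) : ℂ)) * a (x, ξ) * u y) =
      fun x => ∫ ξ, eI ⟪x, ξ⟫ * a (x, ξ) * K.indicator S ξ := by
    funext x
    congr 1; funext ξ
    by_cases hξ : ξ ∈ K
    · rw [Set.indicator_of_mem hξ, hSdef, ← integral_const_mul]
      congr 1; funext y
      have : Complex.exp (Complex.I * ((⟪x, ξ⟫ + φ (y, ξ) : ℝ) : ℂ)) = eI ⟪x, ξ⟫ * eI (φ (y, ξ)) :=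
        eI_add _ _
      rw [this]; ring
    · simp [haK x ξ hξ]
  rw [e]
  refine hT.trans ?_
  rw [mul_assoc]
  refine mul_le_mul_right (le_trans ?_ hS) C2
  refine lintegral_mono fun ξ => ?_
  gcongr
  exact enorm_indicator_le_enorm_self _ _

/-- `L²`-boundedness of `Tu(x) = ∫∫ e^{i(x·ξ+φ(y,ξ))} a(x,ξ) u(y) dy dξ` when `∂_x^α ∂_ξ^β a ∈ L^∞` for `|α| ≤ ⌊n/2⌋+1` and `β ∈ {0,1}ⁿ`, with constant depending only on `n`, `C₀`, the phase constants and the listed sup-norms (bounded by `A`), independent of the compact set `K`. -/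
theorem statement6 (n : ℕ) (C₀ : ℝ) (hC₀ : 0 < C₀) (Cph : (Fin n → ℕ) → ℝ) (A : ℝ) :
    ∃ C : ℝ, 0 < C ∧
      ∀ (φ : EuclideanSpace ℝ (Fin n) × EuclideanSpace ℝ (Fin n) → ℝ)
        (a : EuclideanSpace ℝ (Fin n) × EuclideanSpace ℝ (Fin n) → ℂ)
        (K : Set (EuclideanSpace ℝ (Fin n))), IsCompact K →
        ContDiff ℝ (⊤ : ℕ∞) φ →
        -- nondegeneracy of the mixed Hessian `∂_y∂_ξ φ`:
        (∀ z, C₀ ≤ |Matrix.det (Matrix.of fun i j => mixedHessXY φ i j z)|) →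
        -- bounded derivatives of the entries of `∂_y∂_ξ φ`:
        (∀ i j : Fin n, ∀ α : Fin n → ℕ, mdeg α ≤ 2 * n + 1 →
          (∀ z, |mderiv dX α (mixedHessXY φ i j) z| ≤ Cph α) ∧
          (∀ z, |mderiv dY α (mixedHessXY φ i j) z| ≤ Cph α)) →
        -- `a` vanishes for `ξ` outside the compact set `K`:
        (∀ x ξ, ξ ∉ K → a (x, ξ) = 0) →
        ContDiff ℝ (⊤ : ℕ∞) a →
        -- derivatives: `|α| ≤ ⌊n/2⌋+1` in `x` and `β ∈ {0,1}ⁿ` in `ξ`, bounded by `A`: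
        (∀ α β : Fin n → ℕ, mdeg α ≤ n / 2 + 1 → (∀ i, β i ≤ 1) →
          ∀ z, ‖mderiv dX α (mderiv dY β a) z‖ ≤ A) →
        ∀ u : 𝓢(EuclideanSpace ℝ (Fin n), ℂ),
          eLpNorm (fun x => ∫ ξ, ∫ y,
              Complex.exp (Complex.I * ((⟪x, ξ⟫ + φ (y, ξ) : ℝ) : ℂ)) * a (x, ξ) * u y)
              2 volume
            ≤ ENNReal.ofReal C * eLpNorm (⇑u) 2 volume := by
  obtain ⟨C, hC, h⟩ := main_n2 n C₀ hC₀ Cph A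
  refine ⟨(C ^ (1 / (2:ℝ))).toReal + 1, by positivity, fun φ a K hK hφ hdet hder haK ha hab u => ?_⟩
  have hu := h φ a K hK hφ hdet hder haK ha hab u
  have hCt : C ^ (1 / (2:ℝ)) ≠ ⊤ := ENNReal.rpow_ne_top_of_nonneg (by norm_num) hC
  rw [eLpNorm_n2, eLpNorm_n2]
  refine (ENNReal.rpow_le_rpow hu (by norm_num)).trans ?_
  rw [ENNReal.mul_rpow_of_nonneg _ _ (by norm_num)]
  gcongr
  calc C ^ (1 / (2:ℝ)) = ENNReal.ofReal (C ^ (1 / (2:ℝ))).toReal := (ENNReal.ofReal_toReal hCt).symm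
    _ ≤ _ := ENNReal.ofReal_le_ofReal (by linarith)
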